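/- (Kerékjártó, Eilenberg) Let δ = σ_1 σ_2 ⋯ σ_{n−1} and α = σ_1 σ_2 ⋯ σ_{n−1} σ_1 in B_n (n ≥ 2). Then δ^n = α^{n−1} = Δ_n², and an element ω ∈ B_n is periodic (i.e. ω^k is an integer power of the full twist Δ_n² for some integer k ≥ 1) if and only if ω is conjugate in B_n to δ^j or to α^j for some integer j. -/

import Mathlib

/-- The set of relators for Artin's classical presentation of the braid group `Bₙ`:
generators `σ₁, …, σ_{n-1}` (indexed by `Fin (n-1)`), with relations
`σᵢ σₖ = σₖ σᵢ` when `|i - k| ≥ 2` and `σᵢ σ_{i+1} σᵢ = σ_{i+1} σᵢ σ_{i+1}`. -/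
def braidRels (n : ℕ) : Set (FreeGroup (Fin (n - 1))) :=
  {w | (∃ i k : Fin (n - 1), (i : ℕ) + 2 ≤ (k : ℕ) ∧
          w = FreeGroup.of i * FreeGroup.of k * (FreeGroup.of k * FreeGroup.of i)⁻¹) ∨
       (∃ i k : Fin (n - 1), (i : ℕ) + 1 = (k : ℕ) ∧
          w = FreeGroup.of i * FreeGroup.of k * FreeGroup.of i *
              (FreeGroup.of k * FreeGroup.of i * FreeGroup.of k)⁻¹)}

/-- The braid group `Bₙ`, given by Artin's classical presentation. -/
abbrev BraidGroup (n : ℕ) : Type := PresentedGroup (braidRels n)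

/-- The generator `σ_{i+1}` of `Bₙ` for a natural-number index `i < n - 1`
(junk value `1` otherwise). -/
def sigmaB (n : ℕ) (i : ℕ) : BraidGroup n :=
  if h : i < n - 1 then PresentedGroup.of (⟨i, h⟩ : Fin (n - 1)) else 1

/-- The Garside element
`Δₙ = (σ_{n-1} ⋯ σ₁)(σ_{n-1} ⋯ σ₂) ⋯ (σ_{n-1} σ_{n-2})(σ_{n-1}) ∈ Bₙ`
(written with the 0-indexed Lean generators `x_j = σ_{j+1}`). -/
def deltaB (n : ℕ) : BraidGroup n :=
  ((List.range (n - 1)).map fun k =>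
    ((List.range (n - 1 - k)).map fun j => sigmaB n (n - 2 - j)).prod).prod


/-- The periodic element `δ = σ₁ σ₂ ⋯ σ_{n-1} ∈ Bₙ`. -/
def deltaSmall (n : ℕ) : BraidGroup n :=
  ((List.range (n - 1)).map fun i => sigmaB n i).prod

/-- The periodic element `α = σ₁ σ₂ ⋯ σ_{n-1} σ₁ ∈ Bₙ`. -/
def alphaB (n : ℕ) : BraidGroup n := deltaSmall n * sigmaB n 0

namespace Noncrossing

open Equiv Module

/-- The functions on `Fin n` invariant under the permutation `w`. -/
def fixed {n : ℕ} (w : Perm (Fin n)) : Submodule ℚ (Fin n → ℚ) where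
  carrier := {f | ∀ i, f (w i) = f i}
  add_mem' := by
    intro f g hf hg i
    simp only [Set.mem_ofPred_eq, Pi.add_apply] at *
    rw [hf, hg]
  zero_mem' := fun _ => rfl
  smul_mem' := by
    intro a f hf i
    simp only [Set.mem_ofPred_eq, Pi.smul_apply] at *
    rw [hf]

theorem mem_fixed {n : ℕ} {w : Perm (Fin n)} {f : Fin n → ℚ} :
    f ∈ fixed w ↔ ∀ i, f (w i) = f i := Iff.rfl

/-- The absolute (reflection) length of a permutation. -/
noncomputable def len {n : ℕ} (w : Perm (Fin n)) : ℕ := n - finrank ℚ (fixed w)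

theorem finrank_add_len {n : ℕ} (w : Perm (Fin n)) : finrank ℚ (fixed w) + len w = n := by
  have h := (fixed w).finrank_le
  rw [finrank_fin_fun] at h
  unfold len
  omega

theorem len_lt_of_fixed_lt {n : ℕ} {u v : Perm (Fin n)} (h : fixed u < fixed v) :
    len v < len u := by
  have h1 := Submodule.finrank_lt_finrank_of_lt h
  have h2 := finrank_add_len u
  have h3 := finrank_add_len v
  omega

theorem len_le_of_fixed_le {n : ℕ} {u v : Perm (Fin n)} (h : fixed u ≤ fixed v) :
    len v ≤ len u := by
  have h1 := Submodule.finrank_mono h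
  have h2 := finrank_add_len u
  have h3 := finrank_add_len v
  omega

theorem fixed_eq_of_le {n : ℕ} {u v : Perm (Fin n)} (h : fixed u ≤ fixed v)
    (h' : len u ≤ len v) : fixed u = fixed v := by
  rcases h.lt_or_eq with h1 | h1
  · have := len_lt_of_fixed_lt h1
    omega
  · exact h1

@[simp] theorem fixed_one {n : ℕ} : fixed (1 : Perm (Fin n)) = ⊤ := by
  ext f
  simp [mem_fixed]

@[simp] theorem len_one {n : ℕ} : len (1 : Perm (Fin n)) = 0 := by
  unfold len
  rw [fixed_one, finrank_top, finrank_fin_fun, Nat.sub_self]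

theorem eq_one_of_len_eq_zero {n : ℕ} {u : Perm (Fin n)} (h : len u = 0) : u = 1 := by
  have h1 : fixed (1 : Perm (Fin n)) = fixed u := by
    symm
    apply fixed_eq_of_le
    · simp
    · omega
  ext i
  have h2 : Pi.single i (1 : ℚ) ∈ fixed u := by
    rw [← h1]
    simp
  have h3 := h2 i
  by_contra h4
  have h5 : u i ≠ i := fun h => h4 (by rw [h]; rfl)
  simp [h5] at h3

theorem inf_le_fixed_mul {n : ℕ} (u v : Perm (Fin n)) :
    fixed u ⊓ fixed v ≤ fixed (u * v) := by
  rintro f ⟨hu, hv⟩ i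
  rw [Perm.mul_apply, hu, hv]

theorem le_finrank_inf {n : ℕ} (u v : Perm (Fin n)) :
    n ≤ finrank ℚ ↥(fixed u ⊓ fixed v) + (len u + len v) := by
  have h := Submodule.finrank_sup_add_finrank_inf_eq (fixed u) (fixed v)
  have h1 := (fixed u ⊔ fixed v).finrank_le
  rw [finrank_fin_fun] at h1
  have h2 := finrank_add_len u
  have h3 := finrank_add_len v
  omega

theorem len_mul_le {n : ℕ} (u v : Perm (Fin n)) : len (u * v) ≤ len u + len v := by
  have h := le_finrank_inf u v
  have h1 := Submodule.finrank_mono (inf_le_fixed_mul u v)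
  have h2 := finrank_add_len (u * v)
  omega

theorem fixed_mul_of_len {n : ℕ} {u v : Perm (Fin n)} (h : len (u * v) = len u + len v) :
    fixed (u * v) = fixed u ⊓ fixed v := by
  symm
  apply Submodule.eq_of_le_of_finrank_le (inf_le_fixed_mul u v)
  have h1 := le_finrank_inf u v
  have h2 := finrank_add_len (u * v)
  omega

theorem len_conj {n : ℕ} (u v : Perm (Fin n)) : len (u * v * u⁻¹) ≤ len v := by
  have h1 : finrank ℚ (fixed v) ≤ finrank ℚ (fixed (u * v * u⁻¹)) := by
    rw [← LinearEquiv.finrank_map_eq (LinearEquiv.funCongrLeft ℚ ℚ u⁻¹)]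
    apply Submodule.finrank_mono
    rintro _ ⟨f, hf, rfl⟩ i
    have := hf (u⁻¹ i)
    simpa [LinearMap.funLeft] using this
  have h2 := finrank_add_len v
  have h3 := finrank_add_len (u * v * u⁻¹)
  omega

theorem len_mul_comm {n : ℕ} (u v : Perm (Fin n)) : len (u * v) = len (v * u) := by
  have h1 := len_conj v (u * v)
  have h2 := len_conj u (v * u)
  rw [show v * (u * v) * v⁻¹ = v * u by group] at h1
  rw [show u * (v * u) * u⁻¹ = u * v by group] at h2
  omega

/-- Two points are connected when every invariant function takes the same value at them. -/
def Conn {n : ℕ} (w : Perm (Fin n)) (i j : Fin n) : Prop := ∀ f ∈ fixed w, f i = f j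

theorem Conn.refl {n : ℕ} (w : Perm (Fin n)) (i : Fin n) : Conn w i i := fun _ _ => rfl

theorem Conn.symm {n : ℕ} {w : Perm (Fin n)} {i j : Fin n} (h : Conn w i j) : Conn w j i :=
  fun f hf => (h f hf).symm

theorem Conn.trans {n : ℕ} {w : Perm (Fin n)} {i j k : Fin n} (h : Conn w i j)
    (h' : Conn w j k) : Conn w i k :=
  fun f hf => (h f hf).trans (h' f hf)

theorem conn_apply {n : ℕ} (w : Perm (Fin n)) (i : Fin n) : Conn w (w i) i :=
  fun _ hf => hf i

open Classical in
/-- The indicator function of the cycle of `i`. -/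
noncomputable def cycleInd {n : ℕ} (w : Perm (Fin n)) (i k : Fin n) : ℚ :=
  if Conn w i k then 1 else 0

theorem cycleInd_mem {n : ℕ} (w : Perm (Fin n)) (i : Fin n) : cycleInd w i ∈ fixed w := by
  intro k
  have : Conn w i (w k) ↔ Conn w i k :=
    ⟨fun h => h.trans (conn_apply w k), fun h => h.trans (conn_apply w k).symm⟩
  by_cases h : Conn w i k <;> simp [cycleInd, this, h]

theorem cycleInd_eq_one {n : ℕ} {w : Perm (Fin n)} {i k : Fin n} :
    cycleInd w i k = 1 ↔ Conn w i k := by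
  unfold cycleInd
  split_ifs with h <;> simp [h]

theorem fixed_le_iff {n : ℕ} {u v : Perm (Fin n)} :
    fixed u ≤ fixed v ↔ ∀ i, Conn u (v i) i :=
  ⟨fun h i _ hf => h hf i, fun h f hf i => h i f hf⟩

theorem mem_fixed_swap_mul {n : ℕ} {w : Perm (Fin n)} {f : Fin n → ℚ} {p q : Fin n}
    (hf : f ∈ fixed w) (h : f p = f q) : f ∈ fixed (swap p q * w) := by
  intro i
  rw [Perm.mul_apply, swap_apply_def]
  have := hf i
  split_ifs with h1 h2
  · rw [← h, ← h1, this]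
  · rw [h, ← h2, this]
  · exact this

theorem fixed_le_swap_mul {n : ℕ} {w : Perm (Fin n)} {p q : Fin n} (h : Conn w p q) :
    fixed w ≤ fixed (swap p q * w) :=
  fun f hf => mem_fixed_swap_mul hf (h f hf)

theorem len_swap {n : ℕ} {p q : Fin n} (h : p ≠ q) : len (swap p q) = 1 := by
  have h0 : len (swap p q) ≠ 0 := by
    intro h0
    exact h (swap_eq_one_iff.1 (eq_one_of_len_eq_zero h0))
  have h1 : LinearMap.ker (LinearMap.proj (R := ℚ) (φ := fun _ : Fin n => ℚ) p -
      LinearMap.proj q) ≤ fixed (swap p q) := by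
    intro f hf
    rw [← mul_one (swap p q)]
    apply mem_fixed_swap_mul
    · simp
    · simpa [sub_eq_zero] using hf
  have h2 := Submodule.finrank_mono h1
  have h3 := LinearMap.finrank_range_add_finrank_ker
    (LinearMap.proj (R := ℚ) (φ := fun _ : Fin n => ℚ) p - LinearMap.proj q)
  have h4 := (LinearMap.range (LinearMap.proj (R := ℚ) (φ := fun _ : Fin n => ℚ) p -
    LinearMap.proj q)).finrank_le
  rw [finrank_fin_fun] at h3
  rw [finrank_self] at h4
  have h5 := finrank_add_len (swap p q)
  omega

theorem len_le_swap_mul {n : ℕ} {p q : Fin n} (h : p ≠ q) (w : Perm (Fin n)) :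
    len w ≤ len (swap p q * w) + 1 := by
  have h1 := len_mul_le (swap p q) (swap p q * w)
  rw [swap_mul_self_mul, len_swap h] at h1
  omega

theorem len_swap_apply_mul {n : ℕ} {w : Perm (Fin n)} {q : Fin n} (h : w q ≠ q) :
    len (swap (w q) q * w) + 1 = len w := by
  have h1 : fixed w < fixed (swap (w q) q * w) := by
    refine lt_of_le_of_ne (fixed_le_swap_mul (conn_apply w q)) ?_
    intro h2
    have h3 : Pi.single q (1 : ℚ) ∈ fixed (swap (w q) q * w) := by
      intro i
      by_cases hi : i = q
      · subst hi
        simp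
      · have h4 : (swap (w q) q * w) i ≠ q := by
          intro h5
          apply hi
          apply (swap (w q) q * w).injective
          rw [h5]
          simp
        rw [Pi.single_eq_of_ne hi, Pi.single_eq_of_ne h4]
    rw [← h2] at h3
    have h4 := h3 q
    simp [h] at h4
  have h2 := len_lt_of_fixed_lt h1
  have h3 := len_le_swap_mul h w
  omega

theorem sign_eq {n : ℕ} (w : Perm (Fin n)) : Perm.sign w = (-1) ^ len w := by
  induction hl : len w generalizing w with
  | zero =>
    rw [eq_one_of_len_eq_zero hl]
    simp
  | succ l ih =>
    have h1 : w ≠ 1 := by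
      rintro rfl
      simp at hl
    obtain ⟨q, hq⟩ : ∃ q, w q ≠ q := by
      by_contra! h2
      exact h1 (Perm.ext h2)
    have h2 := len_swap_apply_mul hq
    have h3 := ih (swap (w q) q * w) (by omega)
    rw [Perm.sign_mul, Perm.sign_swap hq] at h3
    rw [pow_succ, ← h3]
    simp

theorem len_swap_mul_of_conn {n : ℕ} {w : Perm (Fin n)} {p q : Fin n} (hpq : p ≠ q)
    (h : Conn w p q) : len (swap p q * w) + 1 = len w := by
  have h1 := len_le_of_fixed_le (fixed_le_swap_mul h)
  have h2 := len_le_swap_mul hpq w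
  have h3 := sign_eq (swap p q * w)
  rw [Perm.sign_mul, Perm.sign_swap hpq, sign_eq w] at h3
  have h4 : len (swap p q * w) ≠ len w := by
    intro h4
    rw [h4] at h3
    rcases neg_one_pow_eq_or ℤˣ (len w) with h5 | h5 <;> rw [h5] at h3 <;>
      exact absurd h3 (by decide)
  omega

end Noncrossing

namespace Noncrossing

open Equiv Module

/-- The absolute order on permutations. -/
def Below {n : ℕ} (u v : Perm (Fin n)) : Prop := len u + len (u⁻¹ * v) = len v

theorem below_iff_le {n : ℕ} {u v : Perm (Fin n)} :
    Below u v ↔ len u + len (u⁻¹ * v) ≤ len v := by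
  have h := len_mul_le u (u⁻¹ * v)
  rw [mul_inv_cancel_left] at h
  unfold Below
  omega

theorem below_mul_iff {n : ℕ} {u v : Perm (Fin n)} :
    Below u (u * v) ↔ len u + len v = len (u * v) := by
  unfold Below
  rw [inv_mul_cancel_left]

theorem below_refl {n : ℕ} (u : Perm (Fin n)) : Below u u := by
  simp [Below]

theorem one_below {n : ℕ} (u : Perm (Fin n)) : Below 1 u := by
  simp [Below]

theorem Below.trans {n : ℕ} {u v w : Perm (Fin n)} (h : Below u v) (h' : Below v w) :
    Below u w := by
  rw [below_iff_le]
  have h1 := len_mul_le (u⁻¹ * v) (v⁻¹ * w)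
  rw [mul_assoc, mul_inv_cancel_left] at h1
  unfold Below at h h'
  omega

theorem Below.len_le {n : ℕ} {u v : Perm (Fin n)} (h : Below u v) : len u ≤ len v := by
  unfold Below at h
  omega

theorem Below.eq_of_len_le {n : ℕ} {u v : Perm (Fin n)} (h : Below u v)
    (h' : len v ≤ len u) : u = v := by
  unfold Below at h
  have := eq_one_of_len_eq_zero (u := u⁻¹ * v) (by omega)
  rw [inv_mul_eq_one] at this
  exact this

theorem Below.antisymm {n : ℕ} {u v : Perm (Fin n)} (h : Below u v) (h' : Below v u) :
    u = v := h.eq_of_len_le h'.len_le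

theorem Below.fixed_le {n : ℕ} {u v : Perm (Fin n)} (h : Below u v) : fixed v ≤ fixed u := by
  have h1 := fixed_mul_of_len (u := u) (v := u⁻¹ * v)
    (by rw [mul_inv_cancel_left]; exact h.symm)
  rw [mul_inv_cancel_left] at h1
  rw [h1]
  exact inf_le_left

/-- Right factors of a reduced product are below the product. -/
theorem Below.right {n : ℕ} {u v : Perm (Fin n)} (h : Below u v) : Below (u⁻¹ * v) v := by
  have h1 : len ((u⁻¹ * v)⁻¹ * v) = len u := by
    rw [len_mul_comm]
    simp [mul_inv_rev]
  unfold Below at *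
  omega

theorem swap_below {n : ℕ} {u : Perm (Fin n)} {p q : Fin n} (hpq : p ≠ q)
    (h : Conn u p q) : Below (swap p q) u := by
  have := len_swap_mul_of_conn hpq h
  unfold Below
  rw [swap_inv, len_swap hpq]
  omega

theorem swap_mul_below {n : ℕ} {u : Perm (Fin n)} {p q : Fin n} (hpq : p ≠ q)
    (h : Conn u p q) : Below (swap p q * u) u := by
  have := (swap_below hpq h).right
  rwa [swap_inv] at this

theorem Below.conn {n : ℕ} {u v : Perm (Fin n)} (h : Below u v) {i j : Fin n}
    (hij : Conn u i j) : Conn v i j := fun f hf => hij f (h.fixed_le hf)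

theorem conn_swap {n : ℕ} (i j : Fin n) : Conn (swap i j) i j := by
  intro f hf
  have := hf j
  simpa using this

theorem rot_val {n : ℕ} (k : Fin n) :
    ((finRotate n k : ℕ) = k + 1 ∧ (k : ℕ) + 1 < n) ∨
      ((finRotate n k : ℕ) = 0 ∧ (k : ℕ) + 1 = n) := by
  cases n with
  | zero => exact k.elim0
  | succ n =>
    rw [coe_finRotate]
    split_ifs with h
    · subst h
      simp
    · left
      have : (k : ℕ) ≠ n := fun h' => h (Fin.ext h')
      have := k.2
      omega

theorem conn_rot {n : ℕ} (i j : Fin n) : Conn (finRotate n) i j := by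
  intro f hf
  have key : ∀ (k : ℕ) (hk : k < n), f ⟨k, hk⟩ = f ⟨0, by omega⟩ := by
    intro k
    induction k with
    | zero => intro _; rfl
    | succ k ih =>
      intro hk
      rw [← ih (by omega), ← hf ⟨k, by omega⟩]
      congr 1
      ext
      rcases rot_val (⟨k, by omega⟩ : Fin n) with h | h
      · exact h.1.symm
      · exact absurd h.2 hk.ne
  exact (key i i.2).trans (key j j.2).symm

theorem indicator_mem_fixed_swap_rot {n : ℕ} {i j : Fin n} (hij : i < j) (k : Fin n) :
    (swap i j * finRotate n) k ∈ Finset.Ico i j ↔ k ∈ Finset.Ico i j := by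
  have h := rot_val k
  have hk := k.2
  rw [Perm.mul_apply, swap_apply_def]
  simp only [Finset.mem_Ico, Fin.le_def, Fin.lt_def, Fin.ext_iff] at *
  split_ifs <;> omega

theorem Below.fixed_swap_mul_le {n : ℕ} {u v : Perm (Fin n)} (h : Below u v) {i j : Fin n}
    (hij : i ≠ j) (hc : Conn u i j) : fixed (swap i j * v) ≤ fixed (swap i j * u) := by
  have h1 := len_swap_mul_of_conn hij hc
  have h2 := len_swap_mul_of_conn hij (h.conn hc)
  have h3 : Below (swap i j * u) (swap i j * v) := by
    unfold Below at *
    rw [mul_inv_rev, mul_assoc, inv_mul_cancel_left]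
    omega
  exact h3.fixed_le

theorem swap_mul_mem_Ico {n : ℕ} {u : Perm (Fin n)} (hu : Below u (finRotate n))
    {i j : Fin n} (hij : i < j) (hc : Conn u i j) (k : Fin n) :
    (swap i j * u) k ∈ Finset.Ico i j ↔ k ∈ Finset.Ico i j := by
  classical
  have h1 : (fun k => if k ∈ Finset.Ico i j then (1 : ℚ) else 0) ∈
      fixed (swap i j * finRotate n) := by
    intro k
    simp only [indicator_mem_fixed_swap_rot hij]
  have h2 := hu.fixed_swap_mul_le hij.ne hc h1 k
  by_cases h3 : (swap i j * u) k ∈ Finset.Ico i j <;> by_cases h4 : k ∈ Finset.Ico i j <;>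
    simp only [h3, h4, if_true, if_false] at h2 ⊢
  · exact absurd h2 one_ne_zero
  · exact absurd h2 zero_ne_one

theorem conn_swap_mul {n : ℕ} {u : Perm (Fin n)} (hu : Below u (finRotate n))
    {i j : Fin n} (hij : i < j) (hc : Conn u i j) {k l : Fin n} (hkl : Conn u k l)
    (h : k ∈ Finset.Ico i j ↔ l ∈ Finset.Ico i j) : Conn (swap i j * u) k l := by
  classical
  intro f hf
  have h1 : (fun m => f m + if m ∈ Finset.Ico i j then 0 else f i - f j) ∈ fixed u := by
    intro m
    have h2 := swap_mul_mem_Ico hu hij hc m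
    have h3 := hf m
    have h4 : u m = swap i j ((swap i j * u) m) := by simp
    rw [h4]
    generalize (swap i j * u) m = y at h2 h3
    simp only [← h2, ← h3]
    by_cases hyi : y = i
    · subst hyi
      simp [hij]
    · by_cases hyj : y = j
      · subst hyj
        simp [hij]
      · rw [swap_apply_of_ne_of_ne hyi hyj]
  have h2 := hkl _ h1
  simp only [h] at h2
  linarith

/-- The property of a permutation of mapping every interval `[w i, i]` to itself. -/
def Nest {n : ℕ} (w : Perm (Fin n)) : Prop :=
  ∀ i k, w i ≤ k → k ≤ i → w i ≤ w k ∧ w k ≤ i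

theorem Below.nest {n : ℕ} {w : Perm (Fin n)} (hw : Below w (finRotate n)) : Nest w := by
  intro i k h1 h2
  rcases h2.eq_or_lt with rfl | h3
  · exact ⟨le_rfl, h1⟩
  have h4 := (swap_mul_mem_Ico hw (lt_of_le_of_lt h1 h3) (conn_apply w i) k).2
    (Finset.mem_Ico.2 ⟨h1, h3⟩)
  have h5 : w k = swap (w i) i ((swap (w i) i * w) k) := by simp
  rw [h5]
  generalize (swap (w i) i * w) k = y at h4
  rw [Finset.mem_Ico] at h4
  rw [swap_apply_def]
  split_ifs with h6 h7
  · exact ⟨h1.trans h2, le_rfl⟩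
  · exact ⟨le_rfl, h1.trans h2⟩
  · exact ⟨h4.1, h4.2.le⟩

theorem exists_apply_lt {n : ℕ} {x : Perm (Fin n)} (h : x ≠ 1) : ∃ q, x q < q := by
  by_contra! h1
  apply h
  have h2 : ∑ q, (x q : ℕ) = ∑ q : Fin n, (q : ℕ) := Equiv.sum_comp x (fun q : Fin n => (q : ℕ))
  have h3 := (Finset.sum_eq_sum_iff_of_le (s := Finset.univ)
    (f := fun q : Fin n => (q : ℕ)) (g := fun q => (x q : ℕ)) (fun q _ => h1 q)).1 h2.symm
  ext q
  exact (h3 q (Finset.mem_univ q)).symm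

theorem mem_of_apply_mem {n : ℕ} (x : Perm (Fin n)) (s : Finset (Fin n))
    (h : ∀ k ∈ s, x k ∈ s) {k : Fin n} (hk : x k ∈ s) : k ∈ s := by
  have h1 : s.image x = s := by
    apply Finset.eq_of_subset_of_card_le
    · intro y hy
      obtain ⟨k, hk, rfl⟩ := Finset.mem_image.1 hy
      exact h k hk
    · rw [Finset.card_image_of_injective _ x.injective]
  rw [← h1] at hk
  obtain ⟨k', hk', h2⟩ := Finset.mem_image.1 hk
  rwa [← x.injective h2]

theorem Nest.swap_mul_mem_Ico {n : ℕ} {x : Perm (Fin n)} (hx : Nest x) {q : Fin n}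
    (hq : x q < q) (k : Fin n) :
    (swap (x q) q * x) k ∈ Finset.Ico (x q) q ↔ k ∈ Finset.Ico (x q) q := by
  have key : ∀ k ∈ Finset.Ico (x q) q, (swap (x q) q * x) k ∈ Finset.Ico (x q) q := by
    intro k hk
    rw [Finset.mem_Ico] at hk
    have h1 := hx q k hk.1 hk.2.le
    have h2 : x k ≠ x q := fun h => hk.2.ne (x.injective h)
    rw [Perm.mul_apply, swap_apply_def, if_neg h2]
    split_ifs with h3
    · exact Finset.mem_Ico.2 ⟨le_rfl, hq⟩
    · exact Finset.mem_Ico.2 ⟨h1.1, lt_of_le_of_ne h1.2 h3⟩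
  exact ⟨mem_of_apply_mem _ _ key, key k⟩

theorem Nest.swap_mul {n : ℕ} {x : Perm (Fin n)} (hx : Nest x) {q : Fin n}
    (hq : x q < q) : Nest (swap (x q) q * x) := by
  intro i k h1 h2
  have hmem := hx.swap_mul_mem_Ico hq
  by_cases hi : x i = q
  · have e1 : (swap (x q) q * x) i = x q := by simp [hi]
    rw [e1] at h1 ⊢
    have hi' : i ∈ Finset.Ico (x q) q := by
      rw [← hmem, e1]
      exact Finset.mem_Ico.2 ⟨le_rfl, hq⟩
    rw [Finset.mem_Ico] at hi'
    have key : ∀ m ∈ Finset.Icc (x q) i,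
        (swap (x q) q * x)⁻¹ m ∈ Finset.Icc (x q) i := by
      intro m hm
      obtain ⟨j, rfl⟩ := (swap (x q) q * x).surjective m
      rw [Perm.inv_def, Equiv.symm_apply_apply]
      rw [Finset.mem_Icc] at hm ⊢
      have hj : j ∈ Finset.Ico (x q) q := by
        rw [← hmem, Finset.mem_Ico]
        exact ⟨hm.1, lt_of_le_of_lt hm.2 hi'.2⟩
      rw [Finset.mem_Ico] at hj
      refine ⟨hj.1, ?_⟩
      by_contra! h3
      have e2 : x j ≠ x q := fun h => hj.2.ne (x.injective h)
      have e3 : x j ≠ q := fun h => h3.ne (x.injective (hi.trans h.symm))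
      rw [Perm.mul_apply, swap_apply_of_ne_of_ne e2 e3] at hm
      have h4 := (hx j i hm.2 h3.le).2
      rw [hi] at h4
      exact absurd (lt_of_le_of_lt h4 hj.2) (lt_irrefl _)
    have h3 := mem_of_apply_mem (swap (x q) q * x)⁻¹ _ key
      (k := (swap (x q) q * x) k) (by
        rw [Perm.inv_def, Equiv.symm_apply_apply]
        exact Finset.mem_Icc.2 ⟨h1, h2⟩)
    exact Finset.mem_Icc.1 h3
  · by_cases hi' : i = q
    · subst hi'
      have e1 : (swap (x i) i * x) i = i := by simp
      rw [e1] at h1 ⊢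
      have := le_antisymm h1 h2
      subst this
      rw [e1]
      exact ⟨le_rfl, le_rfl⟩
    · have e2 : x i ≠ x q := fun h => hi' (x.injective h)
      have e1 : (swap (x q) q * x) i = x i := by
        rw [Perm.mul_apply, swap_apply_of_ne_of_ne e2 hi]
      rw [e1] at h1 ⊢
      have h3 := hx i k h1 h2
      rw [Perm.mul_apply, swap_apply_def]
      split_ifs with h4 h5
      · have := x.injective h4
        subst this
        exact ⟨h1, h2⟩
      · rw [h5] at h3
        exact ⟨(hx i q h3.1 h3.2).1, hq.le.trans h3.2⟩
      · exact h3

theorem Nest.below {n : ℕ} {x u : Perm (Fin n)} (hx : Nest x) (hu : Below u (finRotate n))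
    (h : fixed u ≤ fixed x) : Below x u := by
  induction hl : len x generalizing x u with
  | zero =>
    rw [eq_one_of_len_eq_zero hl]
    exact one_below u
  | succ l ih =>
    obtain ⟨q, hq⟩ : ∃ q, x q < q := by
      apply exists_apply_lt
      rintro rfl
      simp at hl
    have hc : Conn u (x q) q := fixed_le_iff.1 h q
    have h1 := len_swap_mul_of_conn hq.ne hc
    have h2 := len_swap_apply_mul hq.ne
    have h3 := ih (hx.swap_mul hq) ((swap_mul_below hq.ne hc).trans hu) (by
      rw [fixed_le_iff]
      intro k
      refine conn_swap_mul hu hq hc ?_ (hx.swap_mul_mem_Ico hq k)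
      exact fixed_le_iff.1 (h.trans (fixed_le_swap_mul (conn_apply x q))) k) (by omega)
    unfold Below at *
    rw [mul_inv_rev, mul_assoc, inv_mul_cancel_left] at h3
    omega

theorem conn_of_crossing {n : ℕ} {u : Perm (Fin n)} (hu : Below u (finRotate n))
    {a b a' b' : Fin n} (h1 : a < b) (h2 : b < a') (h3 : a' < b') (ha : Conn u a a')
    (hb : Conn u b b') : Conn u a b := by
  classical
  by_contra hab
  have haa := h1.trans h2
  have hz : cycleInd u b a = 0 := by
    unfold cycleInd
    rw [if_neg fun h => hab h.symm]
  have hz' : cycleInd u b a' = 0 := by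
    unfold cycleInd
    rw [if_neg fun h => hab (ha.trans h.symm)]
  have key : (fun k => cycleInd u b k * if k ∈ Finset.Ico a a' then 1 else 0) ∈
      fixed (swap a a' * (swap a a' * u)) := by
    apply mem_fixed_swap_mul
    · intro k
      simp only [swap_mul_mem_Ico hu haa ha]
      rw [fixed_le_swap_mul ha (cycleInd_mem u b) k]
    · simp only [hz, hz', zero_mul]
  rw [swap_mul_self_mul] at key
  have h4 := hb _ key
  have h5 : b ∈ Finset.Ico a a' := Finset.mem_Ico.2 ⟨h1.le, h2⟩
  have h6 : b' ∉ Finset.Ico a a' := by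
    rw [Finset.mem_Ico, not_and, not_lt]
    exact fun _ => h3.le
  simp only [h5, h6, if_true, if_false, mul_one, mul_zero] at h4
  rw [cycleInd_eq_one.2 (Conn.refl u b)] at h4
  exact one_ne_zero h4

theorem exists_nest_of_noncrossing {n : ℕ} (r : Setoid (Fin n))
    (hr : ∀ a b a' b' : Fin n, a < b → b < a' → a' < b' → r a a' → r b b' → r a b) :
    ∃ w : Perm (Fin n), Nest w ∧ (∀ i, r (w i) i) ∧ ∀ i j, r i j → Conn w i j := by
  classical
  have hex : ∀ i : Fin n, ∃ m, r m i ∧ ((i < m ∧ ∀ k, i < k → r k i → m ≤ k) ∨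
      ((∀ k, i < k → ¬ r k i) ∧ ∀ k, r k i → m ≤ k)) := by
    intro i
    by_cases h : ∃ k, i < k ∧ r k i
    · have hne : (Finset.univ.filter fun k => i < k ∧ r k i).Nonempty := by
        obtain ⟨k, hk⟩ := h
        exact ⟨k, by simpa using hk⟩
      have h1 := Finset.min'_mem _ hne
      rw [Finset.mem_filter] at h1
      refine ⟨_, h1.2.2, Or.inl ⟨h1.2.1, fun k hk hki => ?_⟩⟩
      apply Finset.min'_le
      simp [hk, hki]
    · have hne : (Finset.univ.filter fun k => r k i).Nonempty :=
        ⟨i, by simp⟩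
      have h1 := Finset.min'_mem _ hne
      rw [Finset.mem_filter] at h1
      refine ⟨_, h1.2, Or.inr ⟨fun k hk hki => h ⟨k, hk, hki⟩, fun k hki => ?_⟩⟩
      apply Finset.min'_le
      simp [hki]
  choose w hw1 hw2 using hex
  have hlt : ∀ i j, i < j → w i ≠ w j := by
    intro i j hij h
    have hrij : r j i := by
      have := hw1 j
      rw [← h] at this
      exact r.trans' (r.symm' this) (hw1 i)
    rcases hw2 i with h1 | h1
    · have h2 := h1.2 j hij hrij
      rcases hw2 j with h3 | h3
      · rw [h] at h2
        exact absurd (lt_of_lt_of_le h3.1 h2) (lt_irrefl _)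
      · have h4 := h3.2 i (r.symm' hrij)
        rw [← h] at h4
        exact absurd (lt_of_lt_of_le h1.1 h4) (lt_irrefl _)
    · exact h1.1 j hij hrij
  have hinj : Function.Injective w := by
    intro i j h
    rcases lt_trichotomy i j with h1 | h1 | h1
    · exact absurd h (hlt i j h1)
    · exact h1
    · exact absurd h.symm (hlt j i h1)
  refine ⟨Equiv.ofBijective w (Finite.injective_iff_bijective.1 hinj), ?_, hw1, ?_⟩
  · intro i k h1 h2
    simp only [Equiv.ofBijective_apply] at *
    rcases hw2 i with h3 | h3
    · exact absurd (lt_of_lt_of_le h3.1 (h1.trans h2)) (lt_irrefl _)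
    have hmax : ∀ l, r l i → l ≤ i := fun l hl => not_lt.1 fun h => h3.1 l h hl
    by_cases hk : r k i
    · have h4 := r.trans' (hw1 k) hk
      exact ⟨h3.2 _ h4, hmax _ h4⟩
    · have hki : k < i := lt_of_le_of_ne h2 fun h => hk (h ▸ r.refl' i)
      have hwk : w i < k := lt_of_le_of_ne h1 fun h => hk (h ▸ hw1 i)
      constructor
      · by_contra! h4
        have h5 := hr _ _ _ _ h4 hwk hki (hw1 k) (hw1 i)
        exact hk (r.trans' (r.symm' (hw1 k)) (r.trans' h5 (hw1 i)))
      · by_contra! h4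
        have h5 := hr _ _ _ _ hwk hki h4 (hw1 i) (r.symm' (hw1 k))
        exact hk (r.trans' (r.symm' h5) (hw1 i))
  · have key : ∀ (d : ℕ) (i j : Fin n), (j : ℕ) - i ≤ d → i ≤ j → r i j →
        Conn (Equiv.ofBijective w (Finite.injective_iff_bijective.1 hinj)) i j := by
      intro d
      induction d with
      | zero =>
        intro i j hd hij _
        have : i = j := by
          rw [Fin.le_def] at hij
          ext
          omega
        rw [this]
        exact Conn.refl _ _
      | succ d ih =>
        intro i j hd hij hr
        rcases hij.eq_or_lt with rfl | h1
        · exact Conn.refl _ _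
        rcases hw2 i with h2 | h2
        · have h3 := ih (w i) j (by have := Fin.lt_def.1 h2.1; omega)
            (h2.2 j h1 (r.symm' hr)) (r.trans' (hw1 i) hr)
          exact (conn_apply (Equiv.ofBijective w _) i).symm.trans h3
        · exact absurd (r.symm' hr) (h2.1 j h1)
    intro i j hr
    rcases le_total i j with h | h
    · exact key _ i j le_rfl h hr
    · exact (key _ j i le_rfl h (r.symm' hr)).symm

theorem exists_meet {n : ℕ} {u v : Perm (Fin n)} (hu : Below u (finRotate n))
    (hv : Below v (finRotate n)) :
    ∃ w, Below w u ∧ Below w v ∧ ∀ y, Below y u → Below y v → Below y w := by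
  let r : Setoid (Fin n) :=
    { r := fun i j => Conn u i j ∧ Conn v i j
      iseqv := ⟨fun i => ⟨Conn.refl _ _, Conn.refl _ _⟩, fun h => ⟨h.1.symm, h.2.symm⟩,
        fun h h' => ⟨h.1.trans h'.1, h.2.trans h'.2⟩⟩ }
  obtain ⟨w, h1, h2, h3⟩ := exists_nest_of_noncrossing r (by
    intro a b a' b' hab hba hab' h h'
    exact ⟨conn_of_crossing hu hab hba hab' h.1 h'.1,
      conn_of_crossing hv hab hba hab' h.2 h'.2⟩)
  have hwu : Below w u := h1.below hu (fixed_le_iff.2 fun i => (h2 i).1)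
  refine ⟨w, hwu, h1.below hv (fixed_le_iff.2 fun i => (h2 i).2), fun y hyu hyv => ?_⟩
  apply (hyu.trans hu).nest.below (hwu.trans hu)
  rw [fixed_le_iff]
  intro i
  apply h3
  exact ⟨fixed_le_iff.1 hyu.fixed_le i, fixed_le_iff.1 hyv.fixed_le i⟩

theorem exists_join {n : ℕ} {u v : Perm (Fin n)} (hu : Below u (finRotate n))
    (hv : Below v (finRotate n)) :
    ∃ w, Below w (finRotate n) ∧ Below u w ∧ Below v w ∧
      ∀ y, Below y (finRotate n) → Below u y → Below v y → Below w y := by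
  classical
  have hex : ∃ l, ∃ w : Perm (Fin n), Below w (finRotate n) ∧ Below u w ∧ Below v w ∧
      len w = l := ⟨_, _, below_refl _, hu, hv, rfl⟩
  obtain ⟨w, h1, h2, h3, h4⟩ := Nat.find_spec hex
  refine ⟨w, h1, h2, h3, fun y hy huy hvy => ?_⟩
  obtain ⟨m, hmw, hmy, hm⟩ := exists_meet h1 hy
  have h5 := Nat.find_min' hex ⟨m, hmw.trans h1, hm u h2 huy, hm v h3 hvy, rfl⟩
  have h6 := hmw.eq_of_len_le (by omega)
  rwa [← h6]

end Noncrossing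

/-- A sequence of elements of a group satisfying the relations of the braid group on `n`
strands. -/
structure IsBraid {G : Type*} [Group G] (n : ℕ) (s : ℕ → G) : Prop where
  comm : ∀ i k, i + 2 ≤ k → s i * s k = s k * s i
  braid : ∀ i, i + 2 < n → s i * s (i + 1) * s i = s (i + 1) * s i * s (i + 1)

/-- The band generators: the half twist exchanging the strands `i < j` behind the others. -/
def atom {G : Type*} [Group G] (s : ℕ → G) (i : ℕ) : ℕ → G
  | 0 => 1
  | j + 1 => if i = j then s j else (s j)⁻¹ * atom s i j * s j

section atom

variable {G : Type*} [Group G] {s : ℕ → G}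

theorem atom_self_succ (s : ℕ → G) (i : ℕ) : atom s i (i + 1) = s i := by
  simp [atom]

theorem atom_succ (s : ℕ → G) {i j : ℕ} (h : i < j) :
    atom s i (j + 1) = (s j)⁻¹ * atom s i j * s j := by
  simp [atom, h.ne]

theorem IsBraid.commute {n : ℕ} (hs : IsBraid n s) {i k : ℕ} (h : i + 2 ≤ k) :
    Commute (s i) (s k) := hs.comm i k h

theorem Commute.conj_of_commute {a b c : G} (h : Commute a c) (h' : Commute a b) :
    Commute a (c⁻¹ * b * c) := (h.inv_right.mul_right h').mul_right h

theorem IsBraid.commute_atom_of_lt {n : ℕ} (hs : IsBraid n s) {i j k : ℕ} (hij : i < j)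
    (hjk : j < k) : Commute (s k) (atom s i j) := by
  induction j, hij using Nat.le_induction with
  | base =>
    rw [Nat.succ_eq_add_one, atom_self_succ]
    exact (hs.commute (by omega)).symm
  | succ j hj ih =>
    rw [atom_succ s hj]
    exact Commute.conj_of_commute (hs.commute (by omega)).symm (ih (by omega))

theorem IsBraid.commute_atom_of_nested {n : ℕ} (hs : IsBraid n s) {i j k : ℕ} (hik : i < k)
    (hkj : k + 2 ≤ j) (hj : j < n) : Commute (s k) (atom s i j) := by
  induction j, hkj using Nat.le_induction with
  | base =>
    rw [atom_succ s (by omega : i < k + 1), atom_succ s hik]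
    have h1 := hs.commute_atom_of_lt hik (Nat.lt_succ_self k)
    have h2 := hs.braid k (by omega)
    generalize atom s i k = A at h1
    simp only [Nat.succ_eq_add_one] at h1
    generalize s k = x at *
    generalize s (k + 1) = y at *
    have h3 : x * y⁻¹ * x⁻¹ = y⁻¹ * x⁻¹ * y := by
      apply mul_left_cancel (a := x * y)
      calc x * y * (x * y⁻¹ * x⁻¹) = (x * y * x) * y⁻¹ * x⁻¹ := by group
        _ = (x * y) * (y⁻¹ * x⁻¹ * y) := by rw [h2]; group
    change x * (y⁻¹ * (x⁻¹ * A * x) * y) = (y⁻¹ * (x⁻¹ * A * x) * y) * x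
    calc x * (y⁻¹ * (x⁻¹ * A * x) * y) = (x * y⁻¹ * x⁻¹) * A * x * y := by group
      _ = y⁻¹ * x⁻¹ * (y * A) * x * y := by rw [h3]; group
      _ = y⁻¹ * x⁻¹ * A * (y * x * y) := by rw [h1.eq]; group
      _ = _ := by rw [← h2]; group
  | succ j hkj ih =>
    rw [atom_succ s (by omega : i < j)]
    exact Commute.conj_of_commute (hs.commute (by omega)) (ih (by omega))

theorem IsBraid.atom_comm_of_lt {n : ℕ} (hs : IsBraid n s) {i j k l : ℕ} (hij : i < j)
    (hjk : j < k) (hkl : k < l) : Commute (atom s i j) (atom s k l) := by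
  induction l, hkl using Nat.le_induction with
  | base =>
    rw [Nat.succ_eq_add_one, atom_self_succ]
    exact (hs.commute_atom_of_lt hij hjk).symm
  | succ l hl ih =>
    rw [atom_succ s hl]
    exact Commute.conj_of_commute (hs.commute_atom_of_lt hij (by omega)).symm ih

theorem IsBraid.atom_comm_of_nested {n : ℕ} (hs : IsBraid n s) {i j k l : ℕ} (hik : i < k)
    (hkl : k < l) (hlj : l < j) (hj : j < n) : Commute (atom s i j) (atom s k l) := by
  induction l, hkl using Nat.le_induction with
  | base =>
    rw [Nat.succ_eq_add_one, atom_self_succ]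
    exact (hs.commute_atom_of_nested hik (by omega) hj).symm
  | succ l hl ih =>
    rw [atom_succ s hl]
    exact Commute.conj_of_commute (hs.commute_atom_of_nested (by omega) (by omega) hj).symm
      (ih (by omega))

theorem IsBraid.atom_braid {n : ℕ} (hs : IsBraid n s) {i y : ℕ} (hiy : i < y)
    (hy : y + 1 < n) : atom s i y * s y * atom s i y = s y * atom s i y * s y := by
  induction y, hiy using Nat.le_induction with
  | base =>
    rw [Nat.succ_eq_add_one, atom_self_succ]
    exact hs.braid i (by omega)
  | succ y hiy ih =>
    have h1 := hs.commute_atom_of_lt hiy (Nat.lt_succ_self y)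
    have h2 := hs.braid y (by omega)
    have h3 := ih (by omega)
    rw [atom_succ s hiy]
    simp only [Nat.succ_eq_add_one] at h1
    generalize atom s i y = A at *
    generalize s y = x at *
    generalize s (y + 1) = z at *
    have h4 : x * z * x⁻¹ = z⁻¹ * x * z := by
      rw [mul_inv_eq_iff_eq_mul, mul_assoc, mul_assoc, eq_inv_mul_iff_mul_eq]
      simpa only [mul_assoc] using h2.symm
    have h5 : A = z⁻¹ * A * z := by
      rw [mul_assoc, ← h1.eq, inv_mul_cancel_left]
    have h6 : z = x⁻¹ * (z⁻¹ * x * z) * x := by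
      rw [← h4]
      group
    have e1 : x⁻¹ * A * x * z * (x⁻¹ * A * x) = x⁻¹ * (A * (x * z * x⁻¹) * A) * x := by group
    have e2 : z * (x⁻¹ * A * x) * z =
        x⁻¹ * ((x * z * x⁻¹) * A * (x * z * x⁻¹)) * x := by group
    rw [e1, e2, h4]
    have e3 : A * (z⁻¹ * x * z) * A = z⁻¹ * (A * x * A) * z := by
      conv_lhs => rw [h5]
      group
    have e4 : (z⁻¹ * x * z) * A * (z⁻¹ * x * z) = z⁻¹ * (x * A * x) * z := by
      conv_lhs => rw [h5]
      group
    rw [e3, e4, h3]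

theorem IsBraid.atom_triangle {n : ℕ} (hs : IsBraid n s) {i y j : ℕ} (hiy : i < y)
    (hyj : y < j) (hj : j < n) :
    atom s i j * atom s i y = atom s i y * atom s y j ∧
      atom s i y * atom s y j = atom s y j * atom s i j := by
  induction j, hyj using Nat.le_induction with
  | base =>
    rw [Nat.succ_eq_add_one, atom_self_succ, atom_succ s hiy]
    have h := hs.atom_braid hiy (by omega)
    constructor
    · rw [mul_assoc, mul_assoc, inv_mul_eq_iff_eq_mul, ← mul_assoc, h, mul_assoc]
    · simp only [mul_assoc, mul_inv_cancel_left]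
  | succ j hyj ih =>
    have h1 := hs.commute_atom_of_lt hiy hyj
    obtain ⟨h2, h3⟩ := ih (by omega)
    rw [atom_succ s (by omega : i < j), atom_succ s (by omega : y < j)]
    generalize atom s i y = B at *
    generalize s j = x at *
    have h5 : B = x⁻¹ * B * x := by
      rw [mul_assoc, ← h1.eq, inv_mul_cancel_left]
    have e1 : x⁻¹ * atom s i j * x * B = x⁻¹ * (atom s i j * B) * x := by
      conv_lhs => rw [h5]
      group
    have e2 : B * (x⁻¹ * atom s y j * x) = x⁻¹ * (B * atom s y j) * x := by
      conv_lhs => rw [h5]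
      group
    have e3 : x⁻¹ * atom s y j * x * (x⁻¹ * atom s i j * x) =
        x⁻¹ * (atom s y j * atom s i j) * x := by group
    rw [e1, e2, e3, h2, h3]
    exact ⟨rfl, rfl⟩

end atom

namespace Noncrossing

open Equiv

/-- The lift of a permutation to a product of band generators. -/
noncomputable def lift {G : Type*} [Group G] (s : ℕ → G) {n : ℕ} (w : Perm (Fin n)) : G :=
  open Classical in
  if h : ∃ q, w q < q then
    atom s (w h.choose) h.choose * lift s (swap (w h.choose) h.choose * w)
  else 1
termination_by len w
decreasing_by
  have := len_swap_apply_mul h.choose_spec.ne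
  omega

variable {G : Type*} [Group G] {s : ℕ → G} {n : ℕ}

theorem lift_one (s : ℕ → G) : lift s (1 : Perm (Fin n)) = 1 := by
  rw [lift, dif_neg]
  rintro ⟨q, hq⟩
  exact hq.ne rfl

theorem exists_lift_eq (s : ℕ → G) {w : Perm (Fin n)} (hw : w ≠ 1) :
    ∃ q, w q < q ∧ lift s w = atom s (w q) q * lift s (swap (w q) q * w) := by
  have h := exists_apply_lt hw
  refine ⟨h.choose, h.choose_spec, ?_⟩
  rw [lift, dif_pos h]

theorem Nest.mem_Icc_iff {w : Perm (Fin n)} (hw : Nest w) (q : Fin n) (k : Fin n) :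
    w k ∈ Finset.Icc (w q) q ↔ k ∈ Finset.Icc (w q) q := by
  have key : ∀ k ∈ Finset.Icc (w q) q, w k ∈ Finset.Icc (w q) q := by
    intro k hk
    rw [Finset.mem_Icc] at *
    exact hw q k hk.1 hk.2
  exact ⟨mem_of_apply_mem _ _ key, key k⟩

theorem Nest.mem_Icc_of_conn {w : Perm (Fin n)} (hw : Nest w) {q : Fin n} (hq : w q < q)
    {i : Fin n} (h : Conn w i q) : w q ≤ i ∧ i ≤ q := by
  classical
  have h1 : (fun k => if k ∈ Finset.Icc (w q) q then (1 : ℚ) else 0) ∈ fixed w := by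
    intro k
    simp only [hw.mem_Icc_iff]
  have h2 := h _ h1
  beta_reduce at h2
  rw [if_pos (Finset.mem_Icc.2 ⟨hq.le, le_rfl⟩)] at h2
  by_contra h3
  rw [if_neg (fun h => h3 (Finset.mem_Icc.1 h))] at h2
  exact zero_ne_one h2

theorem swap_comm_of_ne {α : Type*} [DecidableEq α] {i j p q : α} (h1 : i ≠ p) (h2 : i ≠ q)
    (h3 : j ≠ p) (h4 : j ≠ q) : swap i j * swap p q = swap p q * swap i j := by
  apply Perm.Disjoint.commute
  intro x
  by_cases hx : x = i ∨ x = j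
  · right
    rcases hx with rfl | rfl
    · exact swap_apply_of_ne_of_ne h1 h2
    · exact swap_apply_of_ne_of_ne h3 h4
  · left
    push Not at hx
    exact swap_apply_of_ne_of_ne hx.1 hx.2

theorem swap_triangle {α : Type*} [DecidableEq α] {i y j : α} (h1 : i ≠ y) (h2 : y ≠ j)
    (h3 : i ≠ j) : swap y j * swap i y = swap i y * swap i j ∧
      swap i y * swap i j = swap i j * swap y j := by
  constructor <;> ext x <;> simp only [Perm.mul_apply, swap_apply_def] <;> grind

theorem lift_eq_of_noncrossing {u : Perm (Fin n)} (hs : IsBraid n s)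
    (hu : Below u (finRotate n)) {i j q : Fin n} (hij : i < j) (hc : Conn u i j)
    (hq : u q < q)
    (hlq : lift s u = atom s (u q) q * lift s (swap (u q) q * u))
    (ih : ∀ v : Perm (Fin n), len v < len u → Below v (finRotate n) → ∀ i j : Fin n, i < j →
      Conn v i j → lift s v = atom s i j * lift s (swap i j * v))
    (h : j < u q ∨ q < i ∨ (u q < i ∧ j < q) ∨ (i < u q ∧ q < j)) :
    lift s u = atom s i j * lift s (swap i j * u) := by
  have hp := conn_apply u q
  generalize u q = p at *
  have hpq := hq.ne
  have h1 : Conn (swap p q * u) i j := by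
    refine conn_swap_mul hu hq hp hc ?_
    simp only [Finset.mem_Ico]
    omega
  have h2 : Conn (swap i j * u) p q := by
    refine conn_swap_mul hu hij hc hp ?_
    simp only [Finset.mem_Ico]
    omega
  have l1 := len_swap_mul_of_conn hq.ne hp
  have l2 := len_swap_mul_of_conn hij.ne hc
  have hcomm : Commute (atom s i j) (atom s p q) := by
    rcases h with h | h | h | h
    · exact IsBraid.atom_comm_of_lt hs hij h hq
    · exact (IsBraid.atom_comm_of_lt hs hq h hij).symm
    · exact (IsBraid.atom_comm_of_nested hs h.1 hij h.2 q.2).symm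
    · exact IsBraid.atom_comm_of_nested hs h.1 hq h.2 j.2
  rw [hlq, ih _ (by omega) ((swap_mul_below hq.ne hp).trans hu) i j hij h1,
    ih _ (by omega) ((swap_mul_below hij.ne hc).trans hu) p q hq h2, ← mul_assoc, ← mul_assoc,
    ← mul_assoc, ← mul_assoc, hcomm.eq,
    swap_comm_of_ne (i := i) (j := j) (p := p) (q := q)] <;> omega

theorem lift_eq (hs : IsBraid n s) {u : Perm (Fin n)} (hu : Below u (finRotate n))
    {i j : Fin n} (hij : i < j) (hc : Conn u i j) :
    lift s u = atom s i j * lift s (swap i j * u) := by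
  induction hl : len u using Nat.strong_induction_on generalizing u i j with
  | _ l ih =>
    have ih' : ∀ v : Perm (Fin n), len v < len u → Below v (finRotate n) → ∀ i j : Fin n,
        i < j → Conn v i j → lift s v = atom s i j * lift s (swap i j * v) :=
      fun v hv hv' i j hij hc => ih (len v) (by omega) hv' hij hc rfl
    have hu1 : u ≠ 1 := by
      rintro rfl
      have := len_swap_mul_of_conn hij.ne hc
      simp at this
    obtain ⟨q, hq, hlq⟩ := exists_lift_eq s hu1
    by_cases hnc : j < u q ∨ q < i ∨ (u q < i ∧ j < q) ∨ (i < u q ∧ q < j)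
    · exact lift_eq_of_noncrossing hs hu hij hc hq hlq ih' hnc
    have hp := conn_apply u q
    have hiq : Conn u i q := by
      by_contra hiq
      have hjq : ¬ Conn u j q := fun h => hiq (hc.trans h)
      have h1 : i ≠ q := fun h => hiq (h ▸ Conn.refl _ _)
      have h2 : j ≠ q := fun h => hjq (h ▸ Conn.refl _ _)
      have h3 : i ≠ u q := fun h => hiq (h ▸ hp)
      have h4 : j ≠ u q := fun h => hjq (h ▸ hp)
      rcases lt_or_gt_of_ne h3 with h5 | h5
      · exact hiq ((conn_of_crossing hu h5 (by omega) (by omega) hc hp).trans hp)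
      · exact hiq ((conn_of_crossing hu h5 (by omega) (by omega) hp hc).symm.trans hp)
    have hi := hu.nest.mem_Icc_of_conn hq hiq
    have hj := hu.nest.mem_Icc_of_conn hq (hc.symm.trans hiq)
    generalize u q = p at *
    have l1 := len_swap_mul_of_conn hq.ne hp
    have l2 := len_swap_mul_of_conn hij.ne hc
    by_cases hip : i = p
    · subst hip
      by_cases hjq : j = q
      · subst hjq
        exact hlq
      have hjq' : j < q := by omega
      have h1 : Conn (swap i q * u) i j := by
        refine conn_swap_mul hu hq hp hc ?_
        simp only [Finset.mem_Ico]
        omega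
      have h2 : Conn (swap i j * u) j q := by
        refine conn_swap_mul hu hij hc (hc.symm.trans hp) ?_
        simp only [Finset.mem_Ico]
        omega
      have h3 := hs.atom_triangle hij hjq' q.2
      have h4 := swap_triangle hij.ne hjq'.ne hq.ne
      rw [hlq, ih' _ (by omega) ((swap_mul_below hq.ne hp).trans hu) i j hij h1,
        ih' _ (by omega) ((swap_mul_below hij.ne hc).trans hu) j q hjq' h2, ← mul_assoc,
        ← mul_assoc, ← mul_assoc, ← mul_assoc, h3.1, h4.1]
    · have hjq : j = q := by omega
      subst hjq
      have hpi : p < i := by omega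
      have h1 : Conn (swap p j * u) p i := by
        refine conn_swap_mul hu hq hp (hp.trans hiq.symm) ?_
        simp only [Finset.mem_Ico]
        omega
      have h2 : Conn (swap i j * u) p j := by
        refine conn_swap_mul hu hij hc hp ?_
        simp only [Finset.mem_Ico]
        omega
      have h3 := hs.atom_triangle hpi hij j.2
      have h4 := swap_triangle hpi.ne hij.ne hq.ne
      rw [hlq, ih' _ (by omega) ((swap_mul_below hq.ne hp).trans hu) p i hpi h1,
        ih' _ (by omega) ((swap_mul_below hij.ne hc).trans hu) p j hq h2, ← mul_assoc,
        ← mul_assoc, ← mul_assoc, ← mul_assoc, h3.1, h3.2, h4.2]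

theorem lift_mul (hs : IsBraid n s) {u v : Perm (Fin n)} (h : len (u * v) = len u + len v)
    (huv : Below (u * v) (finRotate n)) : lift s (u * v) = lift s u * lift s v := by
  induction hl : len u generalizing u with
  | zero =>
    rw [eq_one_of_len_eq_zero hl, lift_one, one_mul, one_mul]
  | succ l ih =>
    have hu1 : u ≠ 1 := by
      rintro rfl
      simp at hl
    obtain ⟨q, hq, hlq⟩ := exists_lift_eq s hu1
    have hp := conn_apply u q
    have hp' : Conn (u * v) (u q) q := Below.conn (below_mul_iff.2 h.symm) hp
    have h1 := len_swap_mul_of_conn hq.ne hp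
    have h2 := len_swap_mul_of_conn hq.ne hp'
    have h3 := ih (u := swap (u q) q * u) (by rw [mul_assoc]; omega)
      (by rw [mul_assoc]; exact (swap_mul_below hq.ne hp').trans huv) (by omega)
    rw [lift_eq hs huv hq hp', ← mul_assoc (swap _ _), h3, hlq, mul_assoc]

theorem lift_swap (hs : IsBraid n s) {i j : Fin n} (hij : i < j) :
    lift s (swap i j) = atom s i j := by
  rw [lift_eq hs (swap_below hij.ne (conn_rot i j)) hij (conn_swap i j), swap_mul_self,
    lift_one, mul_one]

theorem len_rot : len (finRotate n) = n - 1 := by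
  cases n with
  | zero =>
    have := finrank_add_len (finRotate 0)
    omega
  | succ n =>
    have h1 : fixed (finRotate (n + 1)) ≤ Submodule.span ℚ {fun _ => (1 : ℚ)} := by
      intro f hf
      rw [Submodule.mem_span_singleton]
      refine ⟨f 0, ?_⟩
      ext i
      simpa using conn_rot 0 i f hf
    have h2 : Submodule.span ℚ {fun _ => (1 : ℚ)} ≤ fixed (finRotate (n + 1)) := by
      rw [Submodule.span_singleton_le_iff_mem]
      intro i
      rfl
    have h3 := finrank_add_len (finRotate (n + 1))
    rw [le_antisymm h1 h2, finrank_span_singleton] at h3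
    · omega
    · intro h
      exact one_ne_zero (congrFun h 0)

/-- The transposition of two adjacent points. -/
def adj (n i : ℕ) : Perm (Fin n) :=
  if h : i + 1 < n then swap ⟨i, by omega⟩ ⟨i + 1, h⟩ else 1

theorem prod_adj_apply (k : ℕ) (hk : k < n) (j : Fin n) :
    ((((List.range k).map (adj n)).prod j : Fin n) : ℕ) =
      if (j : ℕ) < k then (j : ℕ) + 1 else if (j : ℕ) = k then 0 else j := by
  induction k generalizing j with
  | zero =>
    simp only [List.range_zero, List.map_nil, List.prod_nil, Perm.one_apply, Nat.not_lt_zero,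
      if_false]
    split_ifs with h
    · exact h
    · rfl
  | succ k ih =>
    rw [List.range_succ, List.map_append, List.prod_append, Perm.mul_apply, ih (by omega)]
    simp only [List.map_cons, List.map_nil, List.prod_singleton, adj, dif_pos hk,
      swap_apply_def, Fin.ext_iff]
    split_ifs <;> simp_all <;> omega

theorem prod_adj : ((List.range (n - 1)).map (adj n)).prod = finRotate n := by
  ext j
  have hj := j.2
  rw [prod_adj_apply _ (by omega)]
  rcases rot_val j with h | h <;> split_ifs <;> omega

theorem lift_prod_adj (hs : IsBraid n s) (l : List ℕ) (hl : ∀ i ∈ l, i + 1 < n)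
    (h1 : len (l.map (adj n)).prod = l.length)
    (h2 : Below (l.map (adj n)).prod (finRotate n)) :
    lift s (l.map (adj n)).prod = (l.map s).prod := by
  have hlen : ∀ l : List ℕ, len (l.map (adj n)).prod ≤ l.length := by
    intro l
    induction l with
    | nil => simp
    | cons i l ih =>
      rw [List.map_cons, List.prod_cons, List.length_cons]
      have h3 := len_mul_le (adj n i) (l.map (adj n)).prod
      have h4 : len (adj n i) ≤ 1 := by
        unfold adj
        split_ifs with h
        · exact (len_swap (by simp [Fin.ext_iff])).le
        · simp
      omega
  induction l with
  | nil => simp [lift_one]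
  | cons i l ih =>
    rw [List.map_cons, List.prod_cons] at *
    rw [List.length_cons] at h1
    have hi : i + 1 < n := hl i (by simp)
    have h4 : len (adj n i) = 1 := by
      rw [adj, dif_pos hi]
      exact len_swap (by simp [Fin.ext_iff])
    have h5 := len_mul_le (adj n i) (l.map (adj n)).prod
    have h6 := hlen l
    have h7 : len (adj n i * (l.map (adj n)).prod) =
      len (adj n i) + len (l.map (adj n)).prod := by omega
    have h8 : Below (l.map (adj n)).prod (adj n i * (l.map (adj n)).prod) := by
      have := (below_mul_iff.2 h7.symm).right
      rwa [inv_mul_cancel_left] at this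
    rw [lift_mul hs h7 h2, ih (fun i hi => hl i (by simp [hi])) (by omega) (h8.trans h2),
      List.map_cons, List.prod_cons]
    congr 1
    rw [adj, dif_pos hi, lift_swap hs (by simp [Fin.lt_def])]
    exact atom_self_succ s i

theorem lift_rot (hs : IsBraid n s) :
    lift s (finRotate n) = ((List.range (n - 1)).map s).prod := by
  rw [← prod_adj]
  apply lift_prod_adj hs
  · intro i hi
    rw [List.mem_range] at hi
    omega
  · rw [prod_adj, len_rot, List.length_range]
  · rw [prod_adj]
    exact below_refl _

end Noncrossing

namespace Noncrossing

open Equiv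

/-- The noncrossing partitions, as the permutations below the long cycle. -/
abbrev Simple (n : ℕ) : Type := {s : Perm (Fin n) // Below s (finRotate n)}

/-- The relations of the dual braid monoid. -/
inductive DualRel (n : ℕ) : FreeMonoid (Simple n) → FreeMonoid (Simple n) → Prop
  | one (s : Simple n) (h : s.1 = 1) : DualRel n (FreeMonoid.of s) 1
  | mul (s t u : Simple n) (h : u.1 = s.1 * t.1) (hl : len u.1 = len s.1 + len t.1) :
      DualRel n (FreeMonoid.of s * FreeMonoid.of t) (FreeMonoid.of u)

/-- The dual braid monoid, generated by the noncrossing partitions. -/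
abbrev DualMonoid (n : ℕ) : Type := PresentedMonoid (DualRel n)

variable {n : ℕ}

/-- The generator of the dual braid monoid attached to a permutation below the long cycle. -/
noncomputable def gen (s : Perm (Fin n)) : DualMonoid n :=
  open Classical in
  if h : Below s (finRotate n) then PresentedMonoid.of (DualRel n) ⟨s, h⟩ else 1

theorem gen_coe (s : Simple n) : gen s.1 = PresentedMonoid.of (DualRel n) s := by
  rw [gen, dif_pos s.2]

theorem gen_one : gen (1 : Perm (Fin n)) = 1 := by
  rw [gen, dif_pos (one_below _)]
  exact PresentedMonoid.mk_eq_mk_of_rel (DualRel.one _ rfl)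

theorem left_below {s t u : Perm (Fin n)} (h : Below (s * t) u)
    (hl : len (s * t) = len s + len t) : Below s u :=
  (below_mul_iff.2 hl.symm).trans h

theorem right_below {s t u : Perm (Fin n)} (h : Below (s * t) u)
    (hl : len (s * t) = len s + len t) : Below t u := by
  have := (below_mul_iff.2 hl.symm).right
  rw [inv_mul_cancel_left] at this
  exact this.trans h

theorem gen_mul {s t : Perm (Fin n)} (h : Below (s * t) (finRotate n))
    (hl : len (s * t) = len s + len t) : gen s * gen t = gen (s * t) := by
  have hs := left_below h hl
  have ht := right_below h hl
  rw [gen, gen, gen, dif_pos hs, dif_pos ht, dif_pos h]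
  have := PresentedMonoid.mk_eq_mk_of_rel (DualRel.mul ⟨s, hs⟩ ⟨t, ht⟩ ⟨s * t, h⟩ rfl hl)
  rw [map_mul] at this
  exact this

theorem gen_mul_inv_mul {s t : Perm (Fin n)} (ht : Below t (finRotate n)) (h : Below s t) :
    gen s * gen (s⁻¹ * t) = gen t := by
  rw [gen_mul, mul_inv_cancel_left]
  · rwa [mul_inv_cancel_left]
  · rw [mul_inv_cancel_left]
    exact h.symm

theorem dual_induction {p : DualMonoid n → Prop} (m : DualMonoid n) (one : p 1)
    (mul : ∀ (s : Perm (Fin n)) (m : DualMonoid n), Below s (finRotate n) → p m →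
      p (gen s * m)) : p m := by
  obtain ⟨w, rfl⟩ := PresentedMonoid.surjective_mk m
  induction w using FreeMonoid.inductionOn' with
  | one => simpa using one
  | of_mul s w ih =>
    rw [map_mul]
    have := mul s.1 _ s.2 ih
    rwa [gen_coe] at this

/-- The greatest lower bound for the absolute order, for permutations below the long cycle. -/
noncomputable def meet (u v : Perm (Fin n)) : Perm (Fin n) :=
  open Classical in
  if h : ∃ w, Below w u ∧ Below w v ∧ ∀ y, Below y u → Below y v → Below y w then h.choose
  else 1

theorem meet_spec {u v : Perm (Fin n)} (hu : Below u (finRotate n))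
    (hv : Below v (finRotate n)) :
    Below (meet u v) u ∧ Below (meet u v) v ∧
      ∀ y, Below y u → Below y v → Below y (meet u v) := by
  have h := exists_meet hu hv
  rw [meet, dif_pos h]
  exact h.choose_spec

theorem below_compl_iff {s x c : Perm (Fin n)} (hs : Below s c) :
    Below x (s⁻¹ * c) ↔ Below (s * x) c ∧ len (s * x) = len s + len x := by
  have h1 := len_mul_le s x
  have h2 := len_mul_le (s * x) ((s * x)⁻¹ * c)
  rw [mul_inv_cancel_left] at h2
  unfold Below at *
  rw [mul_inv_rev, mul_assoc] at *
  constructor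
  · intro h
    omega
  · rintro ⟨h3, h4⟩
    omega

theorem below_mul_left_iff {v w x : Perm (Fin n)} (hw : len (v * w) = len v + len w)
    (hx : len (v * x) = len v + len x) : Below (v * w) (v * x) ↔ Below w x := by
  unfold Below
  rw [mul_inv_rev, mul_assoc, inv_mul_cancel_left]
  omega

theorem compl_below {s c : Perm (Fin n)} (hs : Below s c) : Below (s⁻¹ * c) c := hs.right

/-- The part of `t` which can be absorbed into `s`. -/
noncomputable def absorb (s t : Perm (Fin n)) : Perm (Fin n) := meet (s⁻¹ * finRotate n) t

theorem absorb_spec {s t : Perm (Fin n)} (hs : Below s (finRotate n))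
    (ht : Below t (finRotate n)) :
    Below (s * absorb s t) (finRotate n) ∧ len (s * absorb s t) = len s + len (absorb s t) ∧
      Below (absorb s t) t ∧
      ∀ y, Below (s * y) (finRotate n) → len (s * y) = len s + len y → Below y t →
        Below y (absorb s t) := by
  have h := meet_spec (compl_below hs) ht
  have h1 := (below_compl_iff hs).1 h.1
  exact ⟨h1.1, h1.2, h.2.1, fun y hy hy' hyt => h.2.2 y ((below_compl_iff hs).2 ⟨hy, hy'⟩) hyt⟩

theorem absorb_mul {u v t : Perm (Fin n)} (huv : Below (u * v) (finRotate n))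
    (hl : len (u * v) = len u + len v) (ht : Below t (finRotate n)) :
    absorb u (v * absorb v t) = v * absorb (u * v) t := by
  obtain ⟨hx1, hx2, hx3, hx4⟩ := absorb_spec (right_below huv hl) ht
  obtain ⟨hy1, hy2, hy3, hy4⟩ := absorb_spec (left_below huv hl) hx1
  obtain ⟨hw1, hw2, hw3, hw4⟩ := absorb_spec huv ht
  generalize absorb v t = x at *
  generalize absorb u (v * x) = y at *
  generalize absorb (u * v) t = w at *
  have hvy : Below v y := hy4 v huv hl (below_mul_iff.2 hx2.symm)
  obtain ⟨z, rfl⟩ : ∃ z, y = v * z := ⟨v⁻¹ * y, by simp⟩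
  rw [below_mul_iff] at hvy
  rw [below_mul_left_iff hvy.symm hx2] at hy3
  rw [← mul_assoc] at hy1 hy2
  have hvw : len (v * w) = len v + len w := by
    have h1 := len_mul_le v w
    have h2 := len_mul_le u (v * w)
    rw [← mul_assoc] at h2
    omega
  have h1 : Below z w := hw4 z hy1 (by omega) (hy3.trans hx3)
  have hvw' : Below (v * w) (finRotate n) := by
    refine right_below (s := u) ?_ ?_
    · rwa [← mul_assoc]
    · rw [← mul_assoc]
      omega
  have h2 : Below w x := hx4 w hvw' hvw hw3
  have h3 : Below (v * w) (v * z) := by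
    apply hy4
    · rwa [← mul_assoc]
    · rw [← mul_assoc]
      omega
    · rwa [below_mul_left_iff hvw hx2]
  rw [below_mul_left_iff hvw hvy.symm] at h3
  rw [h1.antisymm h3]

/-- The action of a noncrossing partition on pairs consisting of a head and a tail. -/
noncomputable def headAct (s : Simple n) : Function.End (Simple n × DualMonoid n) :=
  fun p => (⟨s.1 * absorb s.1 p.1.1, (absorb_spec s.2 p.1.2).1⟩,
    gen ((absorb s.1 p.1.1)⁻¹ * p.1.1) * p.2)

theorem headAct_one (s : Simple n) (h : s.1 = 1) : headAct s = 1 := by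
  funext ⟨t, m⟩
  have h1 := absorb_spec s.2 t.2
  have h2 : absorb s.1 t.1 = t.1 := by
    apply h1.2.2.1.antisymm
    apply h1.2.2.2 _ _ _ (below_refl _)
    · rw [h, one_mul]
      exact t.2
    · simp [h]
  simp only [headAct, h2, inv_mul_cancel, gen_one, one_mul]
  exact Prod.ext (Subtype.ext ((congrArg (· * t.1) h).trans (one_mul t.1))) rfl

theorem headAct_mul (s t u : Simple n) (h : u.1 = s.1 * t.1)
    (hl : len u.1 = len s.1 + len t.1) : headAct s * headAct t = headAct u := by
  obtain ⟨u, hu⟩ := u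
  simp only at h hl
  subst h
  funext ⟨r, m⟩
  have h1 := absorb_mul hu hl r.2
  have h2 := absorb_spec t.2 r.2
  have h3 := absorb_spec hu r.2
  have h4 : Below (absorb (s.1 * t.1) r.1) (absorb t.1 r.1) := by
    have h5 := absorb_spec s.2 h2.1
    rw [h1] at h5
    have h6 : len (t.1 * absorb (s.1 * t.1) r.1) =
        len t.1 + len (absorb (s.1 * t.1) r.1) := by
      have h7 := len_mul_le t.1 (absorb (s.1 * t.1) r.1)
      have h8 := len_mul_le s.1 (t.1 * absorb (s.1 * t.1) r.1)
      rw [← mul_assoc] at h8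
      omega
    rw [← below_mul_left_iff h6 h2.2.1]
    exact h5.2.2.1
  change headAct s (headAct t (r, m)) = headAct _ (r, m)
  refine Prod.ext (Subtype.ext ?_) ?_
  · simp only [headAct]
    rw [h1, mul_assoc]
  · simp only [headAct]
    rw [h1, mul_inv_rev, mul_assoc, inv_mul_cancel_left, ← mul_assoc (gen _)]
    congr 1
    rw [gen_mul]
    · rw [mul_assoc, mul_inv_cancel_left]
    · rw [mul_assoc, mul_inv_cancel_left]
      exact h3.2.2.1.right.trans r.2
    · rw [mul_assoc, mul_inv_cancel_left]
      have h5 := h2.2.2.1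
      have h6 := h3.2.2.1
      unfold Below at h4 h5 h6
      omega

/-- The action of the dual braid monoid on pairs consisting of a head and a tail. -/
noncomputable def headTail : DualMonoid n →* Function.End (Simple n × DualMonoid n) :=
  PresentedMonoid.lift headAct (by
    rintro _ _ (⟨s, h⟩ | ⟨s, t, u, h, hl⟩)
    · simpa using headAct_one s h
    · simpa using headAct_mul s t u h hl)

theorem headTail_gen_mul {s : Perm (Fin n)} (hs : Below s (finRotate n)) (m : DualMonoid n)
    (p : Simple n × DualMonoid n) :
    headTail (gen s * m) p = headAct ⟨s, hs⟩ (headTail m p) := by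
  rw [map_mul, gen, dif_pos hs]
  rfl

/-- The greatest noncrossing partition dividing an element of the dual braid monoid. -/
noncomputable def head (m : DualMonoid n) : Perm (Fin n) :=
  (headTail m (⟨1, one_below _⟩, 1)).1.1

/-- The quotient of an element of the dual braid monoid by its head. -/
noncomputable def tail (m : DualMonoid n) : DualMonoid n :=
  (headTail m (⟨1, one_below _⟩, 1)).2

theorem head_below (m : DualMonoid n) : Below (head m) (finRotate n) :=
  (headTail m (⟨1, one_below _⟩, 1)).1.2

theorem head_gen_mul {s : Perm (Fin n)} (hs : Below s (finRotate n)) (m : DualMonoid n) :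
    head (gen s * m) = s * absorb s (head m) := by
  rw [head, headTail_gen_mul hs]
  rfl

theorem tail_gen_mul {s : Perm (Fin n)} (hs : Below s (finRotate n)) (m : DualMonoid n) :
    tail (gen s * m) = gen ((absorb s (head m))⁻¹ * head m) * tail m := by
  rw [tail, headTail_gen_mul hs]
  rfl

theorem gen_head_mul_tail (m : DualMonoid n) : gen (head m) * tail m = m := by
  induction m using dual_induction with
  | one =>
    have h1 : head (1 : DualMonoid n) = 1 := by
      rw [head, map_one]
      rfl
    have h2 : tail (1 : DualMonoid n) = 1 := by
      rw [tail, map_one]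
      rfl
    rw [h1, h2, gen_one, one_mul]
  | mul s m hs ih =>
    have h := absorb_spec hs (head_below m)
    rw [head_gen_mul hs, tail_gen_mul hs, ← gen_mul h.1 h.2.1, mul_assoc,
      ← mul_assoc (gen (absorb s (head m))), gen_mul_inv_mul (head_below m) h.2.2.1, ih]

theorem gen_mul_cancel {s : Perm (Fin n)} {a b : DualMonoid n}
    (h : gen s * a = gen s * b) : a = b := by
  by_cases hs : Below s (finRotate n)
  · have key : ∀ m : DualMonoid n,
        gen (s⁻¹ * head (gen s * m)) * tail (gen s * m) = m := by
      intro m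
      have h := absorb_spec hs (head_below m)
      rw [head_gen_mul hs, tail_gen_mul hs, inv_mul_cancel_left, ← mul_assoc,
        gen_mul_inv_mul (head_below m) h.2.2.1, gen_head_mul_tail]
    rw [← key a, ← key b, h]
  · rwa [gen, dif_neg hs, one_mul, one_mul] at h

theorem dual_mul_left_cancel {m a b : DualMonoid n} (h : m * a = m * b) : a = b := by
  induction m using dual_induction generalizing a b with
  | one => simpa using h
  | mul s m hs ih =>
    rw [mul_assoc, mul_assoc] at h
    exact ih (gen_mul_cancel h)

theorem gen_dvd_iff {s : Perm (Fin n)} (hs : Below s (finRotate n)) (m : DualMonoid n) :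
    gen s ∣ m ↔ Below s (head m) := by
  constructor
  · rintro ⟨m, rfl⟩
    rw [head_gen_mul hs, below_mul_iff]
    exact (absorb_spec hs (head_below m)).2.1.symm
  · intro h
    refine ⟨gen (s⁻¹ * head m) * tail m, ?_⟩
    rw [← mul_assoc, gen_mul_inv_mul (head_below m) h, gen_head_mul_tail]

theorem dual_mul_dvd_mul_iff (m a b : DualMonoid n) : m * a ∣ m * b ↔ a ∣ b := by
  constructor
  · rintro ⟨c, hc⟩
    rw [mul_assoc] at hc
    exact ⟨c, dual_mul_left_cancel hc⟩
  · exact mul_dvd_mul_left m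

theorem exists_lcm_gen {s : Perm (Fin n)} (hs : Below s (finRotate n)) (y : DualMonoid n) :
    ∃ l, gen s ∣ l ∧ y ∣ l ∧ ∀ z, gen s ∣ z → y ∣ z → l ∣ z := by
  induction y using dual_induction generalizing s with
  | one => exact ⟨gen s, dvd_rfl, one_dvd _, fun z hz _ => hz⟩
  | mul a y ha ih =>
    obtain ⟨j, hj, hsj, haj, hmin⟩ := exists_join hs ha
    obtain ⟨l, hl1, hl2, hl3⟩ := ih (haj.right.trans hj)
    have e := gen_mul_inv_mul hj haj
    refine ⟨gen a * l, ?_, mul_dvd_mul_left _ hl2, ?_⟩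
    · refine dvd_trans ?_ (mul_dvd_mul_left _ hl1)
      rw [e, ← gen_mul_inv_mul hj hsj]
      exact dvd_mul_right _ _
    · rintro z hz1 ⟨z', rfl⟩
      rw [mul_assoc] at hz1 ⊢
      apply mul_dvd_mul_left
      apply hl3
      · have h1 := (gen_dvd_iff hs _).1 hz1
        have h2 := (gen_dvd_iff ha _).1 (dvd_mul_right (gen a) (y * z'))
        have h3 := (gen_dvd_iff hj _).2 (hmin _ (head_below _) h1 h2)
        rwa [← e, dual_mul_dvd_mul_iff] at h3
      · exact dvd_mul_right _ _

theorem exists_lcm (x y : DualMonoid n) :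
    ∃ l, x ∣ l ∧ y ∣ l ∧ ∀ z, x ∣ z → y ∣ z → l ∣ z := by
  induction x using dual_induction generalizing y with
  | one => exact ⟨y, one_dvd _, dvd_rfl, fun z _ hz => hz⟩
  | mul a x ha ih =>
    obtain ⟨_, ⟨y', rfl⟩, hl2, hl3⟩ := exists_lcm_gen ha y
    obtain ⟨l, h1, h2, h3⟩ := ih y'
    refine ⟨gen a * l, mul_dvd_mul_left _ h1, hl2.trans (mul_dvd_mul_left _ h2), ?_⟩
    rintro _ ⟨z, rfl⟩ hy
    have h4 := hl3 _ (dvd_mul_of_dvd_left (dvd_mul_right _ _) _) hy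
    rw [mul_assoc] at h4 ⊢
    rw [dual_mul_dvd_mul_iff] at h4 ⊢
    exact h3 _ (dvd_mul_right _ _) h4

theorem conj_below {u v w : Perm (Fin n)} (h : Below u v) :
    Below (w * u * w⁻¹) (w * v * w⁻¹) := by
  have key : ∀ x : Perm (Fin n), len (w * x * w⁻¹) = len x := by
    intro x
    rw [mul_assoc, len_mul_comm, inv_mul_cancel_right]
  unfold Below at *
  rw [key, key, show (w * u * w⁻¹)⁻¹ * (w * v * w⁻¹) = w * (u⁻¹ * v) * w⁻¹ by group, key, h]

theorem conj_rot_below {s : Perm (Fin n)} (hs : Below s (finRotate n)) :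
    Below ((finRotate n)⁻¹ * s * finRotate n) (finRotate n) := by
  have := conj_below (w := (finRotate n)⁻¹) hs
  rwa [inv_inv, inv_mul_cancel, one_mul] at this

theorem gen_mul_gen_rot {s : Perm (Fin n)} (hs : Below s (finRotate n)) :
    gen s * gen (finRotate n) =
      gen (finRotate n) * gen ((finRotate n)⁻¹ * s * finRotate n) := by
  have h1 := gen_mul_inv_mul (below_refl _) hs
  have h2 := gen_mul_inv_mul (below_refl _) (compl_below hs)
  have h3 : (s⁻¹ * finRotate n)⁻¹ * finRotate n = (finRotate n)⁻¹ * s * finRotate n := by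
    group
  rw [h3] at h2
  calc gen s * gen (finRotate n) = gen s * gen (s⁻¹ * finRotate n) *
        gen ((finRotate n)⁻¹ * s * finRotate n) := by rw [mul_assoc, h2]
    _ = _ := by rw [h1]

theorem rot_pow : finRotate n ^ n = 1 := by
  have key : ∀ (k : ℕ) (j : Fin n), (((finRotate n ^ k) j : Fin n) : ℕ) = (j + k) % n := by
    intro k
    induction k with
    | zero =>
      intro j
      simp [Nat.mod_eq_of_lt j.2]
    | succ k ih =>
      intro j
      rw [pow_succ', Perm.mul_apply]
      have h1 := ih j
      have h2 : (j + (k + 1) : ℕ) % n = ((j + k) % n + 1) % n := by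
        rw [Nat.mod_add_mod, add_assoc]
      rw [h2, ← h1]
      rcases rot_val ((finRotate n ^ k) j) with h | h
      · rw [h.1, Nat.mod_eq_of_lt h.2]
      · rw [h.1, h.2, Nat.mod_self]
  ext j
  rw [key]
  simp [Nat.mod_eq_of_lt j.2]

theorem gen_rot_pow_mem_center : gen (finRotate n) ^ n ∈ Submonoid.center (DualMonoid n) := by
  have key : ∀ (k : ℕ) (s : Perm (Fin n)), Below s (finRotate n) →
      Below ((finRotate n ^ k)⁻¹ * s * finRotate n ^ k) (finRotate n) ∧
      gen s * gen (finRotate n) ^ k =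
        gen (finRotate n) ^ k * gen ((finRotate n ^ k)⁻¹ * s * finRotate n ^ k) := by
    intro k
    induction k with
    | zero =>
      intro s hs
      simpa using hs
    | succ k ih =>
      intro s hs
      obtain ⟨h1, h2⟩ := ih s hs
      have h3 : (finRotate n ^ (k + 1))⁻¹ * s * finRotate n ^ (k + 1) =
          (finRotate n)⁻¹ * ((finRotate n ^ k)⁻¹ * s * finRotate n ^ k) * finRotate n := by
        rw [pow_succ]
        group
      rw [h3]
      refine ⟨conj_rot_below h1, ?_⟩
      rw [pow_succ, ← mul_assoc, h2, mul_assoc, gen_mul_gen_rot h1, ← mul_assoc]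
  rw [Submonoid.mem_center_iff]
  intro m
  induction m using dual_induction with
  | one => simp
  | mul s m hs ih =>
    have h := (key n s hs).2
    rw [rot_pow, inv_one, one_mul, mul_one] at h
    rw [mul_assoc, ih, ← mul_assoc, h, mul_assoc]

/-- The length homomorphism of the dual braid monoid. -/
noncomputable def dualLen : DualMonoid n →* Multiplicative ℕ :=
  PresentedMonoid.lift (fun s => Multiplicative.ofAdd (len s.1)) (by
    rintro _ _ (⟨s, h⟩ | ⟨s, t, u, h, hl⟩)
    · simp [h]
    · simp [hl])

theorem dualLen_gen {s : Perm (Fin n)} (hs : Below s (finRotate n)) :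
    dualLen (gen s) = Multiplicative.ofAdd (len s) := by
  rw [gen, dif_pos hs]
  rfl

theorem eq_one_of_dualLen {m : DualMonoid n} (h : dualLen m = 1) : m = 1 := by
  induction m using dual_induction with
  | one => rfl
  | mul s m hs ih =>
    rw [map_mul, dualLen_gen hs, mul_eq_one] at h
    rw [ih h.2, mul_one]
    have : len s = 0 := h.1
    rw [eq_one_of_len_eq_zero this, gen_one]

theorem eq_one_of_mul_eq_one {a b : DualMonoid n} (h : a * b = 1) : a = 1 := by
  apply eq_one_of_dualLen
  have := congrArg dualLen h
  rw [map_mul, map_one, mul_eq_one] at this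
  exact this.1

end Noncrossing

namespace Noncrossing

open Equiv

variable {n : ℕ}

theorem swap_mul_swap_below {i j k l : Fin n} (hij : i < j) (hkl : k < l)
    (h : k ∈ Finset.Ico i j ↔ l ∈ Finset.Ico i j) :
    Below (swap i j * swap k l) (finRotate n) ∧
      len (swap i j * swap k l) = len (swap i j) + len (swap k l) := by
  rw [← below_compl_iff (swap_below hij.ne (conn_rot i j)), swap_inv]
  exact swap_below hkl.ne (conn_swap_mul (below_refl _) hij (conn_rot i j) (conn_rot k l) h)

theorem gen_swap_mul_gen_swap {i j k l : Fin n} (hij : i < j) (hkl : k < l)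
    (h : k ∈ Finset.Ico i j ↔ l ∈ Finset.Ico i j) :
    gen (swap i j) * gen (swap k l) = gen (swap i j * swap k l) := by
  have := swap_mul_swap_below hij hkl h
  exact gen_mul this.1 this.2

theorem gen_adj_comm {i k : ℕ} (h : i + 2 ≤ k) :
    gen (adj n i) * gen (adj n k) = gen (adj n k) * gen (adj n i) := by
  by_cases hk : k + 1 < n
  · rw [adj, adj, dif_pos hk, dif_pos (by omega : i + 1 < n), gen_swap_mul_gen_swap,
      gen_swap_mul_gen_swap, swap_comm_of_ne] <;> simp [Fin.lt_def, Fin.le_def] <;> omega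
  · rw [adj, adj, dif_neg hk, gen_one, one_mul, mul_one]

theorem gen_triangle {i j k : Fin n} (hij : i < j) (hjk : j < k) :
    gen (swap i j) * gen (swap j k) = gen (swap j k) * gen (swap i k) ∧
      gen (swap j k) * gen (swap i k) = gen (swap i k) * gen (swap i j) := by
  have h1 := (swap_triangle hij.ne' (hij.trans hjk).ne hjk.ne).2
  have h2 := (swap_triangle hjk.ne' hij.ne' (hij.trans hjk).ne').2
  rw [swap_comm j i] at h1
  rw [swap_comm k j, swap_comm k i, swap_comm j i] at h2
  rw [gen_swap_mul_gen_swap, gen_swap_mul_gen_swap, gen_swap_mul_gen_swap, h1, h2]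
  · exact ⟨rfl, rfl⟩
  all_goals simp only [Finset.mem_Ico, Fin.lt_def, Fin.le_def] at *; omega

theorem gen_adj_braid {i : ℕ} (h : i + 2 < n) :
    gen (adj n i) * gen (adj n (i + 1)) * gen (adj n i) =
      gen (adj n (i + 1)) * gen (adj n i) * gen (adj n (i + 1)) := by
  rw [adj, adj, dif_pos (by omega : i + 1 < n), dif_pos (by omega : i + 1 + 1 < n)]
  have := gen_triangle (i := ⟨i, by omega⟩) (j := ⟨i + 1, by omega⟩) (k := ⟨i + 1 + 1, h⟩)
    (by simp [Fin.lt_def]) (by simp [Fin.lt_def])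
  rw [mul_assoc, mul_assoc, this.1, this.2, ← mul_assoc, this.1, mul_assoc]

noncomputable instance : OreLocalization.OreSet (Submonoid.center (DualMonoid n)) where
  ore_right_cancel r₁ r₂ s h := by
    have hs := Submonoid.mem_center_iff.1 s.2
    rw [hs, hs] at h
    exact ⟨s, h⟩
  oreNum r _ := r
  oreDenom _ s := s
  ore_eq r s := (Submonoid.mem_center_iff.1 s.2 r).symm

theorem numeratorHom_injective : Function.Injective
    (OreLocalization.numeratorHom (S := Submonoid.center (DualMonoid n))) := by
  intro a b h
  rw [OreLocalization.numeratorHom_apply, OreLocalization.numeratorHom_apply,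
    OreLocalization.oreDiv_eq_iff] at h
  obtain ⟨u, v, h1, h2⟩ := h
  simp only [OneMemClass.coe_one, mul_one] at h2
  subst h2
  exact (dual_mul_left_cancel h1).symm

theorem isUnit_numeratorHom (m : DualMonoid n) :
    IsUnit (OreLocalization.numeratorHom (S := Submonoid.center (DualMonoid n)) m) := by
  have h0 : IsUnit (OreLocalization.numeratorHom
      (S := Submonoid.center (DualMonoid n)) (gen (finRotate n))) := by
    by_cases hn : n = 0
    · subst hn
      rw [show finRotate 0 = 1 from Subsingleton.elim _ _, gen_one, map_one]
      exact isUnit_one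
    · have h := OreLocalization.numerator_isUnit
        (⟨_, gen_rot_pow_mem_center⟩ : Submonoid.center (DualMonoid n))
      rw [map_pow] at h
      exact (isUnit_pow_iff hn).1 h
  induction m using dual_induction with
  | one =>
    rw [map_one]
    exact isUnit_one
  | mul s m hs ih =>
    rw [map_mul]
    refine IsUnit.mul ?_ ih
    have h1 := gen_mul_inv_mul (below_refl _) hs
    have h2 := gen_mul_inv_mul (below_refl _) (s := finRotate n * s⁻¹) (by
      have := conj_below (w := finRotate n) (compl_below hs)
      rwa [mul_inv_cancel_right, mul_assoc, mul_assoc, mul_inv_cancel, mul_one] at this)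
    rw [mul_inv_rev, inv_inv, inv_mul_cancel_right] at h2
    obtain ⟨v, hv⟩ := h0
    rw [isUnit_iff_exists]
    have h3 := congrArg (OreLocalization.numeratorHom
      (S := Submonoid.center (DualMonoid n))) h1
    have h4 := congrArg (OreLocalization.numeratorHom
      (S := Submonoid.center (DualMonoid n))) h2
    rw [map_mul, ← hv, ← Units.mul_inv_eq_one, mul_assoc] at h3
    rw [map_mul, ← hv] at h4
    replace h4 := congrArg (v⁻¹.1 * ·) h4
    beta_reduce at h4
    rw [Units.inv_mul, ← mul_assoc] at h4
    exact ⟨_, h3, (left_inv_eq_right_inv h4 h3) ▸ h4⟩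

/-- The embedding of the dual braid monoid in a group of fractions. -/
noncomputable def toFractions :
    DualMonoid n →* (OreLocalization (Submonoid.center (DualMonoid n)) (DualMonoid n))ˣ :=
  IsUnit.liftRight _ isUnit_numeratorHom

theorem toFractions_injective : Function.Injective (toFractions (n := n)) := by
  intro a b h
  apply numeratorHom_injective
  have := congrArg Units.val h
  rwa [toFractions, IsUnit.coe_liftRight, IsUnit.coe_liftRight] at this

/-- The image of the dual braid monoid under a solution of the braid relations. -/
noncomputable def dualLift {G : Type*} [Group G] {s : ℕ → G} (hs : IsBraid n s) :
    DualMonoid n →* G :=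
  PresentedMonoid.lift (fun w => lift s w.1) (by
    rintro _ _ (⟨s, h⟩ | ⟨s, t, u, h, hl⟩)
    · simp [h, lift_one]
    · obtain ⟨u, hu⟩ := u
      simp only at h hl
      subst h
      simp [lift_mul hs hl hu])

theorem dualLift_gen {G : Type*} [Group G] {s : ℕ → G} (hs : IsBraid n s)
    {w : Perm (Fin n)} (hw : Below w (finRotate n)) : dualLift hs (gen w) = lift s w := by
  rw [gen, dif_pos hw]
  rfl

theorem map_lift {G H : Type*} [Group G] [Group H] {s : ℕ → G} (f : G →* H)
    (u : DualMonoid n →* H) (h : ∀ i, i + 1 < n → f (s i) = u (gen (adj n i)))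
    {w : Perm (Fin n)} (hw : Below w (finRotate n)) : f (lift s w) = u (gen w) := by
  have h1 : ∀ (j : ℕ) (hj : j < n) (i : Fin n), (i : ℕ) < j →
      f (atom s i j) = u (gen (swap i ⟨j, hj⟩)) := by
    intro j
    induction j with
    | zero =>
      intro _ _ hi
      omega
    | succ j ih =>
      intro hj i hi
      by_cases hij : (i : ℕ) = j
      · subst hij
        rw [atom_self_succ, h _ hj, adj, dif_pos hj]
      · have hij' : (i : ℕ) < j := by omega
        rw [atom_succ s hij', map_mul, map_mul, ih (by omega) i hij', map_inv, h _ hj, mul_assoc,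
          inv_mul_eq_iff_eq_mul, adj, dif_pos hj, ← map_mul, ← map_mul,
          (gen_triangle (by simpa [Fin.lt_def]) (by simp [Fin.lt_def])).1]
  induction hl : len w generalizing w with
  | zero => rw [eq_one_of_len_eq_zero hl, lift_one, gen_one, map_one, map_one]
  | succ l ih =>
    have hw1 : w ≠ 1 := by
      rintro rfl
      simp at hl
    obtain ⟨q, hq, hlq⟩ := exists_lift_eq s hw1
    have h2 := gen_mul_inv_mul hw (swap_below hq.ne (conn_apply w q))
    have h3 := len_swap_apply_mul hq.ne
    rw [swap_inv] at h2
    rw [hlq, map_mul, h1 q q.2 (w q) hq, ← h2, map_mul,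
      ih ((swap_mul_below hq.ne (conn_apply w q)).trans hw) (by omega)]

end Noncrossing

namespace Braid

open Noncrossing Equiv

variable {n : ℕ} {G : Type*} [Group G]

theorem sigmaB_of_lt {i : ℕ} (h : i < n - 1) :
    sigmaB n i = PresentedGroup.of (⟨i, h⟩ : Fin (n - 1)) := dif_pos h

theorem isBraid_sigmaB (n : ℕ) : IsBraid n (sigmaB n) where
  comm i k h := by
    by_cases hk : k < n - 1
    · rw [sigmaB_of_lt hk, sigmaB_of_lt (by omega : i < n - 1), ← mul_inv_eq_one]
      exact PresentedGroup.one_of_mem (Or.inl ⟨⟨i, by omega⟩, ⟨k, hk⟩, h, rfl⟩)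
    · rw [sigmaB, sigmaB, dif_neg hk, one_mul, mul_one]
  braid i h := by
    rw [sigmaB_of_lt (by omega : i < n - 1), sigmaB_of_lt (by omega : i + 1 < n - 1),
      ← mul_inv_eq_one]
    exact PresentedGroup.one_of_mem
      (Or.inr ⟨⟨i, by omega⟩, ⟨i + 1, by omega⟩, rfl, rfl⟩)

/-- The homomorphism from the braid group attached to a solution of the braid relations. -/
def braidLift {s : ℕ → G} (hs : IsBraid n s) : BraidGroup n →* G :=
  PresentedGroup.toGroup (rels := braidRels n) (f := fun i : Fin (n - 1) => s i) (by
    rintro _ (⟨i, k, h, rfl⟩ | ⟨i, k, h, rfl⟩)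
    · simp only [map_mul, map_inv, FreeGroup.lift_apply_of]
      rw [mul_inv_eq_one, hs.comm i k h]
    · simp only [map_mul, map_inv, FreeGroup.lift_apply_of]
      rw [mul_inv_eq_one, ← h, hs.braid i (by omega)])

theorem braidLift_sigmaB {s : ℕ → G} (hs : IsBraid n s) {i : ℕ} (h : i + 1 < n) :
    braidLift hs (sigmaB n i) = s i := by
  rw [sigmaB_of_lt (by omega)]
  exact FreeGroup.lift_apply_of

theorem generated_by (H : Subgroup (BraidGroup n)) (h : ∀ i, i + 1 < n → sigmaB n i ∈ H)
    (x : BraidGroup n) : x ∈ H := by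
  apply PresentedGroup.generated_by
  intro j
  have := h j (by omega)
  rwa [sigmaB_of_lt] at this

theorem hom_ext {f g : BraidGroup n →* G}
    (h : ∀ i, i + 1 < n → f (sigmaB n i) = g (sigmaB n i)) : f = g := by
  apply PresentedGroup.ext
  intro j
  have := h j (by omega)
  rwa [sigmaB_of_lt] at this

/-- The canonical map from the dual braid monoid to the braid group. -/
noncomputable def ofDual (n : ℕ) : DualMonoid n →* BraidGroup n := dualLift (isBraid_sigmaB n)

theorem ofDual_injective : Function.Injective (ofDual n) := by
  have ht : IsBraid n (fun i => toFractions (gen (adj n i))) :=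
    { comm := fun i k h => by rw [← map_mul, gen_adj_comm h, map_mul]
      braid := fun i h => by
        simp only [← map_mul]
        rw [gen_adj_braid h] }
  have key : ∀ m, braidLift ht (ofDual n m) = toFractions m := by
    intro m
    induction m using dual_induction with
    | one => simp
    | mul s m hs ih =>
      rw [map_mul, map_mul, map_mul, ih, ofDual, dualLift_gen _ hs,
        map_lift (braidLift ht) toFractions (fun i hi => braidLift_sigmaB ht hi) hs]
  intro a b h
  apply toFractions_injective
  rw [← key, ← key, h]

theorem ofDual_rot : ofDual n (gen (finRotate n)) = deltaSmall n := by
  rw [ofDual, dualLift_gen _ (below_refl _), lift_rot (isBraid_sigmaB n)]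
  rfl

/-- The submonoid of the braid group generated by the band generators. -/
noncomputable def positive (n : ℕ) : Submonoid (BraidGroup n) := MonoidHom.mrange (ofDual n)

theorem ofDual_mem (m : DualMonoid n) : ofDual n m ∈ positive n := ⟨m, rfl⟩

theorem sigmaB_mem_positive {i : ℕ} (hi : i + 1 < n) : sigmaB n i ∈ positive n := by
  refine ⟨gen (adj n i), ?_⟩
  have h : (⟨i, by omega⟩ : Fin n) < ⟨i + 1, hi⟩ := by simp [Fin.lt_def]
  rw [adj, dif_pos hi, ofDual, dualLift_gen _ (swap_below h.ne (conn_rot _ _)),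
    lift_swap (isBraid_sigmaB n) h, atom_self_succ]

theorem conj_inv_mem_positive {p : BraidGroup n} (hp : p ∈ positive n) :
    (deltaSmall n)⁻¹ * p * deltaSmall n ∈ positive n := by
  obtain ⟨m, rfl⟩ := hp
  induction m using dual_induction with
  | one => simp [one_mem]
  | mul s m hs ih =>
    have h := congrArg (ofDual n) (gen_mul_gen_rot hs)
    rw [map_mul, map_mul, ofDual_rot] at h
    have h2 := mul_mem (ofDual_mem (gen ((finRotate n)⁻¹ * s * finRotate n))) ih
    rw [← inv_mul_eq_iff_eq_mul, ← mul_assoc] at h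
    rw [← h] at h2
    simpa [mul_assoc] using h2

theorem conj_mem_positive {p : BraidGroup n} (hp : p ∈ positive n) :
    deltaSmall n * p * (deltaSmall n)⁻¹ ∈ positive n := by
  obtain ⟨m, rfl⟩ := hp
  induction m using dual_induction with
  | one => simp [one_mem]
  | mul s m hs ih =>
    have h0 : Below (finRotate n * s * (finRotate n)⁻¹) (finRotate n) := by
      have := conj_below (w := finRotate n) hs
      rwa [mul_inv_cancel_right] at this
    have h := congrArg (ofDual n) (gen_mul_gen_rot h0)
    rw [map_mul, map_mul, ofDual_rot] at h
    have h2 := mul_mem (ofDual_mem (gen (finRotate n * s * (finRotate n)⁻¹))) ih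
    rw [← eq_mul_inv_iff_mul_eq] at h
    rw [h] at h2
    simpa [mul_assoc] using h2

theorem zpow_conj_mem_positive {p : BraidGroup n} (hp : p ∈ positive n) (t : ℤ) :
    deltaSmall n ^ t * p * (deltaSmall n ^ t)⁻¹ ∈ positive n := by
  induction t with
  | zero => simpa using hp
  | succ k ih =>
    have := conj_mem_positive ih
    rw [add_comm, zpow_add, zpow_one, mul_inv_rev]
    simpa [mul_assoc] using this
  | pred k ih =>
    have := conj_inv_mem_positive ih
    rw [sub_eq_neg_add, zpow_add, zpow_neg_one, mul_inv_rev, inv_inv]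
    simpa only [mul_assoc] using this

theorem exists_pow_mul_inv_mem {p : BraidGroup n} (hp : p ∈ positive n) :
    ∃ k : ℕ, deltaSmall n ^ k * p⁻¹ ∈ positive n := by
  obtain ⟨m, rfl⟩ := hp
  induction m using dual_induction with
  | one => exact ⟨0, by simp [one_mem]⟩
  | mul s m hs ih =>
    obtain ⟨k, hk⟩ := ih
    have h2 := gen_mul_inv_mul (below_refl _) (s := finRotate n * s⁻¹) (by
      have := conj_below (w := finRotate n) (compl_below hs)
      rwa [mul_inv_cancel_right, mul_assoc, mul_assoc, mul_inv_cancel, mul_one] at this)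
    rw [mul_inv_rev, inv_inv, inv_mul_cancel_right] at h2
    have h3 := congrArg (ofDual n) h2
    rw [map_mul, ofDual_rot, ← eq_mul_inv_iff_mul_eq] at h3
    have h4 := mul_mem (conj_mem_positive hk) (ofDual_mem (gen (finRotate n * s⁻¹)))
    rw [h3] at h4
    refine ⟨k + 1, ?_⟩
    rw [pow_succ', map_mul, mul_inv_rev]
    simpa [mul_assoc] using h4

theorem exists_pow_mul_mem (x : BraidGroup n) :
    ∃ k : ℕ, deltaSmall n ^ k * x ∈ positive n := by
  have hδ : deltaSmall n ∈ positive n := ofDual_rot (n := n) ▸ ofDual_mem _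
  let H : Subgroup (BraidGroup n) :=
    { carrier := {x | ∃ k : ℕ, deltaSmall n ^ k * x ∈ positive n}
      one_mem' := ⟨0, by simp [one_mem]⟩
      mul_mem' := by
        rintro a b ⟨k, hk⟩ ⟨l, hl⟩
        refine ⟨l + k, ?_⟩
        have h1 := mul_mem (zpow_conj_mem_positive hk l) hl
        rw [zpow_natCast] at h1
        rw [pow_add]
        simpa [mul_assoc] using h1
      inv_mem' := by
        rintro a ⟨k, hk⟩
        obtain ⟨l, hl⟩ := exists_pow_mul_inv_mem hk
        refine ⟨l, ?_⟩
        have := mul_mem hl (pow_mem hδ k)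
        rw [mul_inv_rev] at this
        simpa [mul_assoc] using this }
  exact generated_by H (fun i hi => ⟨0, by simpa using sigmaB_mem_positive hi⟩) x

theorem exists_pow_mul_mem_of_le {x : BraidGroup n} {k : ℕ}
    (h : deltaSmall n ^ k * x ∈ positive n) (l : ℕ) :
    deltaSmall n ^ (l + k) * x ∈ positive n := by
  have hδ : deltaSmall n ∈ positive n := ofDual_rot (n := n) ▸ ofDual_mem _
  rw [pow_add, mul_assoc]
  exact mul_mem (pow_mem hδ l) h

theorem eq_of_mem_positive {x y : BraidGroup n} (h1 : x⁻¹ * y ∈ positive n)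
    (h2 : y⁻¹ * x ∈ positive n) : x = y := by
  obtain ⟨a, ha⟩ := h1
  obtain ⟨b, hb⟩ := h2
  have h3 : a * b = 1 := by
    apply ofDual_injective
    rw [map_mul, ha, hb, map_one]
    group
  rw [eq_one_of_mul_eq_one h3, map_one, eq_comm, inv_mul_eq_one] at ha
  exact ha

theorem exists_sup (x y : BraidGroup n) : ∃ j, x⁻¹ * j ∈ positive n ∧ y⁻¹ * j ∈ positive n ∧
    ∀ z, x⁻¹ * z ∈ positive n → y⁻¹ * z ∈ positive n → j⁻¹ * z ∈ positive n := by
  obtain ⟨k, hk⟩ := exists_pow_mul_mem x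
  obtain ⟨l, hl⟩ := exists_pow_mul_mem y
  obtain ⟨a, ha⟩ := exists_pow_mul_mem_of_le hk l
  obtain ⟨b, hb⟩ := exists_pow_mul_mem_of_le hl k
  rw [add_comm k l] at hb
  rw [← inv_mul_eq_iff_eq_mul] at ha hb
  subst ha hb
  obtain ⟨m, ⟨c, rfl⟩, ⟨d, hd⟩, hmin⟩ := exists_lcm a b
  refine ⟨(deltaSmall n ^ (l + k))⁻¹ * ofDual n (a * c), ⟨c, ?_⟩, ⟨d, ?_⟩, ?_⟩
  · rw [map_mul]
    group
  · rw [hd, map_mul]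
    group
  · rintro z ⟨p, hp⟩ ⟨q, hq⟩
    rw [eq_inv_mul_iff_mul_eq] at hp hq
    have h : a * p = b * q := by
      apply ofDual_injective
      rw [map_mul, map_mul]
      rw [← hq, mul_assoc, mul_assoc] at hp
      exact mul_left_cancel hp
    obtain ⟨r, hr⟩ := hmin _ (dvd_mul_right a p) (h ▸ dvd_mul_right b q)
    refine ⟨r, ?_⟩
    rw [← hp, eq_inv_mul_iff_mul_eq, mul_assoc, mul_assoc, ← map_mul, ← map_mul, hr]

theorem exists_sup_range (f : ℕ → BraidGroup n) (N : ℕ) :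
    ∃ j, (∀ i ≤ N, (f i)⁻¹ * j ∈ positive n) ∧
      ∀ z, (∀ i ≤ N, (f i)⁻¹ * z ∈ positive n) → j⁻¹ * z ∈ positive n := by
  induction N with
  | zero =>
    refine ⟨f 0, fun i hi => ?_, fun z hz => hz 0 le_rfl⟩
    rw [Nat.le_zero.1 hi, inv_mul_cancel]
    exact one_mem _
  | succ N ih =>
    obtain ⟨j, hj1, hj2⟩ := ih
    obtain ⟨l, hl1, hl2, hl3⟩ := exists_sup j (f (N + 1))
    refine ⟨l, fun i hi => ?_, fun z hz => ?_⟩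
    · rcases Nat.le_succ_iff.1 hi with h | rfl
      · have := mul_mem (hj1 i h) hl1
        rwa [mul_assoc, mul_inv_cancel_left] at this
      · exact hl2
    · exact hl3 z (hj2 z fun i hi => hz i (by omega)) (hz _ le_rfl)

/-- A braid with a positive power equal to the corresponding power of `δ ^ t` is conjugate to
`δ ^ t`. -/
theorem exists_conj_of_pow_eq {w : BraidGroup n} {t : ℤ} {g : ℕ}
    (h : w ^ g = (deltaSmall n ^ t) ^ g) : g ≠ 0 → ∃ y, w * y = y * deltaSmall n ^ t := by
  intro hg
  set d := deltaSmall n ^ t with hd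
  have mono : ∀ x y : BraidGroup n, x⁻¹ * y ∈ positive n →
      (w * x * d⁻¹)⁻¹ * (w * y * d⁻¹) ∈ positive n := by
    intro x y hxy
    have := zpow_conj_mem_positive hxy t
    rw [← hd] at this
    simpa [mul_assoc] using this
  have mono' : ∀ x y : BraidGroup n, x⁻¹ * y ∈ positive n →
      (w⁻¹ * x * d)⁻¹ * (w⁻¹ * y * d) ∈ positive n := by
    intro x y hxy
    have := zpow_conj_mem_positive hxy (-t)
    rw [zpow_neg, ← hd] at this
    simpa [mul_assoc] using this
  let f : ℕ → BraidGroup n := fun i => w ^ i * (d ^ i)⁻¹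
  have hf : ∀ i, f (i + 1) = w * f i * d⁻¹ := by
    intro i
    simp only [f]
    rw [pow_succ', pow_succ', mul_inv_rev]
    group
  have hfg : f g = f 0 := by
    simp only [f]
    rw [h]
    simp
  obtain ⟨y, hy1, hy2⟩ := exists_sup_range f g
  have h1 : y⁻¹ * (w * y * d⁻¹) ∈ positive n := by
    apply hy2
    intro i hi
    cases i with
    | zero =>
      obtain ⟨g, rfl⟩ := Nat.exists_eq_succ_of_ne_zero hg
      rw [← hfg, Nat.succ_eq_add_one, hf]
      exact mono _ _ (hy1 g (by omega))
    | succ i =>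
      rw [hf]
      exact mono _ _ (hy1 i (by omega))
  have h2 : y⁻¹ * (w⁻¹ * y * d) ∈ positive n := by
    apply hy2
    have key : ∀ i < g, (f i)⁻¹ * (w⁻¹ * y * d) ∈ positive n := by
      intro i hi
      have := mono' _ _ (hy1 (i + 1) (by omega))
      rwa [hf, mul_assoc w, inv_mul_cancel_left, inv_mul_cancel_right] at this
    intro i hi
    rcases hi.lt_or_eq with h | rfl
    · exact key i h
    · rw [hfg]
      exact key 0 (by omega)
  have h3 := mono _ _ h2
  rw [mul_assoc w⁻¹, mul_inv_cancel_left, mul_inv_cancel_right] at h3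
  have h4 := eq_of_mem_positive h1 h3
  exact ⟨y, by rw [eq_mul_inv_iff_mul_eq] at h4; exact h4.symm⟩

end Braid

section prod

variable {G : Type*} [Group G] {s : ℕ → G} {n : ℕ}

/-- The product `f 0 * f 1 * ⋯ * f (k - 1)`. -/
def prodRange (f : ℕ → G) (k : ℕ) : G := ((List.range k).map f).prod

theorem prodRange_zero (f : ℕ → G) : prodRange f 0 = 1 := rfl

theorem prodRange_succ (f : ℕ → G) (k : ℕ) : prodRange f (k + 1) = prodRange f k * f k := by
  simp [prodRange, List.range_succ]

theorem prodRange_succ' (f : ℕ → G) (k : ℕ) :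
    prodRange f (k + 1) = f 0 * prodRange (fun i => f (i + 1)) k := by
  simp [prodRange, List.range_succ_eq_map, Function.comp_def]

theorem prodRange_mul {f g : ℕ → G} {a : G} {k : ℕ} (h : ∀ j < k, f j * a = a * g j) :
    prodRange f k * a = a * prodRange g k := by
  induction k with
  | zero => simp [prodRange_zero]
  | succ k ih =>
    rw [prodRange_succ, prodRange_succ, mul_assoc, h k (by omega), ← mul_assoc,
      ih fun j hj => h j (by omega), mul_assoc]

theorem prodRange_commute {f : ℕ → G} {a : G} {k : ℕ} (h : ∀ j < k, Commute (f j) a) :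
    Commute (prodRange f k) a := prodRange_mul h

theorem prodRange_congr {f g : ℕ → G} {k : ℕ} (h : ∀ j < k, f j = g j) :
    prodRange f k = prodRange g k := by
  simpa using prodRange_mul (a := 1) (g := g) fun j hj => by simpa using h j hj

theorem map_prodRange {H : Type*} [Group H] (φ : G →* H) (f : ℕ → G) (k : ℕ) :
    φ (prodRange f k) = prodRange (fun i => φ (f i)) k := by
  simp [prodRange, map_list_prod, Function.comp_def]

/-- The descending product `s (k - 1) * ⋯ * s 1 * s 0`. -/
def prodDesc (s : ℕ → G) (k : ℕ) : G := prodRange (fun j => s (k - 1 - j)) k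

theorem prodDesc_succ (s : ℕ → G) (k : ℕ) : prodDesc s (k + 1) = s k * prodDesc s k := by
  rw [prodDesc, prodRange_succ', prodDesc]
  congr 1
  apply prodRange_congr
  intro j hj
  congr 1
  omega

/-- The Garside element on the first `N` generators. -/
def garside (s : ℕ → G) (N : ℕ) : G :=
  prodRange (fun k => prodRange (fun j => s (N - 1 - j)) (N - k)) N

namespace IsBraid

theorem commute_prodRange (hs : IsBraid n s) {k i : ℕ} (h : k < i) :
    Commute (prodRange s k) (s i) :=
  prodRange_commute fun _ hj => hs.commute (by omega)

theorem commute_prodDesc (hs : IsBraid n s) {k i : ℕ} (h : k < i) :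
    Commute (prodDesc s k) (s i) :=
  prodRange_commute fun _ hj => hs.commute (by omega)

theorem prodRange_mul_gen (hs : IsBraid n s) {i k : ℕ} (hi : i + 1 < k) (hk : k < n) :
    prodRange s k * s i = s (i + 1) * prodRange s k := by
  induction k with
  | zero => omega
  | succ k ih =>
    rw [prodRange_succ]
    by_cases h : i + 1 < k
    · rw [mul_assoc, ← (hs.commute h).eq, ← mul_assoc, ih h (by omega), mul_assoc]
    · obtain rfl : i + 1 = k := by omega
      rw [prodRange_succ, mul_assoc, mul_assoc, ← mul_assoc (s i), hs.braid i (by omega),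
        ← mul_assoc, ← mul_assoc, (hs.commute_prodRange (by omega)).eq]
      simp only [mul_assoc]

theorem prodDesc_mul_gen (hs : IsBraid n s) {i k : ℕ} (hi : i + 1 < k) (hk : k < n) :
    prodDesc s k * s (i + 1) = s i * prodDesc s k := by
  induction k with
  | zero => omega
  | succ k ih =>
    rw [prodDesc_succ]
    by_cases h : i + 1 < k
    · rw [mul_assoc, ih h (by omega), ← mul_assoc, ← (hs.commute h).eq, mul_assoc]
    · obtain rfl : i + 1 = k := by omega
      rw [prodDesc_succ, mul_assoc, mul_assoc, (hs.commute_prodDesc (by omega)).eq,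
        ← mul_assoc (s i), ← mul_assoc, ← mul_assoc, ← hs.braid i (by omega)]
      simp only [mul_assoc]

theorem prodRange_pow (hs : IsBraid n s) {N k : ℕ} (hN : N + 1 < n) (hk : k ≤ N + 1) :
    prodRange s (N + 1) ^ k = prodRange s N ^ k * prodRange (fun j => s (N - j)) k := by
  induction k with
  | zero => simp [prodRange_zero]
  | succ k ih =>
    rw [pow_succ, ih (by omega), mul_assoc, prodRange_mul (g := fun j => s (N - (j + 1))),
      prodRange_succ s N, prodRange_succ', pow_succ]
    · simp only [mul_assoc, Nat.sub_zero]
    · intro j hj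
      have := hs.prodRange_mul_gen (i := N - (j + 1)) (k := N + 1) (by omega) hN
      rw [this]
      congr 2
      omega

theorem garside_succ (hs : IsBraid n s) {N : ℕ} (hN : N + 1 < n) :
    garside s (N + 1) = garside s N * prodDesc s (N + 1) := by
  have h : garside s (N + 1) = prodDesc s (N + 1) *
      prodRange (fun k => prodRange (fun j => s (N - 1 - j + 1)) (N - k)) N := by
    rw [garside, prodRange_succ', prodDesc]
    congr 1
    apply prodRange_congr
    intro k hk
    rw [Nat.add_sub_add_right N 1 k]
    apply prodRange_congr
    intro j hj
    congr 1
    omega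
  rw [h, garside, prodRange_mul]
  intro k hk
  apply prodRange_mul
  intro j hj
  exact (hs.prodDesc_mul_gen (by omega) hN).symm

theorem commute_garside (hs : IsBraid n s) {N i : ℕ} (h : N < i) :
    Commute (garside s N) (s i) :=
  prodRange_commute fun _ _ => prodRange_commute fun _ _ => hs.commute (by omega)

theorem garside_succ' (hs : IsBraid n s) {N : ℕ} (hN : N + 1 < n) :
    garside s (N + 1) = prodRange s (N + 1) * garside s N := by
  induction N with
  | zero =>
    rw [hs.garside_succ hN]
    simp [garside, prodDesc, prodRange]
  | succ N ih =>
    rw [hs.garside_succ hN, ih (by omega), prodDesc_succ, mul_assoc, ← mul_assoc (garside s N),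
      (hs.commute_garside (by omega)).eq, mul_assoc, ← hs.garside_succ (by omega),
      ih (by omega), prodRange_succ s (N + 1), mul_assoc]

theorem garside_sq (hs : IsBraid n s) {N : ℕ} (hN : N < n) :
    garside s N ^ 2 = prodRange s N ^ (N + 1) := by
  induction N with
  | zero => simp [garside, prodRange]
  | succ N ih =>
    have h : Commute (garside s N) (prodDesc s (N + 1) * prodRange s (N + 1)) := by
      refine prodRange_commute fun k hk => prodRange_commute fun j hj => ?_
      change _ * _ = _ * _
      rw [mul_assoc, hs.prodRange_mul_gen (by omega) hN, ← mul_assoc,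
        ← hs.prodDesc_mul_gen (by omega) hN, mul_assoc]
    calc garside s (N + 1) ^ 2
        = garside s N * prodDesc s (N + 1) * (prodRange s (N + 1) * garside s N) := by
          rw [sq, ← hs.garside_succ hN, ← hs.garside_succ' hN]
      _ = garside s N ^ 2 * prodDesc s (N + 1) * prodRange s (N + 1) := by
          rw [mul_assoc, ← mul_assoc (prodDesc s (N + 1)), ← h.eq, sq]
          simp only [mul_assoc]
      _ = prodRange s (N + 1) ^ (N + 1 + 1) := by
          rw [ih (by omega), pow_succ (prodRange s (N + 1)), hs.prodRange_pow hN le_rfl]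
          rfl

theorem prodRange_mul_zero_pow (hs : IsBraid n s) {N : ℕ} (hN : N + 1 < n) :
    (prodRange s (N + 1) * s 0) ^ (N + 1) = prodRange s (N + 1) ^ (N + 2) := by
  have key : ∀ k ≤ N, (prodRange s (N + 1) * s 0) ^ k =
      prodRange (fun j => s (j + 1)) k * prodRange s (N + 1) ^ k := by
    intro k hk
    induction k with
    | zero => simp [prodRange_zero]
    | succ k ih =>
      rw [pow_succ', ih (by omega), hs.prodRange_mul_gen (by omega) hN, ← mul_assoc,
        mul_assoc (s _), ← prodRange_mul (f := fun j => s (j + 1 + 1)), ← mul_assoc,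
        prodRange_succ' (fun j => s (j + 1)), mul_assoc, pow_succ' _ k]
      intro j hj
      exact (hs.prodRange_mul_gen (by omega) hN).symm
  rw [pow_succ', key N le_rfl, ← mul_assoc, mul_assoc (prodRange _ _) (s 0),
    ← prodRange_succ' s N, mul_assoc, ← pow_succ', ← pow_succ']

end IsBraid

end prod

namespace Braid

variable {n : ℕ}

theorem deltaSmall_eq (n : ℕ) : deltaSmall n = prodRange (sigmaB n) (n - 1) := rfl

theorem deltaB_eq (n : ℕ) : deltaB n = garside (sigmaB n) (n - 1) := by
  refine prodRange_congr fun k hk => prodRange_congr fun j hj => ?_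
  congr 1

theorem deltaSmall_pow (n : ℕ) (hn : 1 ≤ n) : deltaSmall n ^ n = deltaB n ^ 2 := by
  rw [deltaB_eq, (isBraid_sigmaB n).garside_sq (by omega), deltaSmall_eq,
    Nat.sub_add_cancel hn]

theorem alphaB_pow (n : ℕ) (hn : 2 ≤ n) : alphaB n ^ (n - 1) = deltaSmall n ^ n := by
  obtain ⟨m, rfl⟩ := Nat.exists_eq_add_of_le' hn
  exact (isBraid_sigmaB (m + 2)).prodRange_mul_zero_pow (N := m) (by omega)

theorem deltaSmall_mul_sigmaB {i : ℕ} (hi : i + 2 < n) :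
    deltaSmall n * sigmaB n i = sigmaB n (i + 1) * deltaSmall n :=
  (isBraid_sigmaB n).prodRange_mul_gen (by omega) (by omega)

theorem deltaSmall_pow_commute (x : BraidGroup n) : Commute (deltaSmall n ^ n) x := by
  have h0 : ∀ i, i + 1 < n → Commute (deltaSmall n ^ n) (sigmaB n i) := by
    intro i
    induction i with
    | zero =>
      intro h
      have h1 : Commute (deltaSmall n ^ n) (alphaB n) := by
        rw [← alphaB_pow n (by omega)]
        exact Commute.pow_self _ _
      have h2 : Commute (deltaSmall n ^ n) (deltaSmall n) := Commute.pow_self _ _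
      have h3 : sigmaB n 0 = (deltaSmall n)⁻¹ * alphaB n := by
        rw [alphaB, inv_mul_cancel_left]
      rw [h3]
      exact h2.inv_right.mul_right h1
    | succ i ih =>
      intro h
      have h2 : Commute (deltaSmall n ^ n) (deltaSmall n) := Commute.pow_self _ _
      rw [eq_mul_inv_of_mul_eq (deltaSmall_mul_sigmaB (by omega)).symm]
      exact (h2.mul_right (ih (by omega))).mul_right h2.inv_right
  have := generated_by (Subgroup.centralizer {deltaSmall n ^ n}) (fun i hi => ?_) x
  · rw [Subgroup.mem_centralizer_singleton_iff] at this
    exact this.symm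
  · rw [Subgroup.mem_centralizer_singleton_iff]
    exact (h0 i hi).eq.symm

end Braid

/-- The permutations of `X` decorated with functions from `X` to a group. -/
@[ext] structure Decorated (X E : Type*) where
  /-- The underlying permutation. -/
  perm : Equiv.Perm X
  /-- The decoration. -/
  val : X → E

namespace Decorated

variable {X E : Type*} [Group E]

instance : Mul (Decorated X E) := ⟨fun a b => ⟨a.perm * b.perm, fun x => a.val (b.perm x) * b.val x⟩⟩

instance : One (Decorated X E) := ⟨⟨1, fun _ => 1⟩⟩

instance : Inv (Decorated X E) := ⟨fun a => ⟨a.perm⁻¹, fun x => (a.val (a.perm⁻¹ x))⁻¹⟩⟩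

theorem mul_perm (a b : Decorated X E) : (a * b).perm = a.perm * b.perm := rfl

theorem mul_val (a b : Decorated X E) (x : X) :
    (a * b).val x = a.val (b.perm x) * b.val x := rfl

instance : Group (Decorated X E) :=
  Group.ofLeftAxioms
    (fun a b c => Decorated.ext rfl (funext fun x => mul_assoc _ _ _))
    (fun a => Decorated.ext (one_mul _) (funext fun x => one_mul _))
    (fun a => Decorated.ext (inv_mul_cancel _) (funext fun x => by
      change (a.val (a.perm⁻¹ (a.perm x)))⁻¹ * a.val x = 1
      rw [Equiv.Perm.inv_def, Equiv.symm_apply_apply, inv_mul_cancel]))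

/-- The underlying permutation, as a homomorphism. -/
def permHom (X E : Type*) [Group E] : Decorated X E →* Equiv.Perm X where
  toFun := perm
  map_one' := rfl
  map_mul' _ _ := rfl

end Decorated

namespace Braid

open Noncrossing Equiv

variable {n : ℕ}

theorem exists_cocycle {X E : Type*} [Group E] (p : BraidGroup n →* Perm X) (f : ℕ → X → E)
    (hcomm : ∀ i k, i + 2 ≤ k → k + 1 < n → ∀ x,
      f i (p (sigmaB n k) x) * f k x = f k (p (sigmaB n i) x) * f i x)
    (hbraid : ∀ i, i + 2 < n → ∀ x,
      f i (p (sigmaB n (i + 1)) (p (sigmaB n i) x)) * f (i + 1) (p (sigmaB n i) x) * f i x =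
      f (i + 1) (p (sigmaB n i) (p (sigmaB n (i + 1)) x)) * f i (p (sigmaB n (i + 1)) x) *
        f (i + 1) x) :
    ∃ c : BraidGroup n → X → E, (∀ a b x, c (a * b) x = c a (p b x) * c b x) ∧
      ∀ i, i + 1 < n → ∀ x, c (sigmaB n i) x = f i x := by
  let s : ℕ → Decorated X E := fun i => if i + 1 < n then ⟨p (sigmaB n i), f i⟩ else 1
  have hs : IsBraid n s :=
    { comm := by
        intro i k h
        by_cases hk : k + 1 < n
        · simp only [s]
          rw [if_pos hk, if_pos (by omega)]
          refine Decorated.ext ?_ (funext fun x => hcomm i k h hk x)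
          rw [Decorated.mul_perm, Decorated.mul_perm, ← map_mul, (isBraid_sigmaB n).comm i k h,
            map_mul]
        · simp only [s]
          rw [if_neg hk, one_mul, mul_one]
      braid := by
        intro i h
        simp only [s]
        rw [if_pos (by omega), if_pos (by omega)]
        refine Decorated.ext ?_ (funext fun x => ?_)
        · simp only [Decorated.mul_perm, ← map_mul]
          rw [(isBraid_sigmaB n).braid i h]
        · exact hbraid i h x }
  have hp : (Decorated.permHom X E).comp (braidLift hs) = p := by
    apply hom_ext
    intro i hi
    rw [MonoidHom.comp_apply, braidLift_sigmaB hs hi]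
    simp only [s]
    rw [if_pos hi]
    rfl
  refine ⟨fun a => (braidLift hs a).val, fun a b x => ?_, fun i hi x => ?_⟩
  · rw [← hp]
    beta_reduce
    rw [map_mul, Decorated.mul_val]
    rfl
  · beta_reduce
    rw [braidLift_sigmaB hs hi]
    simp only [s]
    rw [if_pos hi]

/-- The exponent sum of a braid. -/
def expSum (n : ℕ) : BraidGroup n →* Multiplicative ℤ :=
  braidLift (s := fun _ => Multiplicative.ofAdd 1) ⟨fun _ _ _ => rfl, fun _ _ => rfl⟩

theorem expSum_deltaSmall (n : ℕ) :
    expSum n (deltaSmall n) = Multiplicative.ofAdd ((n - 1 : ℕ) : ℤ) := by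
  have h : ∀ k, k + 1 ≤ n → expSum n (prodRange (sigmaB n) k) = Multiplicative.ofAdd (k : ℤ) := by
    intro k
    induction k with
    | zero =>
      intro _
      simp [prodRange_zero]
    | succ k ih =>
      intro hk
      rw [prodRange_succ, map_mul, ih (by omega), expSum, braidLift_sigmaB _ (by omega)]
      rfl
  by_cases hn : 1 ≤ n
  · exact h (n - 1) (by omega)
  · obtain rfl : n = 0 := by omega
    rfl

theorem adj_val {i : ℕ} (hi : i + 1 < n) (a : Fin n) : (adj n i a : ℕ) =
    if (a : ℕ) = i then i + 1 else if (a : ℕ) = i + 1 then i else a := by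
  rw [adj, dif_pos hi, swap_apply_def]
  simp only [Fin.ext_iff]
  split_ifs <;> rfl

theorem isBraid_adj (n : ℕ) : IsBraid n (adj n) where
  comm i k h := by
    by_cases hk : k + 1 < n
    · ext a
      simp only [Perm.mul_apply, adj_val hk, adj_val (by omega : i + 1 < n)]
      split_ifs <;> omega
    · rw [adj, adj, dif_neg hk, one_mul, mul_one]
  braid i h := by
    ext a
    simp only [Perm.mul_apply, adj_val (by omega : i + 1 + 1 < n), adj_val (by omega : i + 1 < n)]
    split_ifs <;> omega

/-- The permutation of a braid. -/
def perm (n : ℕ) : BraidGroup n →* Perm (Fin n) := braidLift (isBraid_adj n)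

theorem perm_sigmaB {i : ℕ} (hi : i + 1 < n) : perm n (sigmaB n i) = adj n i :=
  braidLift_sigmaB _ hi

theorem perm_deltaSmall (n : ℕ) : perm n (deltaSmall n) = finRotate n := by
  rw [← prod_adj, deltaSmall_eq, map_prodRange]
  refine prodRange_congr fun i hi => perm_sigmaB (by omega)

theorem rot_pow_val (k : ℕ) (j : Fin n) : (((finRotate n ^ k) j : Fin n) : ℕ) = (j + k) % n := by
  induction k with
  | zero => simp [Nat.mod_eq_of_lt j.2]
  | succ k ih =>
    rw [pow_succ', Perm.mul_apply, ← add_assoc, ← Nat.mod_add_mod, ← ih]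
    rcases rot_val ((finRotate n ^ k) j) with h | h
    · rw [h.1, Nat.mod_eq_of_lt h.2]
    · rw [h.1, h.2, Nat.mod_self]

/-- The action of braids on pairs of strands. -/
def permPair (n : ℕ) : BraidGroup n →* Perm (Fin n × Fin n) where
  toFun x := (perm n x).prodCongr (perm n x)
  map_one' := by
    rw [map_one]
    rfl
  map_mul' x y := by
    rw [map_mul]
    rfl

theorem permPair_apply (x : BraidGroup n) (a b : Fin n) :
    permPair n x (a, b) = (perm n x a, perm n x b) := rfl

theorem exists_linking (n : ℕ) : ∃ c : BraidGroup n → Fin n × Fin n → Multiplicative ℤ,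
    (∀ a b x, c (a * b) x = c a (permPair n b x) * c b x) ∧
    ∀ i, i + 1 < n → ∀ x, c (sigmaB n i) x =
      Multiplicative.ofAdd (if (x.1 : ℕ) = i ∧ (x.2 : ℕ) = i + 1 then 1 else 0) := by
  apply exists_cocycle
  · rintro i k h hk ⟨a, b⟩
    rw [← ofAdd_add, ← ofAdd_add, permPair_apply, permPair_apply, perm_sigmaB hk,
      perm_sigmaB (by omega : i + 1 < n)]
    have e : ∀ l j : ℕ, l + 1 < n → j ≠ l → j ≠ l + 1 → ∀ a : Fin n,
        ((adj n l a : Fin n) : ℕ) = j ↔ (a : ℕ) = j := by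
      intro l j hl h1 h2 a
      rw [adj_val hl]
      split_ifs <;> omega
    simp only [e k i hk (by omega) (by omega), e k (i + 1) hk (by omega) (by omega),
      e i k (by omega) (by omega) (by omega), e i (k + 1) (by omega) (by omega) (by omega)]
    rw [add_comm]
  · rintro i h ⟨a, b⟩
    rw [← ofAdd_add, ← ofAdd_add, ← ofAdd_add, ← ofAdd_add, permPair_apply, permPair_apply,
      perm_sigmaB (by omega : i + 1 + 1 < n), perm_sigmaB (by omega : i + 1 < n), permPair_apply,
      permPair_apply, perm_sigmaB (by omega : i + 1 + 1 < n), perm_sigmaB (by omega : i + 1 < n)]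
    simp only [adj_val (by omega : i + 1 + 1 < n), adj_val (by omega : i + 1 < n)]
    congr 1
    have ha : (a : ℕ) = i ∨ (a : ℕ) = i + 1 ∨ (a : ℕ) = i + 2 ∨
      ((a : ℕ) ≠ i ∧ (a : ℕ) ≠ i + 1 ∧ (a : ℕ) ≠ i + 2) := by omega
    have hb : (b : ℕ) = i ∨ (b : ℕ) = i + 1 ∨ (b : ℕ) = i + 2 ∨
      ((b : ℕ) ≠ i ∧ (b : ℕ) ≠ i + 1 ∧ (b : ℕ) ≠ i + 2) := by omega
    generalize (a : ℕ) = a at ha ⊢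
    generalize (b : ℕ) = b at hb ⊢
    clear h
    have e1 : i ≠ i + 1 + 1 := by omega
    have e2 : i + 1 + 1 ≠ i := by omega
    rcases ha with ha | ha | ha | ⟨ha1, ha2, ha3⟩ <;>
    rcases hb with hb | hb | hb | ⟨hb1, hb2, hb3⟩ <;>
    simp [*]

/-- A braid with a power equal to a power of the full twist cannot fix two strands, unless it is
itself a power of the full twist at the level of linking numbers. -/
theorem dvd_of_pow_eq_of_fixes {w : BraidGroup n} {r : ℕ} {t : ℤ}
    (h : w ^ r = (deltaSmall n ^ n) ^ t) {a b : Fin n} (hab : a ≠ b) (ha : perm n w a = a)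
    (hb : perm n w b = b) : (r : ℤ) ∣ t := by
  obtain ⟨c, hmul, hsig⟩ := exists_linking n
  have h1 : ∀ x, c 1 x = 1 := by
    intro x
    have := hmul 1 1 x
    rw [map_one, mul_one, Perm.one_apply] at this
    simpa using this
  have hdelta : ∀ k, k + 1 ≤ n → ∀ x : Fin n × Fin n, c (prodRange (sigmaB n) k) x =
      Multiplicative.ofAdd (if (x.2 : ℕ) = k ∧ (x.1 : ℕ) < k then 1 else 0) := by
    intro k
    induction k with
    | zero =>
      intro _ x
      rw [prodRange_zero, h1]
      simp
    | succ k ih =>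
      rintro hk ⟨a, b⟩
      rw [prodRange_succ, hmul, ih (by omega), hsig k (by omega), ← ofAdd_add]
      congr 1
      simp only [permPair_apply, perm_sigmaB (by omega : k + 1 < n),
        adj_val (by omega : k + 1 < n)]
      split_ifs <;> omega
  have hpow : ∀ (w : BraidGroup n) (x : Fin n × Fin n), permPair n w x = x →
      ∀ k : ℕ, c (w ^ k) x = c w x ^ k := by
    intro w x hx k
    induction k with
    | zero => rw [pow_zero, pow_zero, h1]
    | succ k ih => rw [pow_succ, hmul, hx, ih, pow_succ]
  have hzpow : ∀ (w : BraidGroup n) (x : Fin n × Fin n), permPair n w x = x →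
      ∀ k : ℤ, c (w ^ k) x = c w x ^ k := by
    intro w x hx k
    obtain ⟨k, rfl | rfl⟩ := k.eq_nat_or_neg
    · rw [zpow_natCast, zpow_natCast, hpow w x hx]
    · have h2 := hmul (w ^ (-(k : ℤ))) (w ^ k) x
      have h3 : permPair n (w ^ k) x = x := by
        rw [map_pow]
        exact Function.IsFixedPt.perm_pow hx k
      rw [h3, hpow w x hx, ← zpow_natCast, ← zpow_add, neg_add_cancel, zpow_zero, h1] at h2
      rw [zpow_neg (c w x), zpow_natCast]
      exact eq_inv_of_mul_eq_one_left h2.symm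
  have hz : c (deltaSmall n ^ n) (a, b) = Multiplicative.ofAdd 1 := by
    have h2 : ∀ k : ℕ, c (deltaSmall n ^ k) (a, b) = Multiplicative.ofAdd
        (∑ j ∈ Finset.range k, if j = n - 1 - (b : ℕ) then (1 : ℤ) else 0) ∨ n < k := by
      intro k
      induction k with
      | zero =>
        left
        rw [pow_zero, h1]
        rfl
      | succ k ih =>
        by_cases hk : n < k + 1
        · exact Or.inr hk
        · left
          rcases ih with ih | ih
          · rw [pow_succ', hmul, ih, Finset.sum_range_succ, add_comm, ofAdd_add, deltaSmall_eq,
              hdelta _ (by omega), ← deltaSmall_eq]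
            congr 2
            rw [permPair_apply, map_pow, perm_deltaSmall]
            simp only [rot_pow_val]
            have ha' := a.2
            have hb' := b.2
            have hab' : (a : ℕ) ≠ b := fun h => hab (Fin.ext h)
            have ea : ((a : ℕ) + k) % n = if (a : ℕ) + k < n then (a : ℕ) + k else a + k - n := by
              split_ifs with h
              · exact Nat.mod_eq_of_lt h
              · rw [Nat.mod_eq_sub_mod (by omega), Nat.mod_eq_of_lt (by omega)]
            have eb : ((b : ℕ) + k) % n = if (b : ℕ) + k < n then (b : ℕ) + k else b + k - n := by
              split_ifs with h
              · exact Nat.mod_eq_of_lt h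
              · rw [Nat.mod_eq_sub_mod (by omega), Nat.mod_eq_of_lt (by omega)]
            rw [ea, eb]
            split_ifs <;> omega
          · omega
    rcases h2 n with h2 | h2
    · rw [h2, Finset.sum_ite_eq', if_pos]
      rw [Finset.mem_range]
      have := b.2
      omega
    · omega
  have hzp : permPair n (deltaSmall n ^ n) (a, b) = (a, b) := by
    rw [permPair_apply, map_pow, perm_deltaSmall, rot_pow]
    rfl
  have h2 := congrArg (fun w => c w (a, b)) h
  beta_reduce at h2
  rw [hzpow _ _ hzp, hz, hpow w _ (by rw [permPair_apply, ha, hb])] at h2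
  refine ⟨(c w (a, b)).toAdd, ?_⟩
  have h3 := congrArg Multiplicative.toAdd h2
  simp only [toAdd_pow, toAdd_zpow, toAdd_ofAdd, nsmul_eq_mul, zsmul_eq_mul, mul_one] at h3
  simpa using h3.symm

end Braid

/-- The free generators, indexed by natural numbers; trivial out of range. -/
def freeGen (m i : ℕ) : FreeGroup (Fin m) := if h : i < m then FreeGroup.of ⟨i, h⟩ else 1

theorem freeGen_val {m : ℕ} (a : Fin m) : freeGen m a = FreeGroup.of a := dif_pos a.2

theorem freeGen_hom_ext {m : ℕ} {G : Type*} [Group G] {f g : FreeGroup (Fin m) →* G}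
    (h : ∀ i, i < m → f (freeGen m i) = g (freeGen m i)) : f = g := by
  ext a
  rw [← freeGen_val]
  exact h a a.2

/-- The endomorphism of the free group sending the generator of index `i` to `f i`. -/
def freeHom {m : ℕ} {G : Type*} [Group G] (f : ℕ → G) : FreeGroup (Fin m) →* G :=
  FreeGroup.lift fun a => f a

theorem freeHom_freeGen {m i : ℕ} {G : Type*} [Group G] (f : ℕ → G) (hi : i < m) :
    freeHom f (freeGen m i) = f i := by
  rw [freeGen, dif_pos hi, freeHom, FreeGroup.lift_apply_of]

namespace Braid

open Noncrossing Equiv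

/-- The images of the free generators under the Artin automorphism of index `i`. -/
def artinFun (m i j : ℕ) : FreeGroup (Fin m) :=
  if j = i then (freeGen m i)⁻¹ * freeGen m (i + 1) * freeGen m i
  else if j = i + 1 then freeGen m i else freeGen m j

/-- The images of the free generators under the inverse Artin automorphism of index `i`. -/
def artinInvFun (m i j : ℕ) : FreeGroup (Fin m) :=
  if j = i then freeGen m (i + 1)
  else if j = i + 1 then freeGen m (i + 1) * freeGen m i * (freeGen m (i + 1))⁻¹ else freeGen m j

theorem artinFun_self (m i : ℕ) :
    artinFun m i i = (freeGen m i)⁻¹ * freeGen m (i + 1) * freeGen m i := if_pos rfl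

theorem artinFun_succ (m i : ℕ) : artinFun m i (i + 1) = freeGen m i := by simp [artinFun]

theorem artinFun_of_ne (m : ℕ) {i j : ℕ} (h : j ≠ i) (h' : j ≠ i + 1) :
    artinFun m i j = freeGen m j := by simp [artinFun, h, h']

theorem artinInvFun_self (m i : ℕ) : artinInvFun m i i = freeGen m (i + 1) := if_pos rfl

theorem artinInvFun_succ (m i : ℕ) : artinInvFun m i (i + 1) =
    freeGen m (i + 1) * freeGen m i * (freeGen m (i + 1))⁻¹ := by simp [artinInvFun]

theorem artinInvFun_of_ne (m : ℕ) {i j : ℕ} (h : j ≠ i) (h' : j ≠ i + 1) :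
    artinInvFun m i j = freeGen m j := by
  simp [artinInvFun, h', h]

/-- The Artin automorphisms of the free group; trivial out of range. -/
def artin (m i : ℕ) : MulAut (FreeGroup (Fin m)) :=
  if h : i + 1 < m then
    MonoidHom.toMulEquiv (freeHom (artinFun m i)) (freeHom (artinInvFun m i))
      (freeGen_hom_ext fun j hj => by
        rw [MonoidHom.comp_apply, MonoidHom.id_apply, freeHom_freeGen _ hj]
        by_cases h1 : j = i
        · subst h1
          rw [artinFun_self, map_mul, map_mul, map_inv, freeHom_freeGen _ hj, freeHom_freeGen _ h,
            artinInvFun_self, artinInvFun_succ]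
          group
        · by_cases h2 : j = i + 1
          · subst h2
            rw [artinFun_succ, freeHom_freeGen _ (by omega), artinInvFun_self]
          · rw [artinFun_of_ne m h1 h2, freeHom_freeGen _ hj, artinInvFun_of_ne m h1 h2])
      (freeGen_hom_ext fun j hj => by
        rw [MonoidHom.comp_apply, MonoidHom.id_apply, freeHom_freeGen _ hj]
        by_cases h1 : j = i
        · subst h1
          rw [artinInvFun_self, freeHom_freeGen _ h, artinFun_succ]
        · by_cases h2 : j = i + 1
          · subst h2
            rw [artinInvFun_succ, map_mul, map_mul, map_inv, freeHom_freeGen _ hj,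
              freeHom_freeGen _ (by omega), artinFun_self, artinFun_succ]
            group
          · rw [artinInvFun_of_ne m h1 h2, freeHom_freeGen _ hj, artinFun_of_ne m h1 h2])
  else 1

theorem artin_freeGen {m i j : ℕ} (h : i + 1 < m) (hj : j < m) :
    artin m i (freeGen m j) = artinFun m i j := by
  rw [artin, dif_pos h]
  exact freeHom_freeGen _ hj

theorem artin_freeGen_self {m i : ℕ} (h : i + 1 < m) :
    artin m i (freeGen m i) = (freeGen m i)⁻¹ * freeGen m (i + 1) * freeGen m i := by
  rw [artin_freeGen h (by omega), artinFun_self]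

theorem artin_freeGen_succ {m i : ℕ} (h : i + 1 < m) :
    artin m i (freeGen m (i + 1)) = freeGen m i := by
  rw [artin_freeGen h (by omega), artinFun_succ]

theorem artin_freeGen_of_ne {m i j : ℕ} (h1 : j ≠ i) (h2 : j ≠ i + 1) :
    artin m i (freeGen m j) = freeGen m j := by
  by_cases h : i + 1 < m
  · by_cases hj : j < m
    · rw [artin_freeGen h hj, artinFun_of_ne m h1 h2]
    · rw [freeGen, dif_neg hj, map_one]
  · rw [artin, dif_neg h]
    rfl

theorem mulAut_freeGen_ext {m : ℕ} {f g : MulAut (FreeGroup (Fin m))}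
    (h : ∀ i, i < m → f (freeGen m i) = g (freeGen m i)) : f = g := by
  have := freeGen_hom_ext (f := f.toMonoidHom) (g := g.toMonoidHom) h
  ext x
  exact DFunLike.congr_fun this x

theorem isBraid_artin (m : ℕ) : IsBraid m (artin m) where
  comm i k h := by
    by_cases hk : k + 1 < m
    · have hi : i + 1 < m := by omega
      apply mulAut_freeGen_ext
      intro j hj
      rw [MulAut.mul_apply, MulAut.mul_apply]
      rcases (by omega : j = i ∨ j = i + 1 ∨ j = k ∨ j = k + 1 ∨
        (j ≠ i ∧ j ≠ i + 1 ∧ j ≠ k ∧ j ≠ k + 1)) with rfl | rfl | rfl | rfl | ⟨h1, h2, h3, h4⟩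
      · rw [artin_freeGen_of_ne (i := k) (by omega) (by omega), artin_freeGen_self hi, map_mul,
          map_mul, map_inv, artin_freeGen_of_ne (i := k) (by omega) (by omega),
          artin_freeGen_of_ne (i := k) (by omega) (by omega)]
      · rw [artin_freeGen_of_ne (i := k) (by omega) (by omega), artin_freeGen_succ hi,
          artin_freeGen_of_ne (i := k) (by omega) (by omega)]
      · rw [artin_freeGen_of_ne (i := i) (by omega) (by omega), artin_freeGen_self hk, map_mul,
          map_mul, map_inv, artin_freeGen_of_ne (i := i) (by omega) (by omega),
          artin_freeGen_of_ne (i := i) (by omega) (by omega)]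
      · rw [artin_freeGen_of_ne (i := i) (by omega) (by omega), artin_freeGen_succ hk,
          artin_freeGen_of_ne (i := i) (by omega) (by omega)]
      · rw [artin_freeGen_of_ne h1 h2, artin_freeGen_of_ne h3 h4, artin_freeGen_of_ne h1 h2]
    · rw [artin, artin, dif_neg hk, one_mul, mul_one]
  braid i h := by
    have hi : i + 1 < m := by omega
    have hi' : i + 1 + 1 < m := by omega
    have e : artin m (i + 1) (freeGen m i) = freeGen m i :=
      artin_freeGen_of_ne (by omega) (by omega)
    have e' : artin m i (freeGen m (i + 1 + 1)) = freeGen m (i + 1 + 1) :=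
      artin_freeGen_of_ne (by omega) (by omega)
    apply mulAut_freeGen_ext
    intro j hj
    simp only [MulAut.mul_apply]
    rcases (by omega : j = i ∨ j = i + 1 ∨ j = i + 1 + 1 ∨
      (j ≠ i ∧ j ≠ i + 1 ∧ j ≠ i + 1 + 1)) with rfl | rfl | rfl | ⟨h1, h2, h3⟩
    · simp only [artin_freeGen_self hi, artin_freeGen_self hi', artin_freeGen_succ hi,
        e, e', map_mul, map_inv]
      group
    · simp only [artin_freeGen_self hi, artin_freeGen_self hi', artin_freeGen_succ hi,
        artin_freeGen_succ hi', e, e', map_mul, map_inv]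
    · simp only [artin_freeGen_succ hi, artin_freeGen_succ hi', e, e']
    · rw [artin_freeGen_of_ne h1 h2, artin_freeGen_of_ne h2 h3, artin_freeGen_of_ne h1 h2,
        artin_freeGen_of_ne h2 h3]

/-- The Artin action of the braid group on the free group. -/
def artinAction (m : ℕ) : BraidGroup m →* MulAut (FreeGroup (Fin m)) :=
  braidLift (isBraid_artin m)

theorem artinAction_sigmaB {m i : ℕ} (h : i + 1 < m) : artinAction m (sigmaB m i) = artin m i :=
  braidLift_sigmaB _ h

end Braid

section PureStrand

variable {G : Type*} [Group G] {n : ℕ} {s : ℕ → G}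

/-- The braid in which the first strand runs once around the strand of index `i + 1`. -/
def strandLoop (s : ℕ → G) (i : ℕ) : G := prodRange s i * s i ^ 2 * (prodRange s i)⁻¹

theorem inv_prodRange_succ (s : ℕ → G) (i : ℕ) :
    s i * (prodRange s (i + 1))⁻¹ = (prodRange s i)⁻¹ := by
  rw [prodRange_succ]
  group

theorem mul_inv_prodRange_self (s : ℕ → G) (i : ℕ) :
    s i * (prodRange s i)⁻¹ = (prodRange s (i + 1))⁻¹ * strandLoop s i := by
  rw [prodRange_succ, strandLoop]
  group

theorem IsBraid.mul_inv_prodRange_of_lt (hs : IsBraid n s) {i a : ℕ} (h : a < i) :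
    s i * (prodRange s a)⁻¹ = (prodRange s a)⁻¹ * s i :=
  (hs.commute_prodRange h).symm.inv_right.eq

theorem IsBraid.mul_inv_prodRange_of_gt (hs : IsBraid n s) {i a : ℕ} (h : i + 1 < a) (ha : a < n) :
    s i * (prodRange s a)⁻¹ = (prodRange s a)⁻¹ * s (i + 1) := by
  rw [eq_inv_mul_iff_mul_eq, ← mul_assoc, hs.prodRange_mul_gen h ha, mul_inv_cancel_right]

theorem IsBraid.strandLoop_mul (hs : IsBraid n s) {i : ℕ} (h : i + 2 < n) :
    strandLoop s i * s (i + 1) = s (i + 1) * strandLoop s (i + 1) := by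
  have hc : s (i + 1) * prodRange s i = prodRange s i * s (i + 1) :=
    (hs.commute_prodRange (Nat.lt_succ_self i)).symm
  have hc' : (prodRange s i)⁻¹ * s (i + 1) = s (i + 1) * (prodRange s i)⁻¹ :=
    (hs.mul_inv_prodRange_of_lt (Nat.lt_succ_self i)).symm
  have hb := hs.braid i h
  rw [strandLoop, strandLoop, prodRange_succ, mul_assoc, hc', ← mul_assoc, mul_inv_rev, ← mul_assoc,
    ← mul_assoc, ← mul_assoc, ← mul_assoc, hc]
  congr 1
  rw [eq_mul_inv_iff_mul_eq]
  simp only [mul_assoc, pow_two] at hb ⊢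
  rw [hb, ← mul_assoc (s i) (s (i + 1)), ← mul_assoc (s i * s (i + 1)), mul_assoc (s i), hb]
  simp only [mul_assoc]

theorem IsBraid.mul_strandLoop_mul (hs : IsBraid n s) {i : ℕ} (h : i + 2 < n) :
    s (i + 1) * (strandLoop s (i + 1) * strandLoop s i) =
      strandLoop s (i + 1) * strandLoop s i * s (i + 1) := by
  have hc : s (i + 1) * prodRange s i = prodRange s i * s (i + 1) :=
    (hs.commute_prodRange (Nat.lt_succ_self i)).symm
  have hc' : (prodRange s i)⁻¹ * s (i + 1) = s (i + 1) * (prodRange s i)⁻¹ :=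
    (hs.mul_inv_prodRange_of_lt (Nat.lt_succ_self i)).symm
  have hb := hs.braid i h
  have e : strandLoop s (i + 1) * strandLoop s i =
      prodRange s i * (s i * s (i + 1) * (s (i + 1) * s i)) * (prodRange s i)⁻¹ := by
    rw [strandLoop, strandLoop, prodRange_succ, pow_two, pow_two]
    group
  have h2 : s (i + 1) * (s i * s (i + 1) * (s (i + 1) * s i)) =
      s i * s (i + 1) * (s (i + 1) * s i) * s (i + 1) := by
    calc s (i + 1) * (s i * s (i + 1) * (s (i + 1) * s i))
        = s (i + 1) * s i * s (i + 1) * (s (i + 1) * s i) := by simp only [mul_assoc]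
      _ = s i * s (i + 1) * (s i * s (i + 1) * s i) := by
        rw [← hb]
        simp only [mul_assoc]
      _ = _ := by
        rw [hb]
        simp only [mul_assoc]
  calc s (i + 1) * (strandLoop s (i + 1) * strandLoop s i)
      = s (i + 1) * prodRange s i * (s i * s (i + 1) * (s (i + 1) * s i)) *
          (prodRange s i)⁻¹ := by
        rw [e]
        simp only [mul_assoc]
    _ = prodRange s i * (s (i + 1) * (s i * s (i + 1) * (s (i + 1) * s i))) *
          (prodRange s i)⁻¹ := by
        rw [hc]
        simp only [mul_assoc]
    _ = prodRange s i * (s i * s (i + 1) * (s (i + 1) * s i)) *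
          (s (i + 1) * (prodRange s i)⁻¹) := by
        rw [h2]
        simp only [mul_assoc]
    _ = _ := by
        rw [e, ← hc']
        simp only [mul_assoc]

theorem IsBraid.commute_strandLoop (hs : IsBraid n s) {i j : ℕ} (h : j ≠ i) (h' : j ≠ i + 1)
    (hj : j < n) : Commute (s (i + 1)) (strandLoop s j) := by
  rcases lt_or_gt_of_ne h with h | h
  · have h1 := (hs.commute_prodRange (show j < i + 1 by omega)).symm
    exact (h1.mul_right ((hs.commute (show j + 2 ≤ i + 1 by omega)).symm.pow_right 2)).mul_right
      h1.inv_right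
  · have h1 := hs.mul_inv_prodRange_of_gt (show i + 1 < j by omega) hj
    have h2 := hs.prodRange_mul_gen (show i + 1 < j by omega) hj
    have h3 := ((hs.commute (show i + 2 ≤ j by omega)).pow_right 2).eq
    rw [Commute, SemiconjBy, strandLoop, mul_assoc _ _ (s (i + 1)), ← h1, ← mul_assoc, ← mul_assoc,
      ← mul_assoc, ← h2, mul_assoc (prodRange s j), h3]
    simp only [mul_assoc]

theorem IsBraid.shift {m : ℕ} (hs : IsBraid (m + 1) s) : IsBraid m (fun i => s (i + 1)) where
  comm i k h := hs.comm (i + 1) (k + 1) (by omega)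
  braid i h := hs.braid (i + 1) (by omega)

end PureStrand

namespace Braid

open Noncrossing Equiv

/-- The semidirect product of the free group and the braid group along the Artin action. -/
abbrev Annular (m : ℕ) : Type := FreeGroup (Fin m) ⋊[artinAction m] BraidGroup m

open SemidirectProduct

variable {m : ℕ}

theorem inr_mul_inl (g : BraidGroup m) (x : FreeGroup (Fin m)) :
    (inr g * inl x : Annular m) = inl (artinAction m g x) * inr g := by
  rw [inl_aut, mul_assoc, ← map_mul, inv_mul_cancel, map_one, mul_one]

theorem inr_mul_freeGen_succ {i : ℕ} (h : i + 1 < m) :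
    (inr (sigmaB m i) * inl (freeGen m (i + 1)) : Annular m) =
      inl (freeGen m i) * inr (sigmaB m i) := by
  rw [inr_mul_inl, artinAction_sigmaB h, artin_freeGen_succ h]

theorem inr_mul_freeGen_self {i : ℕ} (h : i + 1 < m) :
    (inl (freeGen m i) * inr (sigmaB m i) * inl (freeGen m i) : Annular m) =
      inl (freeGen m (i + 1)) * inl (freeGen m i) * inr (sigmaB m i) := by
  rw [mul_assoc, inr_mul_inl, artinAction_sigmaB h, artin_freeGen_self h]
  simp only [map_mul, map_inv]
  group

theorem inr_mul_freeGen_of_ne {i j : ℕ} (h : i + 1 < m) (h1 : j ≠ i) (h2 : j ≠ i + 1) :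
    (inr (sigmaB m i) * inl (freeGen m j) : Annular m) =
      inl (freeGen m j) * inr (sigmaB m i) := by
  rw [inr_mul_inl, artinAction_sigmaB h, artin_freeGen_of_ne h1 h2]

theorem annular_compat {G : Type*} [Group G] {s : ℕ → G} (hs : IsBraid (m + 1) s)
    (g : BraidGroup m) (x : FreeGroup (Fin m)) :
    freeHom (strandLoop s) (artinAction m g x) =
      braidLift hs.shift g * freeHom (strandLoop s) x * (braidLift hs.shift g)⁻¹ := by
  let H : Subgroup (BraidGroup m) :=
    { carrier := {g | ∀ x : FreeGroup (Fin m), freeHom (strandLoop s) (artinAction m g x) =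
        braidLift hs.shift g * freeHom (strandLoop s) x * (braidLift hs.shift g)⁻¹}
      one_mem' := fun x => by simp
      mul_mem' := fun {a b} ha hb x => by
        rw [map_mul, MulAut.mul_apply, ha, hb, map_mul]
        group
      inv_mem' := fun {a} ha x => by
        have := ha (artinAction m a⁻¹ x)
        rw [← MulAut.mul_apply, ← map_mul, mul_inv_cancel, map_one, MulAut.one_apply] at this
        rw [this, map_inv (braidLift hs.shift)]
        group }
  suffices g ∈ H from this x
  apply generated_by
  intro i hi
  suffices (freeHom (strandLoop s)).comp (artinAction m (sigmaB m i)).toMonoidHom =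
      (MulAut.conj (s (i + 1))).toMonoidHom.comp (freeHom (strandLoop s)) by
    intro x
    rw [braidLift_sigmaB hs.shift hi]
    exact DFunLike.congr_fun this x
  apply freeGen_hom_ext
  intro j hj
  change freeHom (strandLoop s) (artinAction m (sigmaB m i) (freeGen m j)) =
    s (i + 1) * freeHom (strandLoop s) (freeGen m j) * (s (i + 1))⁻¹
  rw [artinAction_sigmaB hi, freeHom_freeGen _ hj, eq_mul_inv_iff_mul_eq]
  by_cases h1 : j = i
  · subst h1
    rw [artin_freeGen_self hi, map_mul, map_mul, map_inv, freeHom_freeGen _ hj,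
      freeHom_freeGen _ hi, mul_assoc, mul_assoc, inv_mul_eq_iff_eq_mul, ← mul_assoc,
      ← mul_assoc (strandLoop s j), hs.strandLoop_mul (by omega),
      ← hs.mul_strandLoop_mul (by omega), mul_assoc]
  · by_cases h2 : j = i + 1
    · subst h2
      rw [artin_freeGen_succ hi, freeHom_freeGen _ (by omega), hs.strandLoop_mul (by omega)]
    · rw [artin_freeGen_of_ne h1 h2, freeHom_freeGen _ hj,
        (hs.commute_strandLoop h1 h2 (by omega)).eq]

/-- The homomorphism from the annular braid group onto the braids fixing the first strand. -/
def annularHom {G : Type*} [Group G] {s : ℕ → G} (hs : IsBraid (m + 1) s) : Annular m →* G :=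
  SemidirectProduct.lift (freeHom (strandLoop s)) (braidLift hs.shift) fun g =>
    MonoidHom.ext fun x => annular_compat hs g x

theorem annularHom_freeGen {G : Type*} [Group G] {s : ℕ → G} (hs : IsBraid (m + 1) s) {i : ℕ}
    (hi : i < m) : annularHom hs (inl (freeGen m i)) = strandLoop s i := by
  rw [annularHom, lift_inl, freeHom_freeGen _ hi]

theorem annularHom_sigmaB {G : Type*} [Group G] {s : ℕ → G} (hs : IsBraid (m + 1) s) {i : ℕ}
    (hi : i + 1 < m) : annularHom hs (inr (sigmaB m i)) = s (i + 1) := by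
  rw [annularHom, lift_inr, braidLift_sigmaB hs.shift hi]

end Braid

namespace Braid

open Noncrossing Equiv SemidirectProduct

variable {m : ℕ}

/-- The annular braid recording how the strand at position `x` runs through the generator of
index `i`. -/
def strandCoset (m i x : ℕ) : Annular m :=
  if x = i then inl (freeGen m i)
  else if x = i + 1 then 1
  else if x < i then inr (sigmaB m (i - 1))
  else inr (sigmaB m i)

theorem strandCoset_self (m i : ℕ) : strandCoset m i i = inl (freeGen m i) := if_pos rfl

theorem strandCoset_succ (m i : ℕ) : strandCoset m i (i + 1) = 1 := by
  simp [strandCoset]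

theorem strandCoset_of_lt (m : ℕ) {i x : ℕ} (h : x < i) :
    strandCoset m i x = inr (sigmaB m (i - 1)) := by
  rw [strandCoset, if_neg (by omega), if_neg (by omega), if_pos h]

theorem strandCoset_of_gt (m : ℕ) {i x : ℕ} (h : i + 1 < x) :
    strandCoset m i x = inr (sigmaB m i) := by
  rw [strandCoset, if_neg (by omega), if_neg (by omega), if_neg (by omega)]

theorem adj_val_self {n i : ℕ} (hi : i + 1 < n) {a : Fin n} (h : (a : ℕ) = i) :
    (adj n i a : ℕ) = i + 1 := by rw [adj_val hi, if_pos h]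

theorem adj_val_succ {n i : ℕ} (hi : i + 1 < n) {a : Fin n} (h : (a : ℕ) = i + 1) :
    (adj n i a : ℕ) = i := by rw [adj_val hi, if_neg (by omega), if_pos h]

theorem adj_val_of_ne {n i : ℕ} (hi : i + 1 < n) {a : Fin n} (h : (a : ℕ) ≠ i)
    (h' : (a : ℕ) ≠ i + 1) : (adj n i a : ℕ) = a := by rw [adj_val hi, if_neg h, if_neg h']

theorem exists_strand_cocycle (m : ℕ) : ∃ c : BraidGroup (m + 1) → Fin (m + 1) → Annular m,
    (∀ a b x, c (a * b) x = c a (perm (m + 1) b x) * c b x) ∧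
    ∀ i, i + 1 < m + 1 → ∀ x, c (sigmaB (m + 1) i) x = strandCoset m i x := by
  apply exists_cocycle
  · intro i k h hk x
    have hi : i + 1 < m + 1 := by omega
    rw [perm_sigmaB hk, perm_sigmaB hi]
    rcases (by omega : (x : ℕ) < i ∨ (x : ℕ) = i ∨ (x : ℕ) = i + 1 ∨ (i + 1 < (x : ℕ) ∧ (x : ℕ) < k)
      ∨ (x : ℕ) = k ∨ (x : ℕ) = k + 1 ∨ k + 1 < (x : ℕ)) with
      hx | hx | hx | ⟨hx, hx'⟩ | hx | hx | hx
    · rw [adj_val_of_ne hi (by omega) (by omega), adj_val_of_ne hk (by omega) (by omega),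
        strandCoset_of_lt m hx, strandCoset_of_lt m (by omega : (x : ℕ) < k), ← map_mul, ← map_mul,
        (isBraid_sigmaB m).comm (i - 1) (k - 1) (by omega)]
    · rw [adj_val_self hi hx, adj_val_of_ne hk (by omega) (by omega), hx, strandCoset_self,
        strandCoset_of_lt m (by omega : i < k), strandCoset_of_lt m (by omega : i + 1 < k),
        inr_mul_freeGen_of_ne (by omega) (by omega) (by omega)]
    · rw [adj_val_succ hi hx, adj_val_of_ne hk (by omega) (by omega), hx, strandCoset_succ,
        strandCoset_of_lt m (by omega : i < k), strandCoset_of_lt m (by omega : i + 1 < k), mul_one,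
        one_mul]
    · rw [adj_val_of_ne hi (by omega) (by omega), adj_val_of_ne hk (by omega) (by omega),
        strandCoset_of_gt m hx, strandCoset_of_lt m hx', ← map_mul, ← map_mul,
        (isBraid_sigmaB m).comm i (k - 1) (by omega)]
    · rw [adj_val_self hk hx, adj_val_of_ne hi (by omega) (by omega), hx, strandCoset_self,
        strandCoset_of_gt m (by omega : i + 1 < k), strandCoset_of_gt m (by omega : i + 1 < k + 1),
        inr_mul_freeGen_of_ne (by omega) (by omega) (by omega)]
    · rw [adj_val_succ hk hx, adj_val_of_ne hi (by omega) (by omega), hx, strandCoset_succ,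
        strandCoset_of_gt m (by omega : i + 1 < k), strandCoset_of_gt m (by omega : i + 1 < k + 1),
        mul_one, one_mul]
    · rw [adj_val_of_ne hi (by omega) (by omega), adj_val_of_ne hk (by omega) (by omega),
        strandCoset_of_gt m (by omega : i + 1 < (x : ℕ)), strandCoset_of_gt m hx, ← map_mul,
        ← map_mul, (isBraid_sigmaB m).comm i k h]
  · intro i h x
    have hi : i + 1 < m + 1 := by omega
    have hi' : i + 1 + 1 < m + 1 := by omega
    rw [perm_sigmaB hi, perm_sigmaB hi']
    rcases (by omega : (x : ℕ) < i ∨ (x : ℕ) = i ∨ (x : ℕ) = i + 1 ∨ (x : ℕ) = i + 1 + 1 ∨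
      i + 1 + 1 < (x : ℕ)) with hx | hx | hx | hx | hx
    · have e1 := adj_val_of_ne hi (a := x) (by omega) (by omega)
      have e2 := adj_val_of_ne hi' (a := x) (by omega) (by omega)
      have e3 := adj_val_of_ne hi (a := adj (m + 1) (i + 1) x) (by omega) (by omega)
      have e4 := adj_val_of_ne hi' (a := adj (m + 1) i x) (by omega) (by omega)
      rw [e3, e4, e1, e2, strandCoset_of_lt m hx, strandCoset_of_lt m (by omega : (x : ℕ) < i + 1),
        ← map_mul, ← map_mul, ← map_mul, ← map_mul]
      obtain ⟨j, rfl⟩ := Nat.exists_eq_add_of_lt (by omega : 0 < i)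
      simp only [Nat.zero_add, Nat.add_sub_cancel]
      rw [(isBraid_sigmaB m).braid j (by omega)]
    · have e1 := adj_val_self hi hx
      have e2 := adj_val_of_ne hi' (a := x) (by omega) (by omega)
      have e3 := adj_val_self hi (a := adj (m + 1) (i + 1) x) (by omega)
      have e4 := adj_val_self hi' (a := adj (m + 1) i x) (by omega)
      rw [e3, e4, e1, e2, hx, strandCoset_self, strandCoset_self,
        strandCoset_of_gt m (by omega : i + 1 < i + 1 + 1),
        strandCoset_of_lt m (by omega : i < i + 1), Nat.add_sub_cancel,
        inr_mul_freeGen_succ (by omega), inr_mul_freeGen_self (by omega)]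
    · have e1 := adj_val_succ hi hx
      have e2 := adj_val_self hi' hx
      have e3 := adj_val_of_ne hi (a := adj (m + 1) (i + 1) x) (by omega) (by omega)
      have e4 := adj_val_of_ne hi' (a := adj (m + 1) i x) (by omega) (by omega)
      rw [e3, e4, e1, e2, hx, strandCoset_self, strandCoset_self, strandCoset_succ,
        strandCoset_succ, strandCoset_of_gt m (by omega : i + 1 < i + 1 + 1),
        strandCoset_of_lt m (by omega : i < i + 1), Nat.add_sub_cancel, mul_one, one_mul,
        inr_mul_freeGen_succ (by omega)]
    · have e1 := adj_val_of_ne hi (a := x) (by omega) (by omega)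
      have e2 := adj_val_succ hi' hx
      have e3 := adj_val_succ hi (a := adj (m + 1) (i + 1) x) (by omega)
      have e4 := adj_val_succ hi' (a := adj (m + 1) i x) (by omega)
      rw [e3, e4, e1, e2, hx, strandCoset_succ, strandCoset_succ,
        strandCoset_of_gt m (by omega : i + 1 < i + 1 + 1),
        strandCoset_of_lt m (by omega : i < i + 1), Nat.add_sub_cancel]
      simp only [mul_one, one_mul]
    · have e1 := adj_val_of_ne hi (a := x) (by omega) (by omega)
      have e2 := adj_val_of_ne hi' (a := x) (by omega) (by omega)
      have e3 := adj_val_of_ne hi (a := adj (m + 1) (i + 1) x) (by omega) (by omega)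
      have e4 := adj_val_of_ne hi' (a := adj (m + 1) i x) (by omega) (by omega)
      rw [e3, e4, e1, e2, strandCoset_of_gt m hx,
        strandCoset_of_gt m (by omega : i + 1 < (x : ℕ)), ← map_mul, ← map_mul, ← map_mul,
        ← map_mul, (isBraid_sigmaB m).braid i (by omega)]

/-- The annular braid group as the braids on `m + 1` strands fixing the first one. -/
def annularBraid (m : ℕ) : Annular m →* BraidGroup (m + 1) := annularHom (isBraid_sigmaB (m + 1))

theorem annularBraid_freeGen {i : ℕ} (hi : i < m) :
    annularBraid m (inl (freeGen m i)) = strandLoop (sigmaB (m + 1)) i :=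
  annularHom_freeGen _ hi

theorem annularBraid_sigmaB {i : ℕ} (hi : i + 1 < m) :
    annularBraid m (inr (sigmaB m i)) = sigmaB (m + 1) (i + 1) :=
  annularHom_sigmaB _ hi

theorem mul_inv_prodRange_eq {c : BraidGroup (m + 1) → Fin (m + 1) → Annular m}
    (hmul : ∀ a b x, c (a * b) x = c a (perm (m + 1) b x) * c b x)
    (hsig : ∀ i, i + 1 < m + 1 → ∀ x, c (sigmaB (m + 1) i) x = strandCoset m i x)
    (b : BraidGroup (m + 1)) (x : Fin (m + 1)) :
    b * (prodRange (sigmaB (m + 1)) x)⁻¹ =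
      (prodRange (sigmaB (m + 1)) (perm (m + 1) b x))⁻¹ * annularBraid m (c b x) := by
  have hs := isBraid_sigmaB (m + 1)
  let H : Subgroup (BraidGroup (m + 1)) :=
    { carrier := {b | ∀ x : Fin (m + 1), b * (prodRange (sigmaB (m + 1)) x)⁻¹ =
        (prodRange (sigmaB (m + 1)) (perm (m + 1) b x))⁻¹ * annularBraid m (c b x)}
      one_mem' := fun x => by
        have h := hmul 1 1 x
        rw [map_one, mul_one, Perm.one_apply, left_eq_mul] at h
        rw [map_one, Perm.one_apply, h, map_one, one_mul, mul_one]
      mul_mem' := fun {a b} ha hb x => by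
        rw [mul_assoc, hb, ← mul_assoc, ha, hmul, map_mul, map_mul, mul_assoc]
        rfl
      inv_mem' := fun {a} ha x => by
        have h1 := ha (perm (m + 1) a⁻¹ x)
        have h := hmul 1 1 x
        rw [map_one, mul_one, Perm.one_apply, left_eq_mul] at h
        have h2 := hmul a a⁻¹ x
        rw [mul_inv_cancel, h] at h2
        rw [← Perm.mul_apply, ← map_mul, mul_inv_cancel, map_one, Perm.one_apply,
          eq_inv_of_mul_eq_one_left h2.symm, map_inv (annularBraid m),
          eq_mul_inv_iff_mul_eq] at h1
        rw [← h1]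
        group }
  suffices b ∈ H from this x
  apply generated_by
  intro i hi x
  rw [hsig i hi, perm_sigmaB hi]
  rcases (by omega : (x : ℕ) < i ∨ (x : ℕ) = i ∨ (x : ℕ) = i + 1 ∨ i + 1 < (x : ℕ)) with
    hx | hx | hx | hx
  · rw [adj_val_of_ne hi (by omega) (by omega), strandCoset_of_lt m hx,
      hs.mul_inv_prodRange_of_lt hx, annularBraid_sigmaB (by omega), Nat.sub_add_cancel (by omega)]
  · rw [adj_val_self hi hx, hx, strandCoset_self, annularBraid_freeGen (by omega),
      mul_inv_prodRange_self]
  · rw [adj_val_succ hi hx, hx, strandCoset_succ, map_one, mul_one, inv_prodRange_succ]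
  · rw [adj_val_of_ne hi (by omega) (by omega), strandCoset_of_gt m hx,
      hs.mul_inv_prodRange_of_gt hx x.2, annularBraid_sigmaB (by omega)]

theorem exists_annularBraid_eq {b : BraidGroup (m + 1)} (h : perm (m + 1) b 0 = 0) :
    ∃ e, annularBraid m e = b := by
  obtain ⟨c, hmul, hsig⟩ := exists_strand_cocycle m
  have := mul_inv_prodRange_eq hmul hsig b 0
  rw [h, Fin.val_zero, prodRange_zero, inv_one, mul_one, one_mul] at this
  exact ⟨_, this.symm⟩

theorem annular_generated_by (H : Subgroup (Annular m)) (h1 : ∀ i, i < m → inl (freeGen m i) ∈ H)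
    (h2 : ∀ i, i + 1 < m → inr (sigmaB m i) ∈ H) (e : Annular m) : e ∈ H := by
  rw [← inl_left_mul_inr_right e]
  refine mul_mem ?_ ?_
  · have : (⊤ : Subgroup (FreeGroup (Fin m))) ≤ H.comap inl := by
      rw [← FreeGroup.closure_range_of, Subgroup.closure_le]
      rintro _ ⟨a, rfl⟩
      rw [← freeGen_val]
      exact h1 a a.2
    exact this (Subgroup.mem_top _)
  · exact generated_by (H.comap inr) h2 e.right

theorem perm_prodRange {n : ℕ} (k : ℕ) (hk : k < n) (j : Fin n) (hj : (j : ℕ) = k) :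
    ((perm n (prodRange (sigmaB n) k) j : Fin n) : ℕ) = 0 := by
  induction k generalizing j with
  | zero => rw [prodRange_zero, map_one, Perm.one_apply, hj]
  | succ k ih =>
    rw [prodRange_succ, map_mul, Perm.mul_apply]
    apply ih (by omega)
    rw [perm_sigmaB (by omega), adj_val_succ (by omega) hj]

theorem annularBraid_injective (m : ℕ) : Function.Injective (annularBraid m) := by
  obtain ⟨c, hmul, hsig⟩ := exists_strand_cocycle m
  have hc1 : ∀ x, c 1 x = 1 := by
    intro x
    have h := hmul 1 1 x
    rwa [map_one, mul_one, Perm.one_apply, left_eq_mul] at h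
  let H : Subgroup (Annular m) :=
    { carrier := {e | perm (m + 1) (annularBraid m e) 0 = 0 ∧ c (annularBraid m e) 0 = e}
      one_mem' := by
        constructor
        · rw [map_one, map_one, Perm.one_apply]
        · rw [map_one, hc1]
      mul_mem' := fun {a b} ha hb => by
        constructor
        · rw [map_mul, map_mul, Perm.mul_apply, hb.1, ha.1]
        · rw [map_mul, hmul, hb.1, ha.2, hb.2]
      inv_mem' := fun {a} ha => by
        have h0 : perm (m + 1) (annularBraid m a⁻¹) 0 = 0 := by
          rw [map_inv, map_inv, Perm.inv_eq_iff_eq, ha.1]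
        refine ⟨h0, ?_⟩
        have := hmul (annularBraid m a) (annularBraid m a⁻¹) 0
        rw [← map_mul, mul_inv_cancel, map_one, hc1, h0, ha.2] at this
        exact eq_inv_of_mul_eq_one_right this.symm }
  have hH : ∀ e, e ∈ H := by
    apply annular_generated_by
    · intro i hi
      have hP : ∀ k, k < m + 1 → ∀ x : Fin (m + 1), (x : ℕ) = k →
          c (prodRange (sigmaB (m + 1)) k) x = 1 := by
        intro k
        induction k with
        | zero =>
          intro _ x _
          rw [prodRange_zero, hc1]
        | succ k ih =>
          intro hk x hx
          rw [prodRange_succ, hmul, hsig k hk, hx, strandCoset_succ, mul_one, perm_sigmaB hk]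
          exact ih (by omega) _ (adj_val_succ hk hx)
      have hpP : perm (m + 1) (prodRange (sigmaB (m + 1)) i) ⟨i, by omega⟩ = 0 :=
        Fin.ext (perm_prodRange i (by omega) _ rfl)
      have hs : perm (m + 1) (sigmaB (m + 1) i) ⟨i, by omega⟩ = ⟨i + 1, by omega⟩ := by
        rw [perm_sigmaB (by omega)]
        exact Fin.ext (adj_val_self (by omega) rfl)
      have hs2 : perm (m + 1) (sigmaB (m + 1) i ^ 2) ⟨i, by omega⟩ = ⟨i, by omega⟩ := by
        rw [pow_two, map_mul, Perm.mul_apply, hs, perm_sigmaB (by omega)]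
        exact Fin.ext (adj_val_succ (by omega) rfl)
      have hL : annularBraid m (inl (freeGen m i)) * prodRange (sigmaB (m + 1)) i =
          prodRange (sigmaB (m + 1)) i * sigmaB (m + 1) i ^ 2 := by
        rw [annularBraid_freeGen hi, strandLoop, inv_mul_cancel_right]
      constructor
      · have := congrArg (fun b => perm (m + 1) b ⟨i, by omega⟩) hL
        beta_reduce at this
        rwa [map_mul, map_mul, Perm.mul_apply, Perm.mul_apply, hs2, hpP] at this
      · have := congrArg (fun b => c b ⟨i, by omega⟩) hL
        beta_reduce at this
        rw [hmul, hmul, hs2, hpP, hP i (by omega) _ rfl, mul_one, one_mul, pow_two, hmul, hs,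
          hsig i (by omega), hsig i (by omega)] at this
        rw [this]
        change strandCoset m i (i + 1) * strandCoset m i i = _
        rw [strandCoset_succ, strandCoset_self, one_mul]
    · intro i hi
      have hz : ((0 : Fin (m + 1)) : ℕ) < i + 1 := by simp
      refine ⟨?_, ?_⟩
      · rw [annularBraid_sigmaB hi, perm_sigmaB (by omega)]
        apply Fin.ext
        rw [adj_val_of_ne (by omega) (by omega) (by omega)]
      · rw [annularBraid_sigmaB hi, hsig _ (by omega), strandCoset_of_lt m hz, Nat.add_sub_cancel]
  intro a b hab
  rw [← (hH a).2, ← (hH b).2, hab]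

end Braid

theorem FreeGroup.IsReduced.map {X : Type*} {L : List (X × Bool)} (h : FreeGroup.IsReduced L)
    (p : Equiv.Perm X) : FreeGroup.IsReduced (L.map fun x => (p x.1, x.2)) := by
  rw [FreeGroup.IsReduced, List.isChain_map]
  exact h.imp fun a b hab e => hab (p.injective e)

theorem List.eq_cons_append_singleton {α : Type*} {L : List α} (h : 2 ≤ L.length) :
    ∃ a M b, L = a :: (M ++ [b]) := by
  match L, h with
  | a :: c :: N, _ =>
    exact ⟨a, (c :: N).dropLast, (c :: N).getLast (by simp), by
      rw [List.dropLast_append_getLast]⟩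

/-- If no cancellation occurs between a reduced word and its image under a permutation of the
letters, then the twisted powers of the word are nontrivial. -/
theorem FreeGroup.iterate_ne_one {X : Type*} (p : Equiv.Perm X) {L : List (X × Bool)}
    (hL : FreeGroup.IsReduced L) (hne : L ≠ [])
    (h : ∀ a ∈ L.getLast?, ∀ b ∈ L.head?, a.1 = p b.1 → a.2 = b.2) {q : ℕ} (hq : q ≠ 0) :
    (fun x => FreeGroup.mk L * FreeGroup.map p x)^[q] 1 ≠ 1 := by
  classical
  have key : ∀ q : ℕ, ∃ W : List (X × Bool), FreeGroup.IsReduced W ∧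
      (fun x => FreeGroup.mk L * FreeGroup.map p x)^[q] 1 = FreeGroup.mk W ∧
      (q ≠ 0 → W ≠ []) ∧ ∀ b ∈ W.head?, b ∈ L.head? := by
    intro q
    induction q with
    | zero => exact ⟨[], FreeGroup.IsReduced.nil, rfl, by simp, by simp⟩
    | succ q ih =>
      obtain ⟨W, h1, h2, -, h4⟩ := ih
      refine ⟨L ++ W.map fun x => (p x.1, x.2), ?_, ?_, ?_, ?_⟩
      · refine List.IsChain.append hL (h1.map p) ?_
        intro a ha b hb e
        rw [List.head?_map, Option.mem_map] at hb
        obtain ⟨c, hc, rfl⟩ := hb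
        exact h a ha c (h4 c hc) e
      · rw [Function.iterate_succ_apply', h2, FreeGroup.map.mk, FreeGroup.mul_mk]
      · simp [hne]
      · intro b hb
        rwa [List.head?_append_of_ne_nil _ hne] at hb
  obtain ⟨W, h1, h2, h3, -⟩ := key q
  rw [h2]
  intro e
  apply h3 hq
  rw [← h1.reduce_eq, ← FreeGroup.toWord_mk, e, FreeGroup.toWord_one]

/-- Twisted conjugacy: an element of finite order in the coset of a permutation of the letters is
conjugate to that permutation. -/
theorem FreeGroup.exists_eq_inv_mul_map {X : Type*} (p : Equiv.Perm X) {q : ℕ} (hq : q ≠ 0)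
    (w : FreeGroup X) (h : ∀ x, (fun x => w * FreeGroup.map p x)^[q] x = x) :
    ∃ u, w = u⁻¹ * FreeGroup.map p u := by
  classical
  induction hN : w.norm using Nat.strong_induction_on generalizing w with
  | _ N ih =>
  subst hN
  by_cases hne : w.toWord = []
  · refine ⟨1, ?_⟩
    rw [FreeGroup.toWord_eq_nil_iff] at hne
    rw [hne, _root_.map_one, inv_one, one_mul]
  have hred : FreeGroup.IsReduced w.toWord := FreeGroup.isReduced_toWord
  have hbad : ¬ ∀ a ∈ w.toWord.getLast?, ∀ b ∈ w.toWord.head?, a.1 = p b.1 → a.2 = b.2 := by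
    intro hgood
    have := FreeGroup.iterate_ne_one p hred hne hgood hq
    rw [FreeGroup.mk_toWord] at this
    exact this (h 1)
  push Not at hbad
  obtain ⟨b, hb, a, ha, e1, e2⟩ := hbad
  have hlen : 2 ≤ w.toWord.length := by
    by_contra hlt
    have h1 : w.toWord.length = 1 := by
      have := List.length_pos_of_ne_nil hne
      omega
    obtain ⟨c, hc⟩ := List.length_eq_one_iff.1 h1
    rw [hc] at ha hb
    simp only [List.head?_cons, List.getLast?_singleton, Option.mem_def, Option.some.injEq] at ha hb
    exact e2 (by rw [← ha, ← hb])
  obtain ⟨a', M, b', hw⟩ := List.eq_cons_append_singleton hlen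
  obtain rfl : a' = a := by simpa [hw] using ha
  obtain rfl : b' = b := by
    rw [hw, ← List.cons_append, List.getLast?_append] at hb
    simpa using hb
  set x : FreeGroup X := FreeGroup.mk [a'] with hx
  have hbx : FreeGroup.mk [b'] = (FreeGroup.map p x)⁻¹ := by
    rw [hx, FreeGroup.map.mk, FreeGroup.inv_mk]
    simp only [List.map_cons, List.map_nil, FreeGroup.invRev, List.reverse_cons, List.reverse_nil,
      List.nil_append]
    have : b' = (p a'.1, !a'.2) := Prod.ext e1 (by
      change b'.2 = !a'.2
      cases hb2 : b'.2 <;> cases ha2 : a'.2 <;> simp_all)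
    rw [this]
  have hw' : w = x * FreeGroup.mk M * (FreeGroup.map p x)⁻¹ := by
    rw [← hbx, hx, FreeGroup.mul_mk, FreeGroup.mul_mk, ← FreeGroup.mk_toWord (x := w), hw]
    rfl
  have hnorm : (FreeGroup.mk M).norm < w.norm := by
    refine lt_of_le_of_lt FreeGroup.norm_mk_le ?_
    rw [FreeGroup.norm, hw]
    simp
  have hconj : ∀ (k : ℕ) (y : FreeGroup X), (fun y => w * FreeGroup.map p y)^[k] (x * y) =
      x * (fun y => FreeGroup.mk M * FreeGroup.map p y)^[k] y := by
    intro k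
    induction k with
    | zero => exact fun y => rfl
    | succ k ihk =>
      intro y
      rw [Function.iterate_succ_apply', Function.iterate_succ_apply', ihk]
      rw [_root_.map_mul]
      conv_lhs => rw [hw']
      group
  obtain ⟨u, hu⟩ := ih _ hnorm (FreeGroup.mk M) (fun y => by
    have := h (x * y)
    rw [hconj] at this
    exact mul_left_cancel this) rfl
  refine ⟨u * x⁻¹, ?_⟩
  rw [hw', hu, _root_.map_mul, _root_.map_inv]
  group

namespace Braid

open Noncrossing Equiv SemidirectProduct

variable {m : ℕ}

/-- The annular rotation. -/
def annularRot (m : ℕ) : Annular m := inl (freeGen m 0) * inr (deltaSmall m)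

theorem artinAction_prodRange (k : ℕ) (hk : k < m) (j : ℕ) (hj : j < m) :
    artinAction m (prodRange (sigmaB m) k) (freeGen m j) =
      if j = k then freeGen m 0
      else if j < k then (freeGen m 0)⁻¹ * freeGen m (j + 1) * freeGen m 0
      else freeGen m j := by
  induction k generalizing j with
  | zero =>
    rw [prodRange_zero, map_one, MulAut.one_apply]
    split_ifs with h
    · rw [h]
    · omega
    · rfl
  | succ k ih =>
    rw [prodRange_succ, map_mul, MulAut.mul_apply, artinAction_sigmaB hk]
    rcases (by omega : j = k ∨ j = k + 1 ∨ (j ≠ k ∧ j ≠ k + 1)) with rfl | rfl | ⟨h1, h2⟩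
    · rw [artin_freeGen_self hk, map_mul, map_mul, map_inv, ih (by omega) _ (by omega),
        ih (by omega) _ hk, if_pos rfl, if_neg (by omega), if_neg (by omega), if_neg (by omega),
        if_pos (by omega)]
    · rw [artin_freeGen_succ hk, ih (by omega) _ (by omega), if_pos rfl, if_pos rfl]
    · rw [artin_freeGen_of_ne h1 h2, ih (by omega) _ hj, if_neg h1, if_neg h2]
      split_ifs <;> first | rfl | omega

theorem annularRot_mul_inl (x : FreeGroup (Fin m)) :
    annularRot m * inl x = inl (FreeGroup.map (finRotate m) x) * annularRot m := by
  rcases Nat.eq_zero_or_pos m with rfl | hm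
  · have : x = 1 := Subsingleton.elim _ _
    rw [this, map_one, map_one, map_one, one_mul, mul_one]
  suffices (MulAut.conj (freeGen m 0)).toMonoidHom.comp
      (artinAction m (deltaSmall m)).toMonoidHom = FreeGroup.map (finRotate m) by
    rw [← this, annularRot, mul_assoc, inr_mul_inl, ← mul_assoc, ← mul_assoc, ← map_mul, ← map_mul]
    change _ = inl (freeGen m 0 * (artinAction m (deltaSmall m)) x * (freeGen m 0)⁻¹ *
      freeGen m 0) * _
    rw [inv_mul_cancel_right]
  apply freeGen_hom_ext
  intro j hj
  change freeGen m 0 * (artinAction m (deltaSmall m)) (freeGen m j) * (freeGen m 0)⁻¹ = _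
  rw [deltaSmall_eq, artinAction_prodRange (m - 1) (by omega) j hj]
  have e : FreeGroup.map (finRotate m) (freeGen m j) =
      freeGen m ((finRotate m ⟨j, hj⟩ : Fin m) : ℕ) := by
    rw [freeGen, dif_pos hj, FreeGroup.map.of, freeGen_val]
  rw [e]
  rcases rot_val (⟨j, hj⟩ : Fin m) with h | h
  · have h1 := h.1
    have h2 := h.2
    simp only at h1 h2
    rw [h1, if_neg (by omega), if_pos (by omega)]
    group
  · have h1 := h.1
    have h2 := h.2
    simp only at h1 h2
    rw [h1, if_pos (by omega), mul_inv_cancel_right]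

theorem annularRot_zpow_mul_inl (j : ℤ) (x : FreeGroup (Fin m)) :
    annularRot m ^ j * inl x = inl (FreeGroup.map ⇑(finRotate m ^ j) x) * annularRot m ^ j := by
  let K : Subgroup (Annular m × Perm (Fin m)) :=
    { carrier := {g | ∀ x, g.1 * inl x = inl (FreeGroup.map g.2 x) * g.1}
      one_mem' := fun x => by
        change 1 * inl x = inl (FreeGroup.map id x) * 1
        rw [FreeGroup.map.id, one_mul, mul_one]
      mul_mem' := fun {a b} ha hb x => by
        change a.1 * b.1 * inl x = inl (FreeGroup.map (a.2 ∘ b.2) x) * (a.1 * b.1)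
        rw [← FreeGroup.map.comp, mul_assoc, hb, ← mul_assoc, ha, mul_assoc]
      inv_mem' := fun {a} ha x => by
        change a.1⁻¹ * inl x = inl (FreeGroup.map ⇑(a.2⁻¹) x) * a.1⁻¹
        rw [inv_mul_eq_iff_eq_mul, ← mul_assoc, ha, FreeGroup.map.comp, mul_inv_cancel_right]
        have : (a.2 : Fin m → Fin m) ∘ (a.2⁻¹ : Perm (Fin m)) = id := by
          funext y
          exact Equiv.apply_symm_apply a.2 y
        rw [this, FreeGroup.map.id] }
  have h : ((annularRot m, finRotate m) : Annular m × Perm (Fin m)) ∈ K := annularRot_mul_inl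
  exact K.zpow_mem h j x

theorem annularBraid_annularRot (hm : 1 ≤ m) :
    annularBraid m (annularRot m) = sigmaB (m + 1) 0 * deltaSmall (m + 1) := by
  obtain ⟨m, rfl⟩ : ∃ k, m = k + 1 := ⟨m - 1, by omega⟩
  rw [annularRot, map_mul, annularBraid_freeGen (by omega), strandLoop, prodRange_zero, one_mul,
    inv_one, mul_one, deltaSmall_eq, deltaSmall_eq]
  simp only [Nat.add_sub_cancel]
  rw [prodRange_succ', ← mul_assoc, ← pow_two]
  congr 1
  have := map_prodRange ((annularBraid (m + 1)).comp inr) (sigmaB (m + 1)) m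
  rw [MonoidHom.comp_apply] at this
  rw [this]
  exact prodRange_congr fun i hi => annularBraid_sigmaB (by omega)

theorem annularBraid_annularRot_conj (hm : 1 ≤ m) :
    annularBraid m (annularRot m) =
      (deltaSmall (m + 1))⁻¹ * alphaB (m + 1) * deltaSmall (m + 1) := by
  rw [annularBraid_annularRot hm, alphaB, inv_mul_cancel_left]

theorem annularBraid_annularRot_pow (hm : 1 ≤ m) :
    annularBraid m (annularRot m ^ m) = deltaSmall (m + 1) ^ (m + 1) := by
  have h : alphaB (m + 1) ^ m = deltaSmall (m + 1) ^ (m + 1) := alphaB_pow (m + 1) (by omega)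
  have hc : ∀ (a b : BraidGroup (m + 1)) (k : ℕ), (a⁻¹ * b * a) ^ k = a⁻¹ * b ^ k * a := by
    intro a b k
    have := conj_pow (a := a⁻¹) (b := b) (i := k)
    rwa [inv_inv] at this
  rw [map_pow, annularBraid_annularRot_conj hm, hc, h, (deltaSmall_pow_commute _).inv_right.eq.symm,
    inv_mul_cancel_right]

/-- An element of the coset of a power of the annular rotation is conjugate to this power if they
have a common central power. -/
theorem annular_conj {w : FreeGroup (Fin m)} {j : ℤ} {q : ℕ} (hq : q ≠ 0)
    (hpow : (inl w * annularRot m ^ j : Annular m) ^ q = (annularRot m ^ j) ^ q)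
    (hcent : ∀ e : Annular m, Commute ((annularRot m ^ j) ^ q) e) :
    ∃ u, (inl w * annularRot m ^ j : Annular m) = u⁻¹ * annularRot m ^ j * u := by
  have key : ∀ (k : ℕ) (x : FreeGroup (Fin m)),
      (inl w * annularRot m ^ j : Annular m) ^ k * inl x =
        inl ((fun x => w * FreeGroup.map ⇑(finRotate m ^ j) x)^[k] x) * (annularRot m ^ j) ^ k := by
    intro k
    induction k with
    | zero =>
      intro x
      rw [pow_zero, pow_zero, one_mul, mul_one]
      rfl
    | succ k ih =>
      intro x
      rw [pow_succ', mul_assoc, ih, Function.iterate_succ_apply', ← mul_assoc, mul_assoc (inl w),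
        annularRot_zpow_mul_inl, pow_succ', map_mul]
      simp only [mul_assoc]
  obtain ⟨u, hu⟩ := FreeGroup.exists_eq_inv_mul_map (finRotate m ^ j) hq w fun x => by
    have := key q x
    rw [hpow, (hcent _).eq] at this
    exact (inl_injective (mul_right_cancel this)).symm
  refine ⟨inl u, ?_⟩
  rw [mul_assoc, annularRot_zpow_mul_inl, ← mul_assoc, ← map_inv, ← map_mul, ← hu]

end Braid

namespace Braid

open Noncrossing Equiv SemidirectProduct

variable {n m : ℕ}

theorem deltaSmall_pow_zpow_commute (t : ℤ) (x : BraidGroup n) :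
    Commute ((deltaSmall n ^ n) ^ t) x := (deltaSmall_pow_commute x).zpow_left t

theorem exists_coprime_root {w : BraidGroup n} {k : ℕ} (hk : k ≠ 0) {N : ℤ}
    (h : w ^ k = deltaSmall n ^ N) :
    ∃ (q : ℕ) (t : ℤ), q ≠ 0 ∧ IsCoprime (q : ℤ) t ∧ ∃ y, w ^ q * y = y * deltaSmall n ^ t := by
  have hg : Int.gcd k N ≠ 0 := by
    rw [Ne, Int.gcd_eq_zero_iff]
    omega
  obtain ⟨q, hq⟩ : Int.gcd k N ∣ k := by exact_mod_cast Int.gcd_dvd_left (k : ℤ) N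
  obtain ⟨t, ht⟩ := Int.gcd_dvd_right (k : ℤ) N
  refine ⟨q, t, ?_, ?_, ?_⟩
  · rintro rfl
    exact hk (by rw [hq, mul_zero])
  · rw [Int.isCoprime_iff_gcd_eq_one]
    have e : Int.gcd k N = Int.gcd k N * Int.gcd q t := by
      have hk' : (k : ℤ) = (Int.gcd k N : ℤ) * q := by exact_mod_cast hq
      have e' := Int.gcd_mul_left (Int.gcd k N : ℤ) q t
      rwa [← hk', ← ht, Int.natAbs_natCast] at e'
    exact (Nat.eq_of_mul_eq_mul_left (Nat.pos_of_ne_zero hg) (by rw [← e, mul_one])).symm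
  · refine exists_conj_of_pow_eq (g := Int.gcd k N) ?_ hg
    rw [← pow_mul, mul_comm, ← hq, h, ← zpow_natCast, ← zpow_mul, mul_comm, ← ht]

theorem dvd_of_conj_deltaSmall {w y : BraidGroup n} {q : ℕ} {t : ℤ}
    (hc : IsCoprime (q : ℤ) t) (h : w ^ q * y = y * deltaSmall n ^ t) : q ∣ n - 1 := by
  have e := congrArg (fun x => Multiplicative.toAdd (expSum n x)) h
  simp only [map_mul, map_pow, map_zpow, expSum_deltaSmall, toAdd_mul, toAdd_pow, toAdd_zpow,
    toAdd_ofAdd, nsmul_eq_mul, zsmul_eq_mul] at e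
  rw [add_comm, add_left_cancel_iff] at e
  have : (q : ℤ) ∣ t * ((n - 1 : ℕ) : ℤ) := ⟨_, by simpa using e.symm⟩
  exact_mod_cast hc.dvd_of_dvd_mul_left this

theorem exists_fixed_strand {w y : BraidGroup n} {q : ℕ} {t : ℤ} (hn : 1 ≤ n) (hq : q ≠ 1)
    (hc : IsCoprime (q : ℤ) t) (h : w ^ q * y = y * deltaSmall n ^ t) :
    ∃ a, perm n w a = a := by
  obtain ⟨r, hr, q', rfl⟩ := Nat.exists_prime_and_dvd hq
  have hdvd := (dvd_mul_right r q').trans (dvd_of_conj_deltaSmall hc h)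
  have hw : (w ^ (q' * n)) ^ r = (deltaSmall n ^ n) ^ t := by
    have e : w ^ (r * q') = y * deltaSmall n ^ t * y⁻¹ := eq_mul_inv_of_mul_eq h
    have e2 : w ^ (r * q' * n) = (deltaSmall n ^ n) ^ t := by
      rw [pow_mul, e, conj_pow, ← zpow_natCast, ← zpow_mul, mul_comm t, zpow_mul, zpow_natCast,
        ← (deltaSmall_pow_zpow_commute t y).eq, mul_inv_cancel_right]
    rw [← e2, ← pow_mul]
    congr 1
    ring
  have hrn : ¬ r ∣ Fintype.card (Fin n) := by
    rw [Fintype.card_fin]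
    intro h1
    have h2 := (Nat.dvd_sub h1 hdvd)
    rw [show n - (n - 1) = 1 by omega] at h2
    exact hr.one_lt.ne' (Nat.dvd_one.1 h2)
  have hp : perm n (w ^ (q' * n)) ^ r ^ 1 = 1 := by
    rw [pow_one, ← map_pow, hw, map_zpow, map_pow, perm_deltaSmall, rot_pow, one_zpow]
  have := Fact.mk hr
  obtain ⟨a, ha⟩ := Perm.exists_fixed_point_of_prime hrn hp
  refine ⟨a, ?_⟩
  by_contra hne
  have hb : perm n (w ^ (q' * n)) (perm n w a) = perm n w a := by
    rw [← Perm.mul_apply, ← map_mul, ← pow_succ, pow_succ', map_mul, Perm.mul_apply, ha]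
  have h3 := dvd_of_pow_eq_of_fixes hw hne hb ha
  have h4 : (r : ℤ) ∣ ((r * q' : ℕ) : ℤ) := by exact_mod_cast dvd_mul_right r q'
  have h5 := hc.isUnit_of_dvd' h4 h3
  rw [Int.isUnit_iff] at h5
  have := hr.one_lt
  omega

theorem dvd_of_rot_zpow_apply_eq {t : ℤ} {a : Fin n} (h : (finRotate n ^ t) a = a) :
    (n : ℤ) ∣ t := by
  have hn : (0 : ℤ) < n := by
    have := a.2
    omega
  obtain ⟨k, hk⟩ := Int.eq_ofNat_of_zero_le (Int.emod_nonneg t hn.ne')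
  have hkn : k < n := by
    have := Int.emod_lt_of_pos t hn
    omega
  have e : finRotate n ^ t = finRotate n ^ k := by
    conv_lhs => rw [← Int.emod_add_mul_ediv t n, zpow_add, zpow_mul, zpow_natCast, rot_pow,
      one_zpow, mul_one, hk, zpow_natCast]
  rw [e] at h
  have h1 := congrArg Fin.val h
  rw [rot_pow_val] at h1
  have h2 := Nat.mod_add_div ((a : ℕ) + k) n
  have h3 : k = 0 := by
    have h4 : n * (((a : ℕ) + k) / n) = k := by omega
    rcases Nat.eq_zero_or_pos (((a : ℕ) + k) / n) with h5 | h5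
    · rw [h5, mul_zero] at h4
      exact h4.symm
    · have := Nat.le_mul_of_pos_right n h5
      omega
  apply Int.dvd_of_emod_eq_zero
  rw [hk, h3]
  rfl

theorem isConj_alphaB_of_fixes_zero (hm : 1 ≤ m) {w : BraidGroup (m + 1)}
    (h0 : perm (m + 1) w 0 = 0) {q : ℕ} (hq : q ≠ 0) (hqm : q ∣ m) {t : ℤ}
    (h : w ^ q = (deltaSmall (m + 1) ^ (m + 1)) ^ t) :
    ∃ j : ℤ, IsConj w (alphaB (m + 1) ^ j) := by
  obtain ⟨e, rfl⟩ := exists_annularBraid_eq h0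
  obtain ⟨l, hl⟩ := hqm
  have he : e ^ q = (annularRot m ^ m) ^ t := by
    apply annularBraid_injective m
    rw [map_pow, h, map_zpow, annularBraid_annularRot_pow hm]
  have hcent : ∀ x : Annular m, Commute ((annularRot m ^ m) ^ t) x := by
    intro x
    apply annularBraid_injective m
    rw [map_mul, map_mul, map_zpow, annularBraid_annularRot_pow hm]
    exact deltaSmall_pow_zpow_commute t _
  have hj : (annularRot m ^ m) ^ t = (annularRot m ^ ((l : ℤ) * t)) ^ q := by
    rw [← zpow_natCast, ← zpow_natCast, ← zpow_mul, ← zpow_mul]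
    congr 1
    rw [hl]
    push_cast
    ring
  have hright : rightHom (annularRot m) = deltaSmall m := by
    rw [annularRot, map_mul, rightHom_inl, rightHom_inr, one_mul]
  obtain ⟨y, hy⟩ := exists_conj_of_pow_eq (w := rightHom e) (t := (l : ℤ) * t) (g := q) (by
    rw [← map_pow, he, hj, map_pow, map_zpow, hright]) hq
  obtain ⟨w, hw⟩ : ∃ w, (inr y)⁻¹ * e * inr y =
      (inl w : Annular m) * annularRot m ^ ((l : ℤ) * t) := by
    have hk : (inr y)⁻¹ * e * inr y * (annularRot m ^ ((l : ℤ) * t))⁻¹ ∈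
        (rightHom : Annular m →* BraidGroup m).ker := by
      rw [MonoidHom.mem_ker, map_mul, map_mul, map_mul, map_inv, map_inv, map_zpow, hright,
        rightHom_inr, mul_assoc y⁻¹, hy]
      group
    rw [← range_inl_eq_ker_rightHom] at hk
    obtain ⟨w, hw⟩ := hk
    exact ⟨w, by rw [hw, inv_mul_cancel_right]⟩
  obtain ⟨u, hu⟩ := annular_conj (w := w) hq (by
    rw [← hw, ← hj, ← he]
    have := conj_pow (a := (inr y : Annular m)⁻¹) (b := e) (i := q)
    rw [inv_inv] at this
    rw [this, he, ← ((hcent (inr y)⁻¹).eq), inv_mul_cancel_right]) (by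
    rw [← hj]
    exact hcent)
  refine ⟨l * t, isConj_iff.2 ?_⟩
  have h3 : e = (u * (inr y)⁻¹)⁻¹ * annularRot m ^ ((l : ℤ) * t) * (u * (inr y)⁻¹) := by
    have : e = inr y * ((inr y)⁻¹ * e * inr y) * (inr y)⁻¹ := by group
    rw [this, hw, hu]
    group
  generalize u * (inr y)⁻¹ = v at h3
  have h4 : ∀ (a b : BraidGroup (m + 1)) (k : ℤ), (a⁻¹ * b * a) ^ k = a⁻¹ * b ^ k * a := by
    intro a b k
    have := conj_zpow (a := a⁻¹) (b := b) (i := k)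
    rwa [inv_inv] at this
  have h5 := congrArg (annularBraid m) h3
  rw [map_mul, map_mul, map_inv, map_zpow, annularBraid_annularRot_conj hm, h4] at h5
  refine ⟨deltaSmall (m + 1) * annularBraid m v, ?_⟩
  rw [h5]
  group

theorem isConj_of_pow_eq (hn : 2 ≤ n) {w : BraidGroup n} {k : ℕ} (hk : k ≠ 0) {N : ℤ}
    (h : w ^ k = deltaSmall n ^ N) :
    ∃ j : ℤ, IsConj w (deltaSmall n ^ j) ∨ IsConj w (alphaB n ^ j) := by
  obtain ⟨q, t, hq, hc, y, hy⟩ := exists_coprime_root hk h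
  by_cases hq1 : q = 1
  · refine ⟨t, Or.inl ((isConj_iff.2 ⟨y, ?_⟩ : IsConj (deltaSmall n ^ t) w).symm)⟩
    rw [hq1, pow_one] at hy
    rw [← hy, mul_inv_cancel_right]
  obtain ⟨a, ha⟩ := exists_fixed_strand (by omega) hq1 hc hy
  have hdvd := dvd_of_conj_deltaSmall hc hy
  have e : w ^ q = y * deltaSmall n ^ t * y⁻¹ := eq_mul_inv_of_mul_eq hy
  have hfix : perm n (w ^ q) a = a := by
    rw [map_pow]
    exact Function.IsFixedPt.perm_pow ha q
  obtain ⟨t', rfl⟩ : (n : ℤ) ∣ t := by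
    refine dvd_of_rot_zpow_apply_eq (a := (perm n y)⁻¹ a) ?_
    rw [e, map_mul, map_mul, map_inv, map_zpow, perm_deltaSmall, Perm.mul_apply,
      Perm.mul_apply] at hfix
    exact ((Perm.inv_eq_iff_eq.2 hfix.symm)).symm
  have e' : w ^ q = (deltaSmall n ^ n) ^ t' := by
    rw [e, zpow_mul, zpow_natCast, ← (deltaSmall_pow_zpow_commute t' y).eq, mul_inv_cancel_right]
  obtain ⟨m, rfl⟩ : ∃ m, n = m + 1 := ⟨n - 1, by omega⟩
  have hrot : perm (m + 1) (deltaSmall (m + 1) ^ (a : ℕ)) 0 = a := by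
    rw [map_pow, perm_deltaSmall]
    apply Fin.ext
    rw [rot_pow_val, Fin.val_zero, zero_add, Nat.mod_eq_of_lt a.2]
  have hinv : (deltaSmall (m + 1) ^ (a : ℕ))⁻¹⁻¹ = deltaSmall (m + 1) ^ (a : ℕ) := inv_inv _
  obtain ⟨j, hj⟩ := isConj_alphaB_of_fixes_zero (by omega)
    (w := (deltaSmall (m + 1) ^ (a : ℕ))⁻¹ * w * (deltaSmall (m + 1) ^ (a : ℕ))⁻¹⁻¹)
    (by
      rw [hinv, map_mul, map_mul, Perm.mul_apply, Perm.mul_apply, hrot, ha, map_inv,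
        Perm.inv_eq_iff_eq, hrot]) hq (by simpa using hdvd) (t := t') (by
      rw [conj_pow, e', ← (deltaSmall_pow_zpow_commute t' _).eq, mul_inv_cancel_right])
  exact ⟨j, Or.inr ((isConj_iff.2 ⟨_, rfl⟩).trans hj)⟩

theorem pow_eq_of_isConj {w v : BraidGroup n} (h : IsConj w v) {k : ℕ} {j : ℤ}
    (hv : v ^ k = (deltaSmall n ^ n) ^ j) : w ^ k = (deltaSmall n ^ n) ^ j := by
  obtain ⟨c, hc⟩ := isConj_iff.1 h.symm
  rw [← hc, conj_pow, hv, ← (deltaSmall_pow_zpow_commute j c).eq, mul_inv_cancel_right]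

end Braid

/-- (Kerékjártó, Eilenberg) In `Bₙ` (n ≥ 2), with `δ = σ₁ ⋯ σ_{n-1}` and
`α = σ₁ ⋯ σ_{n-1} σ₁`, one has `δⁿ = α^{n-1} = Δₙ²`, and `ω ∈ Bₙ` is periodic
(some power `ω ^ k` with `k ≥ 1` is an integer power of the full twist `Δₙ²`)
if and only if `ω` is conjugate to `δ ^ j` or to `α ^ j` for some integer `j`. -/
theorem periodic_braids_classification (n : ℕ) (hn : 2 ≤ n) :
    deltaSmall n ^ n = deltaB n ^ 2 ∧
    alphaB n ^ (n - 1) = deltaB n ^ 2 ∧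
    ∀ ω : BraidGroup n,
      (∃ k : ℤ, 1 ≤ k ∧ ∃ m : ℤ, ω ^ k = (deltaB n ^ 2) ^ m) ↔
      (∃ j : ℤ, IsConj ω (deltaSmall n ^ j) ∨ IsConj ω (alphaB n ^ j)) := by
  have h1 := Braid.deltaSmall_pow n (by omega)
  have h2 := Braid.alphaB_pow n hn
  refine ⟨h1, h2.trans h1, fun w => ?_⟩
  rw [← h1]
  constructor
  · rintro ⟨k, hk, M, h⟩
    obtain ⟨k, rfl⟩ := Int.eq_ofNat_of_zero_le (by omega : 0 ≤ k)
    rw [zpow_natCast, ← zpow_natCast (deltaSmall n), ← zpow_mul] at h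
    exact Braid.isConj_of_pow_eq hn (by omega) h
  · rintro ⟨j, h | h⟩
    · refine ⟨n, by omega, j, ?_⟩
      rw [zpow_natCast]
      refine Braid.pow_eq_of_isConj h ?_
      rw [← zpow_natCast, ← zpow_natCast, ← zpow_mul, ← zpow_mul, mul_comm]
    · refine ⟨(n - 1 : ℕ), by omega, j, ?_⟩
      rw [zpow_natCast]
      refine Braid.pow_eq_of_isConj h ?_
      rw [← h2, ← zpow_natCast, ← zpow_natCast, ← zpow_mul, ← zpow_mul, mul_comm]
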